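/- Let μ be a Borel probability measure on SL₂(ℝ) with a finite exponential moment whose support generates a Zariski dense subgroup, and let ν be the unique μ-stationary measure on X = ℙ(ℝ²), identified with ℝ/πℤ. Let φ : ℝ/πℤ → ℝ/πℤ be a C² diffeomorphism. Then the pushforward φ_*ν is a Rajchman measure: the Fourier coefficients (φ_*ν)^(k) = ∫ e^{2ikφ(θ)} dν(θ) tend to 0 as |k| → ∞. -/

import Mathlib

open MeasureTheory Filter

noncomputable section

abbrev SL2 := Matrix.SpecialLinearGroup (Fin 2) ℝ

abbrev PX := Projectivization ℝ (Fin 2 → ℝ)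

instance : TopologicalSpace SL2 := instTopologicalSpaceSubtype
instance : TopologicalSpace PX := instTopologicalSpaceQuotient
instance : MeasurableSpace SL2 := borel _
instance : MeasurableSpace PX := borel _

/-- Euclidean norm on ℝ². -/
def enorm2 (v : Fin 2 → ℝ) : ℝ := Real.sqrt (v 0 ^ 2 + v 1 ^ 2)

/-- Operator norm of g ∈ SL₂(ℝ) w.r.t. the Euclidean norm on ℝ². -/
def opNorm (g : SL2) : ℝ :=
  ‖Matrix.toEuclideanCLM (𝕜 := ℝ) (n := Fin 2) (g : Matrix (Fin 2) (Fin 2) ℝ)‖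

/-- Cartan projection κ(g) = log ‖g‖. -/
def kappa (g : SL2) : ℝ := Real.log (opNorm g)

/-- The projective action of SL₂(ℝ) on ℙ(ℝ²). -/
def act (g : SL2) (x : PX) : PX :=
  Projectivization.map ((Matrix.SpecialLinearGroup.toLin' g).toLinearMap)
    (LinearEquiv.injective _) x

/-- The norm cocycle σ(g, ℝv) = log (‖gv‖/‖v‖). -/
def cocycle (g : SL2) (x : PX) : ℝ :=
  Real.log (enorm2 ((g : Matrix (Fin 2) (Fin 2) ℝ).mulVec x.rep) / enorm2 x.rep)

/-- The sine distance d(ℝv, ℝw) = |det(v,w)|/(‖v‖‖w‖) on ℙ(ℝ²). -/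
def projDist (x y : PX) : ℝ :=
  |x.rep 0 * y.rep 1 - x.rep 1 * y.rep 0| / (enorm2 x.rep * enorm2 y.rep)

/-- An angle θ(x) ∈ ℝ representing x = ℝ(cos θ, sin θ). -/
def pangle (x : PX) : ℝ := Complex.arg (x.rep 0 + x.rep 1 * Complex.I)

/-- The (topological) support of a measure. -/
def measSupp (μ : Measure SL2) : Set SL2 :=
  {g | ∀ U : Set SL2, IsOpen U → g ∈ U → 0 < μ U}

/-- μ has a finite exponential moment. -/
def HasExpMoment (μ : Measure SL2) : Prop :=
  ∃ ε₁ > (0 : ℝ), ∫⁻ g, ENNReal.ofReal (opNorm g ^ ε₁) ∂μ < ⊤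

/-- The group generated by the support of μ is Zariski dense in SL₂(ℝ),
equivalently it is not solvable. -/
def ZariskiDense (μ : Measure SL2) : Prop :=
  ¬ IsSolvable (Subgroup.closure (measSupp μ))

/-- ν is μ-stationary: μ ∗ ν = ν. -/
def IsMuStationary (μ : Measure SL2) (ν : Measure PX) : Prop :=
  μ.bind (fun g => ν.map (act g)) = ν

/-- The product g₁ ⋯ gₙ of a word (g₁, …, gₙ). -/
def word {n : ℕ} (g : Fin n → SL2) : SL2 := (List.ofFn g).prod

/-- The product measure μ^{⊗n} on words of length n. -/
def μpi (μ : Measure SL2) (n : ℕ) : Measure (Fin n → SL2) := Measure.pi fun _ => μ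

set_option linter.all false
set_option linter.deprecated false

section


open scoped ENNReal NNReal Topology

instance : BorelSpace SL2 := ⟨rfl⟩
instance : BorelSpace PX := ⟨rfl⟩

instance : SecondCountableTopology (Matrix (Fin 2) (Fin 2) ℝ) :=
  inferInstanceAs (SecondCountableTopology (Fin 2 → Fin 2 → ℝ))

instance : SecondCountableTopology SL2 :=
  TopologicalSpace.Subtype.secondCountableTopology _

instance : T2Space SL2 := inferInstanceAs (T2Space {A : Matrix (Fin 2) (Fin 2) ℝ // A.det = 1})

theorem continuous_entry (i j : Fin 2) : Continuous (fun g : SL2 => g.1 i j) :=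
  (continuous_apply_apply i j).comp continuous_subtype_val

@[fun_prop]
theorem measurable_entry (i j : Fin 2) : Measurable (fun g : SL2 => g.1 i j) :=
  (continuous_entry i j).measurable

instance : ContinuousMul SL2 where
  continuous_mul := by
    refine Continuous.subtype_mk (f := fun p : SL2 × SL2 => p.1.1 * p.2.1) ?_ _
    exact (continuous_subtype_val.comp continuous_fst).matrix_mul
      (continuous_subtype_val.comp continuous_snd)

instance : MeasurableMul₂ SL2 := inferInstance

theorem SL2.det_eq (g : SL2) : g.1 0 0 * g.1 1 1 - g.1 0 1 * g.1 1 0 = 1 := by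
  have := g.2; rwa [Matrix.det_fin_two] at this

/-- row action -/
def ra (u : ℂ) (g : SL2) : ℂ :=
  ⟨u.re * g.1 0 0 + u.im * g.1 1 0, u.re * g.1 0 1 + u.im * g.1 1 1⟩

/-- column action -/
def ca (g : SL2) (x : ℂ) : ℂ :=
  ⟨g.1 0 0 * x.re + g.1 0 1 * x.im, g.1 1 0 * x.re + g.1 1 1 * x.im⟩

def dt (u w : ℂ) : ℝ := u.re * w.im - u.im * w.re
def pr (u x : ℂ) : ℝ := u.re * x.re + u.im * x.im
/-- Frobenius norm -/
def NN (g : SL2) : ℝ := Real.sqrt (g.1 0 0 ^ 2 + g.1 0 1 ^ 2 + g.1 1 0 ^ 2 + g.1 1 1 ^ 2)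

theorem SL2.mul_apply (g h : SL2) (i j : Fin 2) :
    (g * h).1 i j = g.1 i 0 * h.1 0 j + g.1 i 1 * h.1 1 j := by
  have : (g * h).1 = g.1 * h.1 := rfl
  rw [this, Matrix.mul_apply, Fin.sum_univ_two]

@[simp] theorem ra_one (u : ℂ) : ra u 1 = u := by
  apply Complex.ext <;> simp [ra]

@[simp] theorem ca_one (u : ℂ) : ca 1 u = u := by
  apply Complex.ext <;> simp [ca]

theorem ra_mul (u : ℂ) (g h : SL2) : ra u (g * h) = ra (ra u g) h := by
  apply Complex.ext <;> simp only [ra, SL2.mul_apply] <;> ring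

theorem ca_mul (g h : SL2) (x : ℂ) : ca (g * h) x = ca g (ca h x) := by
  apply Complex.ext <;> simp only [ca, SL2.mul_apply] <;> ring

theorem dt_ra (u w : ℂ) (g : SL2) : dt (ra u g) (ra w g) = dt u w := by
  have := g.det_eq
  simp only [dt, ra]
  linear_combination (u.re * w.im - u.im * w.re) * this

theorem dt_ca (u w : ℂ) (g : SL2) : dt (ca g u) (ca g w) = dt u w := by
  have := g.det_eq
  simp only [dt, ca]
  linear_combination (u.re * w.im - u.im * w.re) * this

theorem pr_ra (u x : ℂ) (g : SL2) : pr (ra u g) x = pr u (ca g x) := by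
  simp only [pr, ca, ra]; ring

theorem ra_smul (c : ℝ) (u : ℂ) (g : SL2) : ra (c * u) g = c * ra u g := by
  apply Complex.ext <;> simp [ra] <;> ring

theorem ca_smul (c : ℝ) (u : ℂ) (g : SL2) : ca g (c * u) = c * ca g u := by
  apply Complex.ext <;> simp [ca] <;> ring

theorem ra_add (u w : ℂ) (g : SL2) : ra (u + w) g = ra u g + ra w g := by
  apply Complex.ext <;> simp [ra] <;> ring

theorem ra_sub (u w : ℂ) (g : SL2) : ra (u - w) g = ra u g - ra w g := by
  apply Complex.ext <;> simp [ra] <;> ring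

theorem pr_smul (c : ℝ) (u x : ℂ) : pr (c * u) x = c * pr u x := by
  simp [pr]; ring
theorem pr_smul' (c : ℝ) (u x : ℂ) : pr u (c * x) = c * pr u x := by
  simp [pr]; ring
theorem dt_smul (c : ℝ) (u x : ℂ) : dt (c * u) x = c * dt u x := by
  simp [dt]; ring
theorem dt_smul' (c : ℝ) (u x : ℂ) : dt u (c * x) = c * dt u x := by
  simp [dt]; ring

theorem normsq (u : ℂ) : ‖u‖ ^ 2 = u.re ^ 2 + u.im ^ 2 := by
  rw [Complex.sq_norm, Complex.normSq_apply]; ring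

theorem pr_dt (u x : ℂ) : pr u x ^ 2 + dt u x ^ 2 = (‖u‖ * ‖x‖) ^ 2 := by
  rw [mul_pow, normsq, normsq, pr, dt]; ring

theorem abs_pr_le (u x : ℂ) : |pr u x| ≤ ‖u‖ * ‖x‖ := by
  apply abs_le_of_sq_le_sq _ (by positivity)
  nlinarith [pr_dt u x, sq_nonneg (dt u x)]

theorem abs_dt_le (u x : ℂ) : |dt u x| ≤ ‖u‖ * ‖x‖ := by
  apply abs_le_of_sq_le_sq _ (by positivity)
  nlinarith [pr_dt u x, sq_nonneg (pr u x)]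

theorem pr_self (u : ℂ) : pr u u = ‖u‖ ^ 2 := by rw [normsq, pr]; ring
theorem dt_self (u : ℂ) : dt u u = 0 := by rw [dt]; ring
theorem dt_comm (u w : ℂ) : dt u w = - dt w u := by rw [dt, dt]; ring

theorem NN_sq (g : SL2) : NN g ^ 2 = g.1 0 0 ^ 2 + g.1 0 1 ^ 2 + g.1 1 0 ^ 2 + g.1 1 1 ^ 2 := by
  rw [NN, Real.sq_sqrt (by positivity)]

theorem NN_nonneg (g : SL2) : 0 ≤ NN g := Real.sqrt_nonneg _

theorem one_le_NN (g : SL2) : 1 ≤ NN g := by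
  have h := NN_sq g
  have := g.det_eq
  have := NN_nonneg g
  nlinarith [sq_nonneg (g.1 0 0 - g.1 1 1), sq_nonneg (g.1 0 1 + g.1 1 0)]

theorem NN_pos (g : SL2) : 0 < NN g := lt_of_lt_of_le one_pos (one_le_NN g)

theorem norm_ra_le (u : ℂ) (g : SL2) : ‖ra u g‖ ≤ NN g * ‖u‖ := by
  apply le_of_sq_le_sq _ (mul_nonneg (NN_nonneg g) (norm_nonneg u))
  rw [mul_pow, normsq, normsq, NN_sq, ra]
  nlinarith [sq_nonneg (u.re * g.1 1 0 - u.im * g.1 0 0), sq_nonneg (u.re * g.1 1 1 - u.im * g.1 0 1)]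

theorem norm_ca_le (u : ℂ) (g : SL2) : ‖ca g u‖ ≤ NN g * ‖u‖ := by
  apply le_of_sq_le_sq _ (mul_nonneg (NN_nonneg g) (norm_nonneg u))
  rw [mul_pow, normsq, normsq, NN_sq, ca]
  nlinarith [sq_nonneg (u.re * g.1 0 1 - u.im * g.1 0 0), sq_nonneg (u.re * g.1 1 1 - u.im * g.1 1 0)]

theorem NN_inv (g : SL2) : NN g⁻¹ = NN g := by
  simp only [NN]
  rw [Matrix.SpecialLinearGroup.SL2_inv_expl]
  simp
  congr 1; ring

theorem norm_le_ra (u : ℂ) (g : SL2) : ‖u‖ ≤ NN g * ‖ra u g‖ := by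
  have := norm_ra_le (ra u g) g⁻¹
  rwa [← ra_mul, mul_inv_cancel, ra_one, NN_inv] at this

theorem norm_le_ca (u : ℂ) (g : SL2) : ‖u‖ ≤ NN g * ‖ca g u‖ := by
  have := norm_ca_le (ca g u) g⁻¹
  rwa [← ca_mul, inv_mul_cancel, ca_one, NN_inv] at this

theorem NN_mul_le (g h : SL2) : NN (g * h) ≤ NN g * NN h := by
  apply le_of_sq_le_sq _ (mul_nonneg (NN_nonneg g) (NN_nonneg h))
  rw [mul_pow, NN_sq, NN_sq, NN_sq]
  simp only [SL2.mul_apply]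
  have key : ∀ a b c d : ℝ, (a * c + b * d) ^ 2 ≤ (a ^ 2 + b ^ 2) * (c ^ 2 + d ^ 2) := by
    intro a b c d; nlinarith [sq_nonneg (a * d - b * c)]
  nlinarith [key (g.1 0 0) (g.1 0 1) (h.1 0 0) (h.1 1 0), key (g.1 0 0) (g.1 0 1) (h.1 0 1) (h.1 1 1),
    key (g.1 1 0) (g.1 1 1) (h.1 0 0) (h.1 1 0), key (g.1 1 0) (g.1 1 1) (h.1 0 1) (h.1 1 1)]

theorem ra_ne_zero {u : ℂ} (hu : u ≠ 0) (g : SL2) : ra u g ≠ 0 := by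
  intro h
  have := norm_le_ra u g
  rw [h, norm_zero, mul_zero] at this
  exact hu (norm_le_zero_iff.mp this)

theorem ca_ne_zero {u : ℂ} (hu : u ≠ 0) (g : SL2) : ca g u ≠ 0 := by
  intro h
  have := norm_le_ca u g
  rw [h, norm_zero, mul_zero] at this
  exact hu (norm_le_zero_iff.mp this)

theorem continuous_mk {α : Type*} [TopologicalSpace α] {a b : α → ℝ} (ha : Continuous a)
    (hb : Continuous b) : Continuous (fun x => (⟨a x, b x⟩ : ℂ)) := by
  have : (fun x => (⟨a x, b x⟩ : ℂ)) = fun x => ((a x : ℂ) + (b x : ℂ) * Complex.I) := by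
    funext x; apply Complex.ext <;> simp
  rw [this]; fun_prop

theorem continuous_ra : Continuous (fun p : ℂ × SL2 => ra p.1 p.2) := by
  have h := fun i j => (continuous_entry i j).comp (continuous_snd (X := ℂ) (Y := SL2))
  have h1 := Complex.continuous_re.comp (continuous_fst (X := ℂ) (Y := SL2))
  have h2 := Complex.continuous_im.comp (continuous_fst (X := ℂ) (Y := SL2))
  exact continuous_mk ((h1.mul (h 0 0)).add (h2.mul (h 1 0))) ((h1.mul (h 0 1)).add (h2.mul (h 1 1)))

theorem continuous_ca : Continuous (fun p : SL2 × ℂ => ca p.1 p.2) := by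
  have h := fun i j => (continuous_entry i j).comp (continuous_fst (Y := ℂ) (X := SL2))
  have h1 := Complex.continuous_re.comp (continuous_snd (Y := ℂ) (X := SL2))
  have h2 := Complex.continuous_im.comp (continuous_snd (Y := ℂ) (X := SL2))
  exact continuous_mk (((h 0 0).mul h1).add ((h 0 1).mul h2)) (((h 1 0).mul h1).add ((h 1 1).mul h2))

theorem measurable_ra : Measurable (fun p : ℂ × SL2 => ra p.1 p.2) := continuous_ra.measurable
theorem measurable_ca : Measurable (fun p : SL2 × ℂ => ca p.1 p.2) := continuous_ca.measurable

@[fun_prop] theorem Measurable.ra {α : Type*} [MeasurableSpace α] {u : α → ℂ} {g : α → SL2}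
    (hu : Measurable u) (hg : Measurable g) : Measurable (fun a => _root_.ra (u a) (g a)) :=
  measurable_ra.comp (hu.prodMk hg)
@[fun_prop] theorem Measurable.ca {α : Type*} [MeasurableSpace α] {u : α → ℂ} {g : α → SL2}
    (hu : Measurable u) (hg : Measurable g) : Measurable (fun a => _root_.ca (g a) (u a)) :=
  measurable_ca.comp (hg.prodMk hu)
@[fun_prop] theorem Continuous.ra {α : Type*} [TopologicalSpace α] {u : α → ℂ} {g : α → SL2}
    (hu : Continuous u) (hg : Continuous g) : Continuous (fun a => _root_.ra (u a) (g a)) :=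
  continuous_ra.comp (hu.prodMk hg)

theorem continuous_NN : Continuous NN := by
  have h := continuous_entry
  unfold NN
  exact Real.continuous_sqrt.comp (((((h 0 0).pow 2).add ((h 0 1).pow 2)).add ((h 1 0).pow 2)).add ((h 1 1).pow 2))

@[fun_prop] theorem measurable_NN : Measurable NN := continuous_NN.measurable

@[fun_prop] theorem Measurable.pr {α : Type*} [MeasurableSpace α] {u : α → ℂ} {g : α → ℂ}
    (hu : Measurable u) (hg : Measurable g) : Measurable (fun a => _root_.pr (u a) (g a)) := by
  unfold _root_.pr; fun_prop
@[fun_prop] theorem Measurable.dt {α : Type*} [MeasurableSpace α] {u : α → ℂ} {g : α → ℂ}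
    (hu : Measurable u) (hg : Measurable g) : Measurable (fun a => _root_.dt (u a) (g a)) := by
  unfold _root_.dt; fun_prop
@[fun_prop] theorem Continuous.pr {α : Type*} [TopologicalSpace α] {u : α → ℂ} {g : α → ℂ}
    (hu : Continuous u) (hg : Continuous g) : Continuous (fun a => _root_.pr (u a) (g a)) := by
  unfold _root_.pr; fun_prop
@[fun_prop] theorem Continuous.dt {α : Type*} [TopologicalSpace α] {u : α → ℂ} {g : α → ℂ}
    (hu : Continuous u) (hg : Continuous g) : Continuous (fun a => _root_.dt (u a) (g a)) := by
  unfold _root_.dt; fun_prop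

theorem dt_eq_zero_iff {u w : ℂ} (hu : u ≠ 0) : dt u w = 0 ↔ ∃ c : ℝ, w = c * u := by
  constructor
  · intro h
    have hn : ‖u‖ ^ 2 ≠ 0 := by positivity
    refine ⟨pr u w / ‖u‖ ^ 2, ?_⟩
    rw [normsq] at *
    unfold dt at h
    apply Complex.ext
    · rw [Complex.re_ofReal_mul, pr]; field_simp; linear_combination -u.im * h
    · rw [Complex.im_ofReal_mul, pr]; field_simp; linear_combination u.re * h
  · rintro ⟨c, rfl⟩
    rw [dt_smul', dt_self, mul_zero]

theorem continuous_mk_trace : Continuous (fun g : SL2 => g.1 0 0 + g.1 1 1) :=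
  (continuous_entry 0 0).add (continuous_entry 1 1)

end

section

open scoped ENNReal NNReal Topology

/-! ### Algebra in SL2 -/

theorem SL2.ext' {g h : SL2} (h00 : g.1 0 0 = h.1 0 0) (h01 : g.1 0 1 = h.1 0 1)
    (h10 : g.1 1 0 = h.1 1 0) (h11 : g.1 1 1 = h.1 1 1) : g = h := by
  apply Subtype.ext
  ext i j
  fin_cases i <;> fin_cases j <;> assumption

theorem eq_of_ra {u w : ℂ} (huw : dt u w ≠ 0) {g h : SL2} (hu : ra u g = ra u h)
    (hw : ra w g = ra w h) : g = h := by
  have a1 := congrArg Complex.re hu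
  have a2 := congrArg Complex.im hu
  have b1 := congrArg Complex.re hw
  have b2 := congrArg Complex.im hw
  simp only [ra] at a1 a2 b1 b2
  simp only [dt] at huw
  apply SL2.ext' <;> apply mul_left_cancel₀ huw
  · linear_combination w.im * a1 - u.im * b1
  · linear_combination w.im * a2 - u.im * b2
  · linear_combination u.re * b1 - w.re * a1
  · linear_combination u.re * b2 - w.re * a2

theorem solv_of_comm (A : Set SL2) (Q : SL2 → Prop)
    (h1 : ∀ a ∈ Subgroup.closure A, ∀ b ∈ Subgroup.closure A, Q (a * b * a⁻¹ * b⁻¹))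
    (h2 : ∀ g h, Q g → Q h → g * h = h * g) : IsSolvable (Subgroup.closure A) := by
  refine ⟨⟨2, ?_⟩⟩
  rw [derivedSeries_succ, derivedSeries_one, Subgroup.commutator_eq_bot_iff_le_centralizer]
  have key : IsMulCommutative (commutator (Subgroup.closure A)) := by
    rw [commutator_eq_closure]
    apply Subgroup.isMulCommutative_closure
    rintro x ⟨a, b, rfl⟩ y ⟨c, d, rfl⟩
    apply Subtype.ext
    exact h2 _ _ (h1 _ a.2 _ b.2) (h1 _ c.2 _ d.2)
  intro x hx
  rw [Subgroup.mem_centralizer_iff]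
  intro y hy
  have := key.is_comm.comm ⟨y, hy⟩ ⟨x, hx⟩
  exact congrArg Subtype.val this

theorem ra_inv_of {u w : ℂ} {g : SL2} {c : ℝ} (hu : u ≠ 0) (h : ra u g = c * w) :
    c ≠ 0 ∧ ra w g⁻¹ = (c⁻¹ : ℝ) * u := by
  have hc : c ≠ 0 := by
    rintro rfl
    exact ra_ne_zero hu g (by simpa using h)
  refine ⟨hc, ?_⟩
  have h3 : ra (c * w) g⁻¹ = u := by rw [← h, ← ra_mul, mul_inv_cancel, ra_one]
  rw [ra_smul] at h3
  rw [← h3, ← mul_assoc, ← Complex.ofReal_mul, inv_mul_cancel₀ hc]; simp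

def par (u w : ℂ) : Prop := ∃ c : ℝ, c ≠ 0 ∧ w = c * u

theorem par_iff {u w : ℂ} (hu : u ≠ 0) (hw : w ≠ 0) : par u w ↔ dt u w = 0 := by
  rw [dt_eq_zero_iff hu]
  constructor
  · rintro ⟨c, _, h⟩; exact ⟨c, h⟩
  · rintro ⟨c, h⟩; refine ⟨c, ?_, h⟩
    rintro rfl; simp at h; exact hw h

theorem par_refl (u : ℂ) : par u u := ⟨1, one_ne_zero, by simp⟩
theorem par_trans {u v w : ℂ} (h : par u v) (h' : par v w) : par u w := by
  obtain ⟨c, hc, rfl⟩ := h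
  obtain ⟨d, hd, rfl⟩ := h'
  exact ⟨d * c, by positivity, by push_cast; ring⟩
theorem par_symm {u v : ℂ} (h : par u v) : par v u := by
  obtain ⟨c, hc, rfl⟩ := h
  refine ⟨c⁻¹, by positivity, ?_⟩
  rw [← mul_assoc, ← Complex.ofReal_mul, inv_mul_cancel₀ hc]; simp
theorem par_ra {u v : ℂ} (h : par u v) (g : SL2) : par (ra u g) (ra v g) := by
  obtain ⟨c, hc, rfl⟩ := h
  exact ⟨c, hc, ra_smul _ _ _⟩
theorem par_inv {u v : ℂ} {g : SL2} (h : par v (ra u g)) : par u (ra v g⁻¹) := by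
  have := par_ra h g⁻¹
  rw [← ra_mul, mul_inv_cancel, ra_one] at this
  exact par_symm this

theorem N1 {A : Set SL2} (hA : ¬ IsSolvable (Subgroup.closure A)) {u : ℂ} (hu : u ≠ 0) :
    ∃ g ∈ A, dt u (ra u g) ≠ 0 := by
  by_contra! hcon
  apply hA
  have hG : ∀ g ∈ Subgroup.closure A, ∃ c : ℝ, c ≠ 0 ∧ ra u g = c * u := by
    intro g hg
    change par u (ra u g)
    induction hg using Subgroup.closure_induction with
    | mem x hx => exact (par_iff hu (ra_ne_zero hu _)).2 (hcon x hx)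
    | one => rw [ra_one]; exact par_refl u
    | mul x y _ _ hx hy => rw [ra_mul]; exact par_trans hy (par_ra hx y)
    | inv x _ hx => exact par_inv hx
  apply solv_of_comm A (fun g => ra u g = u)
  · intro a ha b hb
    obtain ⟨c, hc, h1⟩ := hG a ha
    obtain ⟨d, hd, h2⟩ := hG b hb
    have h3 := (ra_inv_of hu h1).2
    have h4 := (ra_inv_of hu h2).2
    change ra u _ = u
    rw [ra_mul, ra_mul, ra_mul, h1]
    simp only [ra_smul, h2, h3, h4]
    rw [← mul_assoc, ← mul_assoc, ← mul_assoc, ← Complex.ofReal_mul, ← Complex.ofReal_mul, ← Complex.ofReal_mul]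
    rw [show c * d * c⁻¹ * d⁻¹ = 1 by field_simp]; simp
  · intro g h hg hh
    set w : ℂ := ⟨-u.im, u.re⟩ with hw
    have huw : dt u w = ‖u‖ ^ 2 := by rw [normsq, dt, hw]; simp; ring
    have hn : ‖u‖ ^ 2 ≠ 0 := by positivity
    have hw' : ∀ g : SL2, ra u g = u → ∃ c : ℝ, ra w g = w + c * u := by
      intro g hg
      have h1 := dt_ra u w g
      rw [hg] at h1
      have : dt u (ra w g - w) = 0 := by
        rw [dt] at h1 ⊢; rw [dt] at h1; simp; linarith
      obtain ⟨c, hc⟩ := (dt_eq_zero_iff hu).1 this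
      exact ⟨c, by rw [← hc]; ring⟩
    apply eq_of_ra (u := u) (w := w) (by rw [huw]; exact hn)
    · rw [ra_mul, ra_mul, hg, hh, hg]
    · obtain ⟨c, hc⟩ := hw' g hg
      obtain ⟨d, hd⟩ := hw' h hh
      rw [ra_mul, ra_mul, hc, hd, ra_add, ra_add, ra_smul, ra_smul, hc, hd, hg, hh]; ring

theorem N2 {A : Set SL2} (hA : ¬ IsSolvable (Subgroup.closure A)) {u w : ℂ} (huw : dt u w ≠ 0) :
    ∃ g ∈ A, ¬ ((par u (ra u g) ∧ par w (ra w g)) ∨ (par w (ra u g) ∧ par u (ra w g))) := by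
  by_contra! hcon
  apply hA
  have hu : u ≠ 0 := by rintro rfl; simp [dt] at huw
  have hw : w ≠ 0 := by rintro rfl; simp [dt] at huw
  have hG : ∀ g ∈ Subgroup.closure A,
      ((par u (ra u g) ∧ par w (ra w g)) ∨ (par w (ra u g) ∧ par u (ra w g))) := by
    intro g hg
    induction hg using Subgroup.closure_induction with
    | mem x hx => exact hcon x hx
    | one => rw [ra_one, ra_one]; exact Or.inl ⟨par_refl u, par_refl w⟩
    | mul x y _ _ hx hy =>
      rw [ra_mul, ra_mul]
      rcases hx with hx | hx <;> rcases hy with hy | hy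
      · exact Or.inl ⟨par_trans hy.1 (par_ra hx.1 y), par_trans hy.2 (par_ra hx.2 y)⟩
      · exact Or.inr ⟨par_trans hy.1 (par_ra hx.1 y), par_trans hy.2 (par_ra hx.2 y)⟩
      · exact Or.inr ⟨par_trans hy.2 (par_ra hx.1 y), par_trans hy.1 (par_ra hx.2 y)⟩
      · exact Or.inl ⟨par_trans hy.2 (par_ra hx.1 y), par_trans hy.1 (par_ra hx.2 y)⟩
    | inv x _ hx =>
      rcases hx with hx | hx
      · exact Or.inl ⟨par_inv hx.1, par_inv hx.2⟩
      · exact Or.inr ⟨par_inv hx.2, par_inv hx.1⟩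
  have hmul : ∀ {a b c : ℂ} {x y : SL2}, par b (ra a x) → par c (ra b y) → par c (ra a (x * y)) := by
    intro a b c x y h1 h2
    rw [ra_mul]; exact par_trans h2 (par_ra h1 y)
  apply solv_of_comm A (fun g => par u (ra u g) ∧ par w (ra w g))
  · intro a ha b hb
    rcases hG a ha with h | h <;> rcases hG b hb with h' | h'
    · exact ⟨hmul (hmul (hmul h.1 h'.1) (par_inv h.1)) (par_inv h'.1),
        hmul (hmul (hmul h.2 h'.2) (par_inv h.2)) (par_inv h'.2)⟩
    · exact ⟨hmul (hmul (hmul h.1 h'.1) (par_inv h.2)) (par_inv h'.1),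
        hmul (hmul (hmul h.2 h'.2) (par_inv h.1)) (par_inv h'.2)⟩
    · exact ⟨hmul (hmul (hmul h.1 h'.2) (par_inv h.1)) (par_inv h'.1),
        hmul (hmul (hmul h.2 h'.1) (par_inv h.2)) (par_inv h'.2)⟩
    · exact ⟨hmul (hmul (hmul h.1 h'.2) (par_inv h.2)) (par_inv h'.1),
        hmul (hmul (hmul h.2 h'.1) (par_inv h.1)) (par_inv h'.2)⟩
  · rintro g h ⟨⟨c, _, h1⟩, ⟨c', _, h1'⟩⟩ ⟨⟨d, _, h2⟩, ⟨d', _, h2'⟩⟩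
    apply eq_of_ra huw
    · rw [ra_mul, ra_mul, h1, h2, ra_smul, ra_smul, h1, h2]; ring
    · rw [ra_mul, ra_mul, h1', h2', ra_smul, ra_smul, h1', h2']; ring

end

section

open scoped ENNReal NNReal Topology

def tr (g : SL2) : ℝ := g.1 0 0 + g.1 1 1

theorem continuous_tr : Continuous tr := (continuous_entry 0 0).add (continuous_entry 1 1)

theorem SL2.inv_entries (g : SL2) : g⁻¹.1 0 0 = g.1 1 1 ∧ g⁻¹.1 0 1 = - g.1 0 1 ∧
    g⁻¹.1 1 0 = - g.1 1 0 ∧ g⁻¹.1 1 1 = g.1 0 0 := by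
  rw [Matrix.SpecialLinearGroup.SL2_inv_expl]
  simp

theorem SL2.one_entries : (1 : SL2).1 0 0 = 1 ∧ (1 : SL2).1 0 1 = 0 ∧
    (1 : SL2).1 1 0 = 0 ∧ (1 : SL2).1 1 1 = 1 := by
  simp

theorem tr_inv_limit {a : SL2} (ha : |tr a| < 2) {γ : SL2}
    (h : ∀ n : ℕ, |tr (γ * a ^ n)| ≤ 2) : |tr (γ * a⁻¹)| ≤ 2 := by
  set c : ℝ := tr a / 2 with hc
  have hc1 : c ^ 2 < 1 := by
    rw [abs_lt] at ha
    nlinarith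
  set s : ℝ := Real.sqrt (1 - c ^ 2) with hs
  have hs2 : s ^ 2 = 1 - c ^ 2 := Real.sq_sqrt (by linarith)
  have hs0 : 0 < s := Real.sqrt_pos.2 (by linarith)
  have hz : (⟨c, s⟩ : ℂ) ∈ Submonoid.unitSphere ℂ := by
    change (⟨c, s⟩ : ℂ) ∈ Metric.sphere (0 : ℂ) 1
    rw [mem_sphere_zero_iff_norm]
    have := normsq ⟨c, s⟩
    simp only at this
    nlinarith [norm_nonneg (⟨c, s⟩ : ℂ)]
  set z : Circle := ⟨⟨c, s⟩, hz⟩ with hzdef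
  have zre : (z : ℂ).re = c := rfl
  have zim : (z : ℂ).im = s := rfl
  have hdet := a.det_eq
  have htr : a.1 0 0 + a.1 1 1 = 2 * c := by rw [hc, tr]; ring
  have hp : ∀ n : ℕ, (a ^ n).1 0 0 = ((z ^ n : Circle) : ℂ).re + ((z ^ n : Circle) : ℂ).im / s * (a.1 0 0 - c)
      ∧ (a ^ n).1 0 1 = ((z ^ n : Circle) : ℂ).im / s * (a.1 0 1)
      ∧ (a ^ n).1 1 0 = ((z ^ n : Circle) : ℂ).im / s * (a.1 1 0)
      ∧ (a ^ n).1 1 1 = ((z ^ n : Circle) : ℂ).re + ((z ^ n : Circle) : ℂ).im / s * (a.1 1 1 - c) := by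
    intro n
    induction n with
    | zero => simp
    | succ n ih =>
      obtain ⟨h1, h2, h3, h4⟩ := ih
      rw [pow_succ, pow_succ]
      simp only [SL2.mul_apply, Circle.coe_mul, Complex.mul_re, Complex.mul_im, zre, zim]
      rw [h1, h2, h3, h4]
      set R := ((z ^ n : Circle) : ℂ).re
      set I := ((z ^ n : Circle) : ℂ).im
      have e11 : a.1 1 1 = 2 * c - a.1 0 0 := by linarith
      rw [e11] at hdet ⊢
      refine ⟨?_, ?_, ?_, ?_⟩ <;> field_simp <;> ring_nf
      · linear_combination (I) * hs2 - I * hdet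
      · linear_combination (I) * hs2 - I * hdet
  set f : Circle → ℝ := fun w => (w : ℂ).re * tr γ + (w : ℂ).im / s *
    (γ.1 0 0 * (a.1 0 0 - c) + γ.1 0 1 * a.1 1 0 + γ.1 1 0 * a.1 0 1 + γ.1 1 1 * (a.1 1 1 - c)) with hf
  have hfc : Continuous f := by
    have : Continuous (fun w : Circle => (w : ℂ)) := continuous_subtype_val
    have h1 : Continuous fun w : Circle => (w : ℂ).re := Complex.continuous_re.comp this
    have h2 : Continuous fun w : Circle => (w : ℂ).im := Complex.continuous_im.comp this
    exact (h1.mul continuous_const).add ((h2.div_const s).mul continuous_const)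
  have hfn : ∀ n : ℕ, f (z ^ n) = tr (γ * a ^ n) := by
    intro n
    obtain ⟨h1, h2, h3, h4⟩ := hp n
    simp only [hf, tr, SL2.mul_apply]
    rw [h1, h2, h3, h4]; ring
  have hfi : f z⁻¹ = tr (γ * a⁻¹) := by
    obtain ⟨h1, h2, h3, h4⟩ := a.inv_entries
    simp only [hf, tr, SL2.mul_apply, h1, h2, h3, h4, Circle.coe_inv_eq_conj, Complex.conj_re,
      Complex.conj_im, zre, zim]
    have e11 : a.1 1 1 = 2 * c - a.1 0 0 := by linarith
    rw [e11]
    field_simp; ring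
  have hcl : IsClosed {w : Circle | |f w| ≤ 2} := isClosed_le hfc.abs continuous_const
  have hm := mapClusterPt_inv_atTop_pow.2 (mapClusterPt_self_atTop_pow z)
  have : z⁻¹ ∈ closure {w : Circle | |f w| ≤ 2} := by
    rw [mem_closure_iff_clusterPt]
    apply hm.clusterPt.mono
    rw [Filter.le_principal_iff, Filter.mem_map]
    apply Filter.univ_mem'
    intro n
    change |f (z ^ n)| ≤ 2
    rw [hfn]; exact h n
  rw [hcl.closure_eq] at this
  have h3 : |f z⁻¹| ≤ 2 := this
  rwa [hfi] at h3

theorem comm_real {a0 a1 a2 a3 b0 b1 b2 b3 : ℝ} (da : a0 * a3 - a1 * a2 = 1)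
    (db : b0 * b3 - b1 * b2 = 1) (ha : (a0 + a3) ^ 2 < 4)
    (h' : ((a0 * b0 + a1 * b2) * a3 + (a0 * b1 + a1 * b3) * -a2) * b3 +
        ((a0 * b0 + a1 * b2) * -a1 + (a0 * b1 + a1 * b3) * a0) * -b2 +
        (((a2 * b0 + a3 * b2) * a3 + (a2 * b1 + a3 * b3) * -a2) * -b1 +
        ((a2 * b0 + a3 * b2) * -a1 + (a2 * b1 + a3 * b3) * a0) * b0) ≤ 2) :
    a1 * b2 - b1 * a2 = 0 ∧ a0 * b1 + a1 * b3 - b0 * a1 - b1 * a3 = 0 ∧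
      a2 * b0 + a3 * b2 - b2 * a0 - b3 * a2 = 0 := by
  have hneg : ((a0 - a3) / 2) ^ 2 + a1 * a2 < 0 := by
    have : ((a0 - a3) / 2) ^ 2 + a1 * a2 = ((a0 + a3) / 2) ^ 2 - 1 := by linear_combination -da
    rw [this]; linarith
  have horth : 2 * ((a0 - a3) / 2) * (a1 * b2 - b1 * a2) + a1 * (a2 * b0 + a3 * b2 - b2 * a0 - b3 * a2)
      + a2 * (a0 * b1 + a1 * b3 - b0 * a1 - b1 * a3) = 0 := by ring
  have hdet : (a1 * b2 - b1 * a2) ^ 2 + (a0 * b1 + a1 * b3 - b0 * a1 - b1 * a3) *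
      (a2 * b0 + a3 * b2 - b2 * a0 - b3 * a2) ≤ 0 := by
    refine le_of_eq_of_le ?_ (sub_nonpos.2 h')
    linear_combination (-2 * (b0 * b3 - b1 * b2)) * da + (-2) * db
  generalize a1 * b2 - b1 * a2 = s at *
  generalize a0 * b1 + a1 * b3 - b0 * a1 - b1 * a3 = t at *
  generalize a2 * b0 + a3 * b2 - b2 * a0 - b3 * a2 = w at *
  generalize (a0 - a3) / 2 = p at *
  clear h' da db ha
  have ha1 : a1 ≠ 0 := by rintro h0; rw [h0] at hneg; nlinarith [sq_nonneg p]
  have hfin : (a1 * s - p * t) ^ 2 - t ^ 2 * (p ^ 2 + a1 * a2) ≤ 0 := by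
    have : (a1 * s - p * t) ^ 2 - t ^ 2 * (p ^ 2 + a1 * a2) = a1 ^ 2 * (s ^ 2 + t * w) := by
      linear_combination (-a1 * t) * horth
    rw [this]; nlinarith [sq_nonneg a1]
  have ht0 : t = 0 := by
    by_contra hne
    have : 0 < t ^ 2 := by positivity
    nlinarith [sq_nonneg (a1 * s - p * t)]
  have hs0 : s = 0 := by
    rw [ht0] at hfin
    have h2 : (a1 * s) ^ 2 = 0 := le_antisymm (by nlinarith) (sq_nonneg _)
    exact (mul_eq_zero.1 (pow_eq_zero_iff two_ne_zero |>.1 h2)).resolve_left ha1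
  have hw0 : w = 0 := by
    rw [ht0, hs0] at horth
    have : a1 * w = 0 := by linarith
    exact (mul_eq_zero.1 this).resolve_left ha1
  exact ⟨hs0, ht0, hw0⟩

/-- if the commutator of an elliptic a with b has trace at most 2 then they commute -/
theorem comm_of_tr {a b : SL2} (ha : |tr a| < 2) (h : |tr (a * b * a⁻¹ * b⁻¹)| ≤ 2) :
    a * b = b * a := by
  obtain ⟨h1, h2, h3, h4⟩ := a.inv_entries
  obtain ⟨k1, k2, k3, k4⟩ := b.inv_entries
  have h' := (abs_le.1 h).2
  simp only [tr, SL2.mul_apply, h1, h2, h3, h4, k1, k2, k3, k4] at h'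
  rw [tr] at ha
  have ha2 : (a.1 0 0 + a.1 1 1) ^ 2 < 4 := by
    rw [abs_lt] at ha; nlinarith
  obtain ⟨hs, ht, hw⟩ := comm_real a.det_eq b.det_eq ha2 h'
  apply SL2.ext' <;> simp only [SL2.mul_apply]
  · linear_combination hs
  · linear_combination ht
  · linear_combination hw
  · linear_combination -hs

theorem parab_pow {a : SL2} {e : ℝ} (he : e ^ 2 = 1) (ha : tr a = 2 * e) (n : ℕ) :
    (a ^ n).1 0 0 = e ^ n * (1 + n * (e * a.1 0 0 - 1))
      ∧ (a ^ n).1 0 1 = e ^ n * (n * (e * a.1 0 1))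
      ∧ (a ^ n).1 1 0 = e ^ n * (n * (e * a.1 1 0))
      ∧ (a ^ n).1 1 1 = e ^ n * (1 + n * (e * a.1 1 1 - 1)) := by
  have da := a.det_eq
  rw [tr] at ha
  have e11 : a.1 1 1 = 2 * e - a.1 0 0 := by linarith
  induction n with
  | zero => simp
  | succ n ih =>
    obtain ⟨h1, h2, h3, h4⟩ := ih
    rw [pow_succ]
    simp only [SL2.mul_apply]
    rw [h1, h2, h3, h4]
    rw [e11] at da ⊢
    push_cast
    simp only [pow_succ]
    set X := a.1 0 0
    refine ⟨?_, ?_, ?_, ?_⟩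
    · linear_combination (-e ^ n * n * e) * da + e ^ n * (-X + n * X) * he
    · linear_combination (e ^ n * (n - 1) * a.1 0 1) * he
    · linear_combination (e ^ n * (n - 1) * a.1 1 0) * he
    · linear_combination (-e ^ n * n * e) * da + e ^ n * (X - n * X + 2 * n * e - 2 * e) * he

theorem N3 {A : Set SL2} (hA : ¬ IsSolvable (Subgroup.closure A)) :
    ∃ h ∈ Submonoid.closure A, 2 < |tr h| := by
  by_contra! hcon
  set S := Submonoid.closure A
  have hsub : ∀ g ∈ A, g ∈ S := fun g hg => Submonoid.subset_closure hg
  -- no parabolics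
  have hpar : ∀ a ∈ S, |tr a| = 2 → ∀ b, a * b = b * a := by
    intro a ha htr
    obtain ⟨e, he, hae⟩ : ∃ e : ℝ, e ^ 2 = 1 ∧ tr a = 2 * e := by
      rcases abs_eq (by norm_num : (0:ℝ) ≤ 2) |>.1 htr with h | h
      · exact ⟨1, by norm_num, by linarith⟩
      · exact ⟨-1, by norm_num, by linarith⟩
    have hN : ∀ γ ∈ S, (e * a.1 0 0 - 1) * γ.1 0 0 + e * a.1 0 1 * γ.1 1 0 + e * a.1 1 0 * γ.1 0 1 +
        (e * a.1 1 1 - 1) * γ.1 1 1 = 0 := by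
      intro γ hγ
      by_contra hne
      set d := (e * a.1 0 0 - 1) * γ.1 0 0 + e * a.1 0 1 * γ.1 1 0 + e * a.1 1 0 * γ.1 0 1 +
        (e * a.1 1 1 - 1) * γ.1 1 1 with hd
      obtain ⟨n, hn⟩ := exists_nat_gt (4 / |d|)
      have h1 := hcon _ (S.mul_mem (S.pow_mem ha n) hγ)
      have h2 := hcon _ hγ
      obtain ⟨p1, p2, p3, p4⟩ := parab_pow he hae n
      have h3 : tr (a ^ n * γ) = e ^ n * (tr γ + n * d) := by
        simp only [tr, SL2.mul_apply, p1, p2, p3, p4, hd]; ring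
      have he1 : |e| = 1 := by
        rw [← sq_eq_sq₀ (abs_nonneg e) zero_le_one, sq_abs]; simpa using he
      rw [h3, abs_mul, abs_pow, he1, one_pow, one_mul] at h1
      have h4 : |n * d| ≤ 4 := by
        have : n * d = (tr γ + n * d) - tr γ := by ring
        rw [this]
        calc _ ≤ |tr γ + n * d| + |tr γ| := abs_sub _ _
          _ ≤ 4 := by linarith
      rw [abs_mul, Nat.abs_cast] at h4
      have hd0 : 0 < |d| := abs_pos.2 hne
      rw [div_lt_iff₀ hd0] at hn
      linarith
    have da := a.det_eq
    rw [tr] at hae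
    have hq : (e * a.1 0 0 - 1) ^ 2 + (e * a.1 0 1) * (e * a.1 1 0) = 0 := by
      have e11 : a.1 1 1 = 2 * e - a.1 0 0 := by linarith
      rw [e11] at da
      linear_combination (-e^2) * da + (1 + 2 * e * a.1 0 0 - 2) * he - he + (2 - 2 * e * a.1 0 0 + 2 * e * a.1 0 0) * he - he
    have h11 : e * a.1 1 1 - 1 = - (e * a.1 0 0 - 1) := by linear_combination e * hae + 2 * he
    by_cases hu : (⟨e * a.1 0 0 - 1, e * a.1 0 1⟩ : ℂ) = 0
    · by_cases hw : (⟨e * a.1 1 0, -(e * a.1 0 0 - 1)⟩ : ℂ) = 0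
      · intro b
        have e1 : e * a.1 0 0 - 1 = 0 := congrArg Complex.re hu
        have e2 : e * a.1 0 1 = 0 := congrArg Complex.im hu
        have e3 : e * a.1 1 0 = 0 := congrArg Complex.re hw
        have he0 : e ≠ 0 := by rintro rfl; norm_num at he
        have f1 : a.1 0 1 = 0 := (mul_eq_zero.1 e2).resolve_left he0
        have f2 : a.1 1 0 = 0 := (mul_eq_zero.1 e3).resolve_left he0
        have f3 : a.1 0 0 = a.1 1 1 := by
          apply mul_left_cancel₀ he0; linarith
        apply SL2.ext' <;> simp only [SL2.mul_apply, f1, f2, f3] <;> ring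
      · exfalso
        obtain ⟨g, hg, hne⟩ := N1 hA hw
        apply hne
        have := hN g (hsub g hg)
        rw [h11] at this
        simp only [dt, ra]
        generalize e * a.1 0 0 - 1 = p at *
        generalize e * a.1 1 0 = r at *
        generalize e * a.1 0 1 = q at *
        linear_combination r * this - g.1 1 0 * hq
    · exfalso
      obtain ⟨g, hg, hne⟩ := N1 hA hu
      apply hne
      have := hN g (hsub g hg)
      rw [h11] at this
      simp only [dt, ra]
      generalize e * a.1 0 0 - 1 = p at *
      generalize e * a.1 1 0 = r at *
      generalize e * a.1 0 1 = q at *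
      linear_combination -q * this + g.1 0 1 * hq
  have hcomm : ∀ a ∈ S, ∀ b ∈ S, a * b = b * a := by
    intro a ha b hb
    rcases (hcon a ha).eq_or_lt with h1 | h1
    · exact hpar a ha h1 b
    rcases (hcon b hb).eq_or_lt with h2 | h2
    · exact (hpar b hb h2 a).symm
    apply comm_of_tr h1
    apply tr_inv_limit h2
    intro n
    have : tr (a * b * a⁻¹ * b ^ n) = tr ((b ^ n * (a * b)) * a⁻¹) := by
      simp only [tr, SL2.mul_apply]; ring
    rw [this]
    apply tr_inv_limit h1
    intro m
    exact hcon _ (S.mul_mem (S.mul_mem (S.pow_mem hb n) (S.mul_mem ha hb)) (S.pow_mem ha m))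
  apply hA
  have : IsMulCommutative (Subgroup.closure A) :=
    Subgroup.isMulCommutative_closure (fun x hx y hy => hcomm x (hsub x hx) y (hsub y hy))
  apply solv_of_comm A (fun g => g = 1)
  · intro a ha b hb
    have h1 := this.is_comm.comm ⟨a, ha⟩ ⟨b, hb⟩
    have h2 : a * b = b * a := congrArg Subtype.val h1
    rw [h2]; group
  · rintro g h rfl rfl; rfl

/-- eigenrows of hyperbolic elements -/
theorem hyper_eig {h : SL2} (hh : 2 < |tr h|) : ∃ (l : ℝ) (p q : ℂ), 1 < |l| ∧ dt p q = 1 ∧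
    ra p h = l * p ∧ ra q h = (l⁻¹ : ℝ) * q := by
  obtain ⟨l, hl, hl2⟩ : ∃ l : ℝ, 1 < |l| ∧ l ^ 2 - tr h * l + 1 = 0 := by
    have hd : 0 ≤ tr h ^ 2 - 4 := by
      rw [← sq_abs]; nlinarith
    set s := Real.sqrt (tr h ^ 2 - 4) with hs
    have hs2 : s ^ 2 = tr h ^ 2 - 4 := Real.sq_sqrt hd
    have hs0 : 0 ≤ s := Real.sqrt_nonneg _
    rcases le_total 0 (tr h) with h0 | h0
    · rw [abs_of_nonneg h0] at hh
      refine ⟨(tr h + s) / 2, ?_, by nlinarith⟩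
      rw [abs_of_nonneg (by linarith)]; linarith
    · rw [abs_of_nonpos h0] at hh
      refine ⟨(tr h - s) / 2, ?_, by nlinarith⟩
      rw [abs_of_nonpos (by linarith)]; linarith
  have hl0 : l ≠ 0 := by rintro rfl; norm_num at hl
  have key : ∀ m : ℝ, m ^ 2 - tr h * m + 1 = 0 → m ^ 2 ≠ 1 → ∃ u : ℂ, u ≠ 0 ∧ ra u h = m * u := by
    intro m hm hm1
    have hd := h.det_eq
    rw [tr] at hm
    by_cases hu : (⟨h.1 1 0, m - h.1 0 0⟩ : ℂ) = 0
    · by_cases hw : (⟨m - h.1 1 1, h.1 0 1⟩ : ℂ) = 0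
      · exfalso
        have e1 : h.1 1 0 = 0 := congrArg Complex.re hu
        have e2 : m - h.1 0 0 = 0 := congrArg Complex.im hu
        have e3 : m - h.1 1 1 = 0 := congrArg Complex.re hw
        apply hm1
        have : m ^ 2 = h.1 0 0 * h.1 1 1 := by
          rw [← sub_eq_zero.1 e2, ← sub_eq_zero.1 e3]; ring
        rw [this]; rw [e1] at hd; linarith
      · refine ⟨_, hw, ?_⟩
        apply Complex.ext <;> simp [ra]
        · linear_combination - hm - hd
        · ring
    · refine ⟨_, hu, ?_⟩
      apply Complex.ext <;> simp [ra]
      · ring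
      · linear_combination - hm - hd
  have hl1 : 1 < l ^ 2 := by rw [← sq_abs]; nlinarith [abs_nonneg l]
  obtain ⟨p, hp, hpe⟩ := key l hl2 (ne_of_gt hl1)
  have hinv : (l⁻¹) ^ 2 - tr h * l⁻¹ + 1 = 0 := by
    field_simp; linarith
  obtain ⟨q, hq, hqe⟩ := key l⁻¹ hinv (by
    rw [inv_pow]; exact (inv_lt_one_of_one_lt₀ hl1).ne)
  have hpq : dt p q ≠ 0 := by
    intro h0
    obtain ⟨c, hc⟩ := (dt_eq_zero_iff hp).1 h0
    rw [hc, ra_smul, hpe] at hqe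
    have hc0 : (c : ℂ) ≠ 0 := by
      intro hc0; rw [hc, hc0, zero_mul] at hq; exact hq rfl
    have : (l : ℂ) = (l⁻¹ : ℝ) := by
      have h3 : (c * p) * (l : ℂ) = (c * p) * ((l⁻¹ : ℝ) : ℂ) := by linear_combination hqe
      exact mul_left_cancel₀ (mul_ne_zero hc0 hp) h3
    have h4 : l = l⁻¹ := by exact_mod_cast this
    have h5 : l * l = 1 := by
      have := congrArg (fun t => l * t) h4
      simpa [mul_inv_cancel₀ hl0] using this
    nlinarith
  refine ⟨l, p, ((dt p q)⁻¹ : ℝ) * q, hl, ?_, hpe, ?_⟩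
  · rw [dt_smul', inv_mul_cancel₀ hpq]
  · rw [ra_smul, hqe]; ring

theorem move_pair {A : Set SL2} (hA : ¬ IsSolvable (Subgroup.closure A)) {p q : ℂ}
    (hpq : dt p q ≠ 0) : ∃ γ ∈ Submonoid.closure A, dt p (ra p γ) ≠ 0 ∧ dt q (ra p γ) ≠ 0 := by
  by_contra! hcon
  have hp : p ≠ 0 := by rintro rfl; simp [dt] at hpq
  have hq : q ≠ 0 := by rintro rfl; simp [dt] at hpq
  have hc : ∀ γ ∈ Submonoid.closure A, par p (ra p γ) ∨ par q (ra p γ) := by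
    intro γ hγ
    rw [par_iff hp (ra_ne_zero hp _), par_iff hq (ra_ne_zero hp _)]
    by_cases h : dt p (ra p γ) = 0
    · exact Or.inl h
    · exact Or.inr (hcon γ hγ h)
  obtain ⟨g, hg, hgp⟩ := N1 hA hp
  have hgS := Submonoid.subset_closure (M := SL2) hg
  have hgq : par q (ra p g) := (hc g hgS).resolve_left
    (fun h => hgp ((par_iff hp (ra_ne_zero hp _)).1 h))
  have hc2 : ∀ γ ∈ Submonoid.closure A, par p (ra q γ) ∨ par q (ra q γ) := by
    intro γ hγ
    have h1 := par_ra hgq γ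
    rw [← ra_mul] at h1
    rcases hc _ (Submonoid.mul_mem _ hgS hγ) with h2 | h2
    · exact Or.inl (par_trans h2 (par_symm h1))
    · exact Or.inr (par_trans h2 (par_symm h1))
  obtain ⟨γ, hγ, hne⟩ := N2 hA hpq
  apply hne
  have hγS := Submonoid.subset_closure (M := SL2) hγ
  have hnot : ¬ par (ra p γ) (ra q γ) := by
    rw [par_iff (ra_ne_zero hp _) (ra_ne_zero hq _), dt_ra]; exact hpq
  rcases hc γ hγS with h1 | h1 <;> rcases hc2 γ hγS with h2 | h2
  · exact absurd (par_trans (par_symm h1) h2) hnot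
  · exact Or.inl ⟨h1, h2⟩
  · exact Or.inr ⟨h1, h2⟩
  · exact absurd (par_trans (par_symm h1) h2) hnot

end

section

open scoped ENNReal NNReal Topology

/-- The working setup. -/
structure Setup (μ : Measure SL2) (ν : Measure ℂ) : Prop where
  lazy : 1 / 2 ≤ μ {1}
  mom : ∃ ε₁ > (0 : ℝ), ∫⁻ g, ENNReal.ofReal (NN g ^ ε₁) ∂μ < ⊤
  zd : ¬ IsSolvable (Subgroup.closure (measSupp μ))
  unit : ∀ᵐ x ∂ν, ‖x‖ = 1
  stat : ∀ φ : ℂ → ℝ≥0∞, Measurable φ → (∀ (c : ℝ) (x : ℂ), c ≠ 0 → φ (c * x) = φ x) →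
    ∫⁻ x, φ x ∂ν = ∫⁻ g, ∫⁻ x, φ (ca g x) ∂ν ∂μ

theorem decomp {p q : ℂ} (hpq : dt p q = 1) (u : ℂ) : u = (dt u q : ℝ) * p + (dt p u : ℝ) * q := by
  simp only [dt] at *
  apply Complex.ext <;> simp
  · linear_combination -u.re * hpq
  · linear_combination -u.im * hpq

theorem ra_pow_eig {p : ℂ} {h : SL2} {l : ℝ} (hp : ra p h = l * p) (n : ℕ) :
    ra p (h ^ n) = ((l ^ n : ℝ) : ℂ) * p := by
  induction n with
  | zero => simp [ra_one]
  | succ n ih => rw [pow_succ, ra_mul, ih, ra_smul, hp]; push_cast; ring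

theorem ra_pow_hyp {p q : ℂ} {h : SL2} {l : ℝ} (hpq : dt p q = 1) (hp : ra p h = l * p)
    (hq : ra q h = (l⁻¹ : ℝ) * q) (u : ℂ) (n : ℕ) :
    ra u (h ^ n) = (dt u q * l ^ n : ℝ) * p + (dt p u * (l⁻¹) ^ n : ℝ) * q := by
  conv_lhs => rw [decomp hpq u]
  rw [ra_add, ra_smul, ra_smul, ra_pow_eig hp, ra_pow_eig hq]
  push_cast; ring

theorem dt_add (u v w : ℂ) : dt u (v + w) = dt u v + dt u w := by
  simp [dt]; ring

section
variable {μ : Measure SL2} {ν : Measure ℂ} [IsProbabilityMeasure μ] [IsProbabilityMeasure ν]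

theorem Setup.ne_zero (hS : Setup μ ν) : ∀ᵐ x ∂ν, x ≠ 0 := by
  filter_upwards [hS.unit] with x hx h0
  rw [h0] at hx; norm_num at hx

/-- mass of the line orthogonal to u, thickened -/
def lm (ν : Measure ℂ) (u : ℂ) (δ : ℝ) : ℝ≥0∞ := ν {x | |pr u x| ≤ δ * (‖u‖ * ‖x‖)}

theorem measurable_pr (u : ℂ) : Measurable (pr u) :=
  (measurable_const : Measurable (fun _ : ℂ => u)).pr measurable_id

theorem measurableSet_lm (u : ℂ) (δ : ℝ) : MeasurableSet {x : ℂ | |pr u x| ≤ δ * (‖u‖ * ‖x‖)} := by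
  apply measurableSet_le
  · exact (measurable_pr u).abs
  · fun_prop

theorem lm_stat (hS : Setup μ ν) (u : ℂ) : lm ν u 0 = ∫⁻ g, lm ν (ra u g) 0 ∂μ := by
  have hm : MeasurableSet {x : ℂ | pr u x = 0} := (measurable_pr u) (measurableSet_singleton 0)
  have h := hS.stat (Set.indicator {x | pr u x = 0} 1) (measurable_one.indicator hm) (by
    intro c x hc
    simp only [Set.indicator, Set.mem_ofPred_eq, pr_smul', mul_eq_zero, hc, false_or, Pi.one_apply])
  have e : ∀ u : ℂ, {x : ℂ | |pr u x| ≤ 0 * (‖u‖ * ‖x‖)} = {x | pr u x = 0} := by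
    intro u; ext x; simp
  rw [lintegral_indicator_one hm] at h
  unfold lm
  simp only [e]
  rw [h]
  congr 1; ext g
  rw [← lintegral_indicator_one (by exact (measurable_pr _) (measurableSet_singleton 0))]
  congr 1; ext x
  simp only [Set.indicator, Set.mem_ofPred_eq, pr_ra, Pi.one_apply]

/-- upper semicontinuity -/
theorem lm_usc (ν : Measure ℂ) [IsProbabilityMeasure ν] {u : ℂ} (hu : u ≠ 0) {M : ℝ≥0∞} (h : lm ν u 0 < M) :
    ∃ δ > 0, ∀ w, ‖w - u‖ < δ → lm ν w δ < M := by
  have hmono : Antitone (fun n : ℕ => {x : ℂ | |pr u x| ≤ (1 / ((n : ℝ) + 1)) * (‖u‖ * ‖x‖)}) := by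
    intro m n hmn x hx
    simp only [Set.mem_ofPred_eq] at *
    refine hx.trans ?_
    gcongr
  have hi : (⋂ n : ℕ, {x : ℂ | |pr u x| ≤ (1 / ((n : ℝ) + 1)) * (‖u‖ * ‖x‖)}) =
      {x : ℂ | |pr u x| ≤ 0 * (‖u‖ * ‖x‖)} := by
    ext x
    simp only [Set.mem_iInter, Set.mem_ofPred_eq]
    constructor
    · intro hx
      have h1 : Tendsto (fun n : ℕ => (1 / ((n : ℝ) + 1)) * (‖u‖ * ‖x‖)) atTop (𝓝 (0 * (‖u‖ * ‖x‖))) :=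
        tendsto_one_div_add_atTop_nhds_zero_nat.mul_const _
      exact ge_of_tendsto' h1 hx
    · intro hx n
      refine hx.trans ?_
      gcongr
      positivity
  have ht := tendsto_measure_iInter_atTop (μ := ν) (fun n : ℕ => (measurableSet_lm u (1 / ((n : ℝ) + 1))).nullMeasurableSet)
    hmono ⟨0, measure_ne_top _ _⟩
  rw [hi] at ht
  obtain ⟨n, hn⟩ := (ht.eventually (gt_mem_nhds h)).exists
  set d : ℝ := 1 / ((n : ℝ) + 1) with hd
  have hd0 : 0 < d := by positivity
  have hd1 : d ≤ 1 := by rw [hd, div_le_one (by positivity)]; linarith [(Nat.cast_nonneg n : (0:ℝ) ≤ n)]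
  have hu0 : 0 < ‖u‖ := norm_pos_iff.2 hu
  refine ⟨min (d / 4) (d / 4 * ‖u‖), by positivity, fun w hw => lt_of_le_of_lt (measure_mono ?_) hn⟩
  intro x hx
  simp only [Set.mem_ofPred_eq] at hx ⊢
  have h1 : pr u x = pr w x - pr (w - u) x := by simp [pr]; ring
  have h2 := abs_pr_le (w - u) x
  have h3 : ‖w - u‖ < d / 4 * ‖u‖ := lt_of_lt_of_le hw (min_le_right _ _)
  have h4 : ‖w‖ ≤ 2 * ‖u‖ := by
    have : w = u + (w - u) := by ring
    rw [this]
    refine (norm_add_le _ _).trans ?_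
    nlinarith
  rw [h1]
  calc |pr w x - pr (w - u) x| ≤ |pr w x| + |pr (w - u) x| := abs_sub _ _
    _ ≤ min (d / 4) (d / 4 * ‖u‖) * (‖w‖ * ‖x‖) + ‖w - u‖ * ‖x‖ := add_le_add hx h2
    _ ≤ d / 4 * (2 * ‖u‖ * ‖x‖) + d / 4 * ‖u‖ * ‖x‖ := by
        gcongr
        exact min_le_left _ _
    _ ≤ d * (‖u‖ * ‖x‖) := by nlinarith [mul_nonneg hd0.le (mul_nonneg hu0.le (norm_nonneg x))]

theorem lines_disj (hS : Setup μ ν) {u w : ℂ} (huw : dt u w ≠ 0) :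
    AEDisjoint ν {x | |pr u x| ≤ 0 * (‖u‖ * ‖x‖)} {x | |pr w x| ≤ 0 * (‖w‖ * ‖x‖)} := by
  refine measure_mono_null ?_ (ae_iff.1 hS.ne_zero)
  rintro x ⟨h1, h2⟩
  simp only [Set.mem_ofPred_eq, zero_mul, abs_nonpos_iff, not_not] at h1 h2 ⊢
  simp only [pr, dt] at h1 h2 huw
  apply Complex.ext <;> simp <;> apply mul_left_cancel₀ huw
  · linear_combination w.im * h1 - u.im * h2
  · linear_combination u.re * h2 - w.re * h1

theorem lm_par {u w : ℂ} (h : par u w) : lm ν w 0 = lm ν u 0 := by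
  obtain ⟨c, hc, rfl⟩ := h
  unfold lm
  congr 1; ext x
  simp only [pr_smul, zero_mul, abs_nonpos_iff, mul_eq_zero, hc, false_or]

theorem supp_of_open {U : Set SL2} (hU : IsOpen U) (h0 : μ U = 0) : ∀ g ∈ measSupp μ, g ∉ U := by
  intro g hg hgU
  exact (hg U hU hgU).ne' h0

theorem nonatomic (hS : Setup μ ν) {u : ℂ} (hu : u ≠ 0) : lm ν u 0 = 0 := by
  by_contra hne
  -- the set of large values is finite
  set V : Set ℝ≥0∞ := {r | ∃ w, w ≠ 0 ∧ lm ν w 0 = r} with hV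
  have hch : ∀ r : V, ∃ w, w ≠ 0 ∧ lm ν w 0 = r.1 := fun r => r.2
  choose f hf0 hf using hch
  have hfin : Set.Finite {r : V | lm ν u 0 ≤ ν {x | |pr (f r) x| ≤ 0 * (‖f r‖ * ‖x‖)}} := by
    apply Measure.finite_const_le_meas_of_disjoint_iUnion₀ ν (pos_iff_ne_zero.2 hne)
      (fun r => (measurableSet_lm _ _).nullMeasurableSet) _ (measure_ne_top _ _)
    intro r s hrs
    apply lines_disj hS
    intro h0
    apply hrs
    apply Subtype.ext
    rw [← hf r, ← hf s]
    exact (lm_par ((par_iff (hf0 r) (hf0 s)).2 h0)).symm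
  obtain ⟨m, hm, hmax⟩ := Set.exists_max_image _ (fun r : V => r.1) hfin
    ⟨⟨lm ν u 0, u, hu, rfl⟩, by change _ ≤ lm ν _ 0; rw [hf]⟩
  set M := m.1 with hM
  have hMpos : M ≠ 0 := by
    intro h0
    have : lm ν u 0 ≤ lm ν (f m) 0 := hm
    rw [hf m] at this
    exact hne (le_antisymm (this.trans h0.le) bot_le)
  have hle : ∀ w, w ≠ 0 → lm ν w 0 ≤ M := by
    intro w hw
    by_cases h : lm ν u 0 ≤ lm ν w 0
    · exact hmax ⟨lm ν w 0, w, hw, rfl⟩ (by change _ ≤ lm ν _ 0; rw [hf]; exact h)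
    · have : lm ν u 0 ≤ lm ν (f m) 0 := hm
      rw [hf m] at this
      exact (not_le.1 h).le.trans this
  have hMtop : M ≠ ⊤ := by
    rw [hM, ← hf m]; exact measure_ne_top _ _
  have hinv1 : ∀ g ∈ measSupp μ, ∀ w, w ≠ 0 → lm ν w 0 = M → lm ν (ra w g) 0 = M := by
    intro g hg w hw hwM
    have hop : IsOpen {g : SL2 | lm ν (ra w g) 0 < M} := by
      rw [isOpen_iff_mem_nhds]
      intro g hg
      obtain ⟨δ, hδ, hw⟩ := lm_usc ν (ra_ne_zero hw g) hg
      have hc : Continuous (fun g => ra w g) := Continuous.ra continuous_const continuous_id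
      filter_upwards [hc.continuousAt.preimage_mem_nhds (Metric.ball_mem_nhds _ hδ)] with g' hg'
      have h2 : ‖ra w g' - ra w g‖ < δ := by
        rw [← dist_eq_norm]; exact hg'
      refine lt_of_le_of_lt (measure_mono ?_) (hw _ h2)
      intro x hx
      refine le_trans (Set.mem_ofPred.1 hx) ?_
      gcongr
    have hz : μ {g : SL2 | lm ν (ra w g) 0 < M} = 0 := by
      have hst := lm_stat hS w
      rw [hwM] at hst
      by_contra hpos
      have hlt : ∫⁻ g, lm ν (ra w g) 0 ∂μ < ∫⁻ _g, M ∂μ := by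
        refine lintegral_strict_mono_of_ae_le_of_ae_lt_on aemeasurable_const ?_
          (Eventually.of_forall fun g => hle _ (ra_ne_zero hw g)) hpos
          (Eventually.of_forall fun g hg => hg)
        rw [← hst]; exact hMtop
      rw [← hst] at hlt; simp at hlt
    have := supp_of_open hop hz g hg
    simp only [Set.mem_ofPred_eq, not_lt] at this
    exact le_antisymm (hle _ (ra_ne_zero hw g)) this
  have hinv : ∀ g ∈ Submonoid.closure (measSupp μ), ∀ w, w ≠ 0 → lm ν w 0 = M → lm ν (ra w g) 0 = M := by
    intro g hg
    induction hg using Submonoid.closure_induction with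
    | mem x hx => exact hinv1 x hx
    | one => intro w _ h; rwa [ra_one]
    | mul x y _ _ hx hy =>
      intro w hw h
      rw [ra_mul]
      exact hy _ (ra_ne_zero hw x) (hx w hw h)
  obtain ⟨h, hh, htr⟩ := N3 hS.zd
  obtain ⟨l, p, q, hl, hpq, hp, hq⟩ := hyper_eig htr
  have hp0 : p ≠ 0 := by rintro rfl; simp [dt] at hpq
  have hq0 : q ≠ 0 := by rintro rfl; simp [dt] at hpq
  obtain ⟨w, hw0, hwM, hwp, hwq⟩ : ∃ w, w ≠ 0 ∧ lm ν w 0 = M ∧ dt p w ≠ 0 ∧ dt q w ≠ 0 := by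
    by_cases h1 : dt p (f m) = 0
    · obtain ⟨γ, hγ, h2, h3⟩ := move_pair hS.zd (p := p) (q := q) (by rw [hpq]; norm_num)
      refine ⟨ra p γ, ra_ne_zero hp0 γ, ?_, h2, h3⟩
      apply hinv γ hγ p hp0
      rw [hM, ← hf m]
      exact (lm_par ((par_iff hp0 (hf0 m)).2 h1)).symm
    by_cases h1' : dt q (f m) = 0
    · obtain ⟨γ, hγ, h2, h3⟩ := move_pair hS.zd (p := q) (q := p) (by rw [dt_comm, hpq]; norm_num)
      refine ⟨ra q γ, ra_ne_zero hq0 γ, ?_, h3, h2⟩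
      apply hinv γ hγ q hq0
      rw [hM, ← hf m]
      exact (lm_par ((par_iff hq0 (hf0 m)).2 h1')).symm
    exact ⟨f m, hf0 m, hf m, h1, h1'⟩
  have hdisj : ∀ n k : ℕ, dt (ra w (h ^ n)) (ra w (h ^ (n + k + 1))) ≠ 0 := by
    intro n k
    rw [show n + k + 1 = (k + 1) + n by ring, pow_add h (k+1) n, ra_mul, dt_ra]
    rw [ra_pow_hyp hpq hp hq, dt_add, dt_smul', dt_smul', dt_comm w p]
    have e : dt w q * l ^ (k + 1) * -dt p w + dt p w * l⁻¹ ^ (k + 1) * dt w q =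
      dt w q * dt p w * (l⁻¹ ^ (k + 1) - l ^ (k + 1)) := by ring
    rw [e]
    refine mul_ne_zero (mul_ne_zero (by rw [dt_comm]; exact neg_ne_zero.2 hwq) hwp) ?_
    intro h0
    have h1 : |l⁻¹ ^ (k+1)| = |l ^ (k+1)| := by rw [sub_eq_zero.1 h0]
    rw [abs_pow, abs_pow, abs_inv] at h1
    have h2 : 1 < |l| ^ (k+1) := one_lt_pow₀ hl (by omega)
    have h3 : |l|⁻¹ ^ (k+1) < 1 := pow_lt_one₀ (by positivity) (inv_lt_one_of_one_lt₀ hl) (by omega)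
    linarith
  have hfin2 : Set.Finite {n : ℕ | M ≤ ν {x | |pr (ra w (h ^ n)) x| ≤ 0 * (‖ra w (h ^ n)‖ * ‖x‖)}} := by
    apply Measure.finite_const_le_meas_of_disjoint_iUnion₀ ν (pos_iff_ne_zero.2 hMpos)
      (fun r => (measurableSet_lm _ _).nullMeasurableSet) _ (measure_ne_top _ _)
    intro i j hij
    rcases lt_or_gt_of_ne hij with h1 | h1
    · obtain ⟨k, rfl⟩ := Nat.exists_eq_add_of_lt h1
      exact lines_disj hS (hdisj i k)
    · obtain ⟨k, rfl⟩ := Nat.exists_eq_add_of_lt h1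
      exact (lines_disj hS (hdisj j k)).symm
  apply Set.infinite_univ (α := ℕ)
  refine hfin2.subset fun n _ => ?_
  exact (hinv _ (Submonoid.pow_mem _ hh n) w hw0 hwM).ge

/-- uniform smallness of thickened lines -/
theorem lm_unif (hS : Setup μ ν) {ε : ℝ≥0∞} (hε : 0 < ε) : ∃ δ > 0, δ < 1 ∧ ∀ u, u ≠ 0 → lm ν u δ ≤ ε := by
  have h1 : ∀ u ∈ Metric.sphere (0 : ℂ) 1, ∃ δ > 0, ∀ w, ‖w - u‖ < δ → lm ν w δ < ε := by
    intro u hu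
    have hu0 : u ≠ 0 := by rintro rfl; simp at hu
    exact lm_usc ν hu0 (by rw [nonatomic hS hu0]; exact hε)
  choose! d hd hd' using h1
  obtain ⟨t, ht, hcov⟩ := (isCompact_sphere (0 : ℂ) 1).elim_nhds_subcover
    (fun u => Metric.ball u (d u)) (fun u hu => Metric.ball_mem_nhds _ (hd u hu))
  obtain ⟨δ, hδ, hδ1, hδt⟩ : ∃ δ > 0, δ < 1 ∧ ∀ u ∈ t, δ ≤ d u := by
    clear hcov
    induction t using Finset.induction_on with
    | empty => exact ⟨1/2, by norm_num, by norm_num, by simp⟩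
    | insert a s _ ih =>
      obtain ⟨δ, h1, h11, h2⟩ := ih (fun u hu => ht u (Finset.mem_insert_of_mem hu))
      refine ⟨min δ (d a), lt_min h1 (hd a (ht a (Finset.mem_insert_self _ _))), (min_le_left _ _).trans_lt h11, ?_⟩
      intro u hu
      rcases Finset.mem_insert.1 hu with rfl | hu
      · exact min_le_right _ _
      · exact (min_le_left _ _).trans (h2 u hu)
  refine ⟨δ, hδ, hδ1, fun u hu => ?_⟩
  have hn : 0 < ‖u‖ := norm_pos_iff.2 hu
  set v : ℂ := ((‖u‖⁻¹ : ℝ) : ℂ) * u with hv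
  have hvn : ‖v‖ = 1 := by
    rw [hv, norm_mul, Complex.norm_real, norm_inv, norm_norm, inv_mul_cancel₀ hn.ne']
  have hvs : v ∈ Metric.sphere (0 : ℂ) 1 := by simp [hvn]
  obtain ⟨w, hw, hwb⟩ := Set.mem_iUnion₂.1 (hcov hvs)
  have := hd' w (ht w hw) v (by rw [← dist_eq_norm]; exact hwb)
  refine le_trans (measure_mono ?_) this.le
  intro x hx
  simp only [Set.mem_ofPred_eq] at hx ⊢
  rw [hvn, hv, pr_smul, abs_mul, abs_inv, abs_norm, one_mul]
  rw [inv_mul_le_iff₀ hn]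
  calc |pr u x| ≤ δ * (‖u‖ * ‖x‖) := hx
    _ ≤ d w * (‖u‖ * ‖x‖) := by gcongr; exact hδt w hw
    _ = _ := by ring

end

end

section

open scoped ENNReal NNReal Topology

/-! ### Convolution powers and the Green measure -/

def mun (μ : Measure SL2) : ℕ → Measure SL2
  | 0 => Measure.dirac 1
  | n + 1 => (μ.prod (mun μ n)).map (fun p => p.1 * p.2)

section
variable {μ : Measure SL2} [IsProbabilityMeasure μ]

instance mun_prob (n : ℕ) : IsProbabilityMeasure (mun μ n) := by
  induction n with
  | zero => exact Measure.dirac.isProbabilityMeasure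
  | succ n ih =>
    have : IsProbabilityMeasure (μ.prod (mun μ n)) := inferInstance
    exact Measure.isProbabilityMeasure_map (measurable_fst.mul measurable_snd).aemeasurable

theorem lintegral_mun_zero (f : SL2 → ℝ≥0∞) (hf : Measurable f) : ∫⁻ g, f g ∂(mun μ 0) = f 1 := by
  rw [mun, lintegral_dirac' _ hf]

theorem lintegral_mun_succ (n : ℕ) (f : SL2 → ℝ≥0∞) (hf : Measurable f) :
    ∫⁻ g, f g ∂(mun μ (n + 1)) = ∫⁻ g, ∫⁻ h, f (g * h) ∂(mun μ n) ∂μ := by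
  rw [mun, lintegral_map hf (by fun_prop : Measurable fun p : SL2 × SL2 => p.1 * p.2), lintegral_prod]
  exact (hf.comp (measurable_fst.mul measurable_snd)).aemeasurable

theorem measurable_shift {α : Type*} [MeasurableSpace α] {ρ : Measure SL2} [SFinite ρ] {f : SL2 → ℝ≥0∞} (hf : Measurable f)
    {a : α → SL2} (ha : Measurable a) : Measurable (fun x => ∫⁻ h, f (a x * h) ∂ρ) := by
  have : Measurable (fun p : α × SL2 => f (a p.1 * p.2)) :=
    hf.comp ((ha.comp measurable_fst).mul measurable_snd)
  exact this.lintegral_prod_right'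

theorem measurable_shift0 {ρ : Measure SL2} [SFinite ρ] {f : SL2 → ℝ≥0∞} (hf : Measurable f) :
    Measurable (fun g => ∫⁻ h, f (g * h) ∂ρ) := measurable_shift hf measurable_id

theorem lintegral_mun_add (m n : ℕ) (f : SL2 → ℝ≥0∞) (hf : Measurable f) :
    ∫⁻ g, f g ∂(mun μ (m + n)) = ∫⁻ g, ∫⁻ h, f (g * h) ∂(mun μ n) ∂(mun μ m) := by
  induction m generalizing f with
  | zero =>
    rw [lintegral_mun_zero _ (measurable_shift0 hf), zero_add]; simp
  | succ m ih =>
    rw [show m + 1 + n = (m + n) + 1 by ring, lintegral_mun_succ _ _ hf,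
      lintegral_mun_succ _ _ (measurable_shift0 hf)]
    congr 1; ext g
    rw [ih (fun h => f (g * h)) (hf.comp (measurable_const_mul g))]
    simp only [mul_assoc]

theorem mun_one : mun μ 1 = μ := by
  ext s hs
  have := lintegral_mun_succ (μ := μ) 0 (s.indicator 1) (measurable_one.indicator hs)
  rw [lintegral_indicator_one hs] at this
  rw [show (1 : ℕ) = 0 + 1 from rfl, this, ← lintegral_indicator_one hs]
  congr 1; ext g
  rw [lintegral_mun_zero (fun h => s.indicator 1 (g * h)) ((measurable_one.indicator hs).comp (measurable_const_mul g)), mul_one]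

theorem lintegral_mun_succ' (n : ℕ) (f : SL2 → ℝ≥0∞) (hf : Measurable f) :
    ∫⁻ g, f g ∂(mun μ (n + 1)) = ∫⁻ g, ∫⁻ h, f (g * h) ∂μ ∂(mun μ n) := by
  rw [lintegral_mun_add n 1 f hf, mun_one]

/-- Green measure -/
def Gr (μ : Measure SL2) : Measure SL2 := Measure.sum (mun μ)

instance : SFinite (Gr μ) := by unfold Gr; infer_instance

theorem lintegral_Gr (f : SL2 → ℝ≥0∞) : ∫⁻ g, f g ∂(Gr μ) = ∑' n, ∫⁻ g, f g ∂(mun μ n) := by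
  rw [Gr, lintegral_sum_measure]

theorem lintegral_Gr_step (f : SL2 → ℝ≥0∞) (hf : Measurable f) :
    ∫⁻ g, f g ∂(Gr μ) = f 1 + ∫⁻ g, ∫⁻ h, f (g * h) ∂(Gr μ) ∂μ := by
  simp only [lintegral_Gr]
  rw [tsum_eq_zero_add' ENNReal.summable, lintegral_mun_zero _ hf]
  congr 1
  rw [lintegral_tsum (fun n => (measurable_shift0 hf).aemeasurable)]
  congr 1; ext n
  exact lintegral_mun_succ n f hf

/-- points of the semigroup are charged by convolution powers -/
theorem mun_charge {γ : SL2} (hγ : γ ∈ Submonoid.closure (measSupp μ)) :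
    ∃ n, ∀ U : Set SL2, IsOpen U → γ ∈ U → 0 < mun μ n U := by
  induction hγ using Submonoid.closure_induction with
  | mem x hx => exact ⟨1, fun U hU hxU => by rw [mun_one]; exact hx U hU hxU⟩
  | one => exact ⟨0, fun U hU hxU => by
      rw [mun, Measure.dirac_apply' _ hU.measurableSet]; simp [hxU]⟩
  | mul x y _ _ hx hy =>
    obtain ⟨m, hm⟩ := hx
    obtain ⟨n, hn⟩ := hy
    refine ⟨m + n, fun U hU hxU => ?_⟩
    have hc : Continuous (fun p : SL2 × SL2 => p.1 * p.2) := continuous_mul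
    have : (fun p : SL2 × SL2 => p.1 * p.2) ⁻¹' U ∈ 𝓝 (x, y) := hc.continuousAt.preimage_mem_nhds (hU.mem_nhds hxU)
    obtain ⟨V, hV, W, hW, hVW⟩ := mem_nhds_prod_iff.1 this
    obtain ⟨V', hV', hVo, hxV⟩ := mem_nhds_iff.1 hV
    obtain ⟨W', hW', hWo, hyW⟩ := mem_nhds_iff.1 hW
    have hp := ENNReal.mul_pos (hm V' hVo hxV).ne' (hn W' hWo hyW).ne'
    refine hp.trans_le ?_
    rw [← lintegral_indicator_one hU.measurableSet, lintegral_mun_add _ _ _ (measurable_one.indicator hU.measurableSet)]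
    calc mun μ m V' * mun μ n W' = ∫⁻ g, V'.indicator (fun _ => mun μ n W') g ∂(mun μ m) := by
          rw [lintegral_indicator_const hVo.measurableSet, mul_comm]
      _ ≤ _ := by
          apply lintegral_mono
          intro g
          by_cases hg : g ∈ V'
          · simp only [Set.indicator_of_mem hg]
            rw [← lintegral_indicator_one hWo.measurableSet]
            apply lintegral_mono
            intro h
            by_cases hh : h ∈ W'
            · have : g * h ∈ U := hVW (Set.mk_mem_prod (hV' hg) (hW' hh))
              simp [hh, this]
            · simp [hh]
          · simp [hg]

theorem Setup.stat_mun {ν : Measure ℂ} [IsProbabilityMeasure ν] (hS : Setup μ ν) (n : ℕ) (φ : ℂ → ℝ≥0∞) (hφ : Measurable φ)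
    (hc : ∀ (c : ℝ) (x : ℂ), c ≠ 0 → φ (c * x) = φ x) :
    ∫⁻ x, φ x ∂ν = ∫⁻ g, ∫⁻ x, φ (ca g x) ∂ν ∂(mun μ n) := by
  have hm : Measurable (fun g : SL2 => ∫⁻ x, φ (ca g x) ∂ν) := by
    have : Measurable (fun p : SL2 × ℂ => φ (ca p.1 p.2)) := hφ.comp measurable_ca
    exact this.lintegral_prod_right'
  induction n with
  | zero => rw [lintegral_mun_zero _ hm]; simp [ca_one]
  | succ n ih =>
    rw [lintegral_mun_succ' _ _ hm, ih]
    congr 1; ext g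
    simp only [ca_mul]
    apply hS.stat (fun x => φ (ca g x)) (hφ.comp (measurable_ca.comp measurable_prodMk_left))
    intro c x h; rw [ca_smul, hc c _ h]

end

end

section

open scoped ENNReal NNReal Topology

/-! ### L2 gap -/

def raLin (g : SL2) : ℂ →ₗ[ℝ] ℂ where
  toFun u := ra u g
  map_add' u w := ra_add u w g
  map_smul' c u := by simpa using ra_smul c u g

theorem raLin_det (g : SL2) : LinearMap.det (raLin g) = 1 := by
  rw [← LinearMap.det_toMatrix Complex.basisOneI, Matrix.det_fin_two]
  simp only [LinearMap.toMatrix_apply, Complex.coe_basisOneI, Complex.coe_basisOneI_repr, raLin,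
    LinearMap.coe_mk, AddHom.coe_mk, ra]
  have := g.det_eq
  simp
  linarith

theorem mp_ra (g : SL2) : MeasurePreserving (fun u : ℂ => ra u g) volume volume := by
  refine ⟨by fun_prop, ?_⟩
  have := Measure.map_linearMap_addHaar_eq_smul_addHaar (μ := (volume : Measure ℂ)) (f := raLin g)
    (by rw [raLin_det]; exact one_ne_zero)
  rw [raLin_det] at this
  simp only [inv_one, abs_one, ENNReal.ofReal_one, one_smul] at this
  exact this

theorem lintegral_ra (g : SL2) (f : ℂ → ℝ≥0∞) (hf : Measurable f) : ∫⁻ u, f (ra u g) = ∫⁻ u, f u :=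
  (mp_ra g).lintegral_comp hf

/-- squared L2 norm -/
def Q2 (f : ℂ → ℝ) : ℝ≥0∞ := ∫⁻ u, ENNReal.ofReal (f u ^ 2)
/-- squared L2 displacement -/
def D2 (f : ℂ → ℝ) (g : SL2) : ℝ≥0∞ := ∫⁻ u, ENNReal.ofReal ((f (ra u g) - f u) ^ 2)
/-- tested mass -/
def La (f φ : ℂ → ℝ) : ℝ≥0∞ := ∫⁻ u, ENNReal.ofReal (φ u * f u ^ 2)

theorem measurable_D2 {f : ℂ → ℝ} (hf : Measurable f) : Measurable (D2 f) := by
  unfold D2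
  have : Measurable (fun p : SL2 × ℂ => ENNReal.ofReal ((f (ra p.2 p.1) - f p.2) ^ 2)) := by fun_prop
  exact this.lintegral_prod_right'

theorem D2_mul {f : ℂ → ℝ} (hf : Measurable f) (g h : SL2) : D2 f (g * h) ≤ 2 * D2 f g + 2 * D2 f h := by
  have e : D2 f h = ∫⁻ u, ENNReal.ofReal ((f (ra (ra u g) h) - f (ra u g)) ^ 2) := by
    rw [lintegral_ra g (fun u => ENNReal.ofReal ((f (ra u h) - f u) ^ 2)) (by fun_prop)]; rfl
  rw [e]
  unfold D2
  rw [← lintegral_const_mul _ (by fun_prop), ← lintegral_const_mul _ (by fun_prop),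
    ← lintegral_add_left (by fun_prop)]
  apply lintegral_mono
  intro u
  simp only
  rw [← ENNReal.ofReal_ofNat 2, ← ENNReal.ofReal_mul (by norm_num), ← ENNReal.ofReal_mul (by norm_num),
    ← ENNReal.ofReal_add (by positivity) (by positivity), ra_mul]
  apply ENNReal.ofReal_le_ofReal
  nlinarith [sq_nonneg (f (ra (ra u g) h) - f (ra u g) - (f (ra u g) - f u))]

theorem D2_one (f : ℂ → ℝ) : D2 f 1 = 0 := by simp [D2, ra_one]

theorem La_transfer {f φ : ℂ → ℝ} (hf : Measurable f) (hφ : Measurable φ) (h0 : ∀ u, 0 ≤ φ u)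
    (h1 : ∀ u, φ u ≤ 1) (g : SL2) {s : ℝ} (hs : 0 < s) :
    La f (fun u => φ (ra u g)) ≤ La f φ + ENNReal.ofReal s⁻¹ * D2 f g + ENNReal.ofReal s * Q2 f := by
  have e : La f φ = ∫⁻ u, ENNReal.ofReal (φ (ra u g) * f (ra u g) ^ 2) := by
    rw [lintegral_ra g (fun u => ENNReal.ofReal (φ u * f u ^ 2)) (by fun_prop)]; rfl
  rw [e]
  unfold La D2 Q2
  rw [← lintegral_const_mul _ (by fun_prop), ← lintegral_const_mul _ (by fun_prop),
    ← lintegral_add_left (by fun_prop), ← lintegral_add_left (by fun_prop)]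
  apply lintegral_mono
  intro u
  simp only
  have := h0 (ra u g)
  rw [← ENNReal.ofReal_mul (by positivity), ← ENNReal.ofReal_mul (by positivity),
    ← ENNReal.ofReal_add (by positivity) (by positivity),
    ← ENNReal.ofReal_add (by positivity) (by positivity)]
  apply ENNReal.ofReal_le_ofReal
  have h2 := h1 (ra u g)
  set x := f u
  set y := f (ra u g)
  set t := φ (ra u g)
  have hk : x ^ 2 ≤ y ^ 2 + (s⁻¹ * (y - x) ^ 2 + s * x ^ 2) := by
    have h3 : 0 ≤ s⁻¹ * ((y - x) + s * x) ^ 2 := by positivity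
    have h4 : s⁻¹ * ((y - x) + s * x) ^ 2 = s⁻¹ * (y - x) ^ 2 + 2 * (y - x) * x + s * x ^ 2 := by
      field_simp; ring
    nlinarith [sq_nonneg (y - x)]
  have h5 : 0 ≤ s⁻¹ * (y - x) ^ 2 + s * x ^ 2 := by positivity
  nlinarith [mul_le_mul_of_nonneg_left hk this, mul_nonneg (sub_nonneg.2 h2) h5]

/-- uniform approximation of homogeneous functions -/
theorem homog_approx {φ : ℂ → ℝ} (hφ : ContinuousOn φ {u | u ≠ 0})
    (hh : ∀ (c : ℝ) (u : ℂ), c ≠ 0 → φ (c * u) = φ u) (γ : SL2) {η : ℝ} (hη : 0 < η) :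
    ∃ U : Set SL2, IsOpen U ∧ γ ∈ U ∧ ∀ g ∈ U, ∀ u, u ≠ 0 → |φ (ra u g) - φ (ra u γ)| < η := by
  have hev : ∀ᶠ g in 𝓝 γ, ∀ u ∈ Metric.sphere (0 : ℂ) 1, |φ (ra u g) - φ (ra u γ)| < η := by
    apply (isCompact_sphere (0 : ℂ) 1).eventually_forall_of_forall_eventually
    intro u hu
    have hu0 : u ≠ 0 := by rintro rfl; simp at hu
    have hne : IsOpen {u : ℂ | u ≠ 0} := isOpen_ne
    have c1 : ContinuousAt (fun z : ℂ × SL2 => φ (ra z.1 z.2)) (u, γ) := by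
      have h1 : ContinuousAt φ (ra u γ) := hφ.continuousAt (hne.mem_nhds (ra_ne_zero hu0 γ))
      exact ContinuousAt.comp (f := fun z : ℂ × SL2 => ra z.1 z.2) (x := (u, γ)) h1 continuous_ra.continuousAt
    have c2 : ContinuousAt (fun z : ℂ × SL2 => φ (ra z.1 γ)) (u, γ) := by
      have h1 : ContinuousAt φ (ra u γ) := hφ.continuousAt (hne.mem_nhds (ra_ne_zero hu0 γ))
      have h2 : Continuous (fun z : ℂ × SL2 => ra z.1 γ) := by fun_prop
      exact ContinuousAt.comp (f := fun z : ℂ × SL2 => ra z.1 γ) (x := (u, γ)) h1 h2.continuousAt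
    have h3 := (c1.sub c2).abs
    have h4 : |φ (ra u γ) - φ (ra u γ)| < η := by simpa using hη
    have h5 := h3.eventually (gt_mem_nhds h4)
    first
    | exact h5
    | exact (continuous_swap.tendsto (γ, u)).eventually h5
  obtain ⟨U, hU, hUo, hγ⟩ := mem_nhds_iff.1 hev
  refine ⟨U, hUo, hγ, fun g hg u hu => ?_⟩
  have hn : 0 < ‖u‖ := norm_pos_iff.2 hu
  have := hU hg (((‖u‖⁻¹ : ℝ) : ℂ) * u) (by
    simp [norm_mul, hn.ne'])
  rwa [ra_smul, ra_smul, hh _ _ (by positivity), hh _ _ (by positivity)] at this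

theorem exists_lower {φ : ℂ → ℝ} (hφ : ContinuousOn φ {u | u ≠ 0})
    (hh : ∀ (c : ℝ) (u : ℂ), c ≠ 0 → φ (c * u) = φ u) (hpos : ∀ u, u ≠ 0 → 0 < φ u) :
    ∃ c > 0, ∀ u, u ≠ 0 → c ≤ φ u := by
  obtain ⟨w, hw, hmin⟩ := (isCompact_sphere (0 : ℂ) 1).exists_isMinOn ⟨1, by simp⟩
    (hφ.mono (fun u hu => by rintro rfl; simp at hu))
  refine ⟨φ w, hpos w (by rintro rfl; simp at hw), fun u hu => ?_⟩
  have hn : 0 < ‖u‖ := norm_pos_iff.2 hu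
  have := hmin (show (((‖u‖⁻¹ : ℝ) : ℂ) * u) ∈ Metric.sphere (0 : ℂ) 1 by simp [norm_mul, hn.ne'])
  simp only [Set.mem_ofPred_eq] at this
  rwa [hh _ _ (by positivity)] at this

theorem continuous_dt_left (q : ℂ) : Continuous (fun u => dt u q) := by
  unfold dt; fun_prop
theorem continuous_dt_right (q : ℂ) : Continuous (fun u => dt q u) := by
  unfold dt; fun_prop

end

section

open scoped ENNReal NNReal Topology

theorem gap_arith {κ c s : ℝ} (hκ : 0 < κ) (hs : 0 < s) (hsc : (6 / κ + 4) * s = c / 2)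
    {Q X P Y1 Y2 d0 d1 d2 : ℝ≥0∞} (hQ : Q ≠ ⊤) (hX : X ≠ ⊤) (hP : P ≠ ⊤)
    (E0 : ENNReal.ofReal κ * X + P ≤ P + ENNReal.ofReal s⁻¹ * d0 + ENNReal.ofReal s * Q + ENNReal.ofReal s * Q)
    (E1 : Y1 ≤ X + ENNReal.ofReal s⁻¹ * d1 + ENNReal.ofReal s * Q + ENNReal.ofReal s * Q)
    (E2 : Y2 ≤ X + ENNReal.ofReal s⁻¹ * d2 + ENNReal.ofReal s * Q + ENNReal.ofReal s * Q)
    (E3 : ENNReal.ofReal c * Q ≤ X + Y1 + Y2) (hc : 0 < c) :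
    ENNReal.ofReal ((c / 2) / (3 / (κ * s) + 1 / s)) * Q ≤ d0 + d1 + d2 := by
  by_cases h0 : d0 = ⊤
  · simp [h0]
  by_cases h1 : d1 = ⊤
  · simp [h1]
  by_cases h2 : d2 = ⊤
  · simp [h2]
  have E4 : ENNReal.ofReal c * Q ≤ X + (X + ENNReal.ofReal s⁻¹ * d1 + ENNReal.ofReal s * Q + ENNReal.ofReal s * Q) +
    (X + ENNReal.ofReal s⁻¹ * d2 + ENNReal.ofReal s * Q + ENNReal.ofReal s * Q) :=
    E3.trans (by gcongr)
  obtain ⟨q, hq, rfl⟩ : ∃ q : ℝ, 0 ≤ q ∧ Q = ENNReal.ofReal q := ⟨Q.toReal, ENNReal.toReal_nonneg, (ENNReal.ofReal_toReal hQ).symm⟩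
  obtain ⟨x, hx, rfl⟩ : ∃ q : ℝ, 0 ≤ q ∧ X = ENNReal.ofReal q := ⟨X.toReal, ENNReal.toReal_nonneg, (ENNReal.ofReal_toReal hX).symm⟩
  obtain ⟨p, hp, rfl⟩ : ∃ q : ℝ, 0 ≤ q ∧ P = ENNReal.ofReal q := ⟨P.toReal, ENNReal.toReal_nonneg, (ENNReal.ofReal_toReal hP).symm⟩
  obtain ⟨a0, ha0, rfl⟩ : ∃ q : ℝ, 0 ≤ q ∧ d0 = ENNReal.ofReal q := ⟨d0.toReal, ENNReal.toReal_nonneg, (ENNReal.ofReal_toReal h0).symm⟩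
  obtain ⟨a1, ha1, rfl⟩ : ∃ q : ℝ, 0 ≤ q ∧ d1 = ENNReal.ofReal q := ⟨d1.toReal, ENNReal.toReal_nonneg, (ENNReal.ofReal_toReal h1).symm⟩
  obtain ⟨a2, ha2, rfl⟩ : ∃ q : ℝ, 0 ≤ q ∧ d2 = ENNReal.ofReal q := ⟨d2.toReal, ENNReal.toReal_nonneg, (ENNReal.ofReal_toReal h2).symm⟩
  have hsi : 0 < s⁻¹ := by positivity
  simp only [← ENNReal.ofReal_mul hκ.le, ← ENNReal.ofReal_mul hs.le, ← ENNReal.ofReal_mul hsi.le, ← ENNReal.ofReal_mul hc.le] at E0 E4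
  repeat rw [← ENNReal.ofReal_add (by positivity) (by positivity)] at E0
  repeat rw [← ENNReal.ofReal_add (by positivity) (by positivity)] at E4
  rw [ENNReal.ofReal_le_ofReal_iff (by positivity)] at E0 E4
  rw [← ENNReal.ofReal_mul (by positivity), ← ENNReal.ofReal_add (by positivity) (by positivity),
    ← ENNReal.ofReal_add (by positivity) (by positivity)]
  apply ENNReal.ofReal_le_ofReal
  rw [div_mul_eq_mul_div, div_le_iff₀ (by positivity)]
  have hx1 : x ≤ (s⁻¹ * a0 + 2 * s * q) / κ := by
    rw [le_div_iff₀ hκ]; nlinarith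
  have h5 : c * q ≤ 3 * ((s⁻¹ * a0 + 2 * s * q) / κ) + s⁻¹ * (a1 + a2) + 4 * s * q := by nlinarith
  have h6 : 3 * ((s⁻¹ * a0 + 2 * s * q) / κ) = 3 / (κ * s) * a0 + 6 / κ * s * q := by field_simp; ring
  have h7 : (6 / κ + 4) * s * q = c / 2 * q := by rw [hsc]
  have h8 : 0 ≤ 3 / (κ * s) * (a1 + a2) := by positivity
  have h9 : 0 ≤ 1 / s * a0 := by positivity
  have h10 : s⁻¹ = 1 / s := by simp
  rw [h10] at h5 h6
  nlinarith

theorem phi_ineq {A B m : ℝ} (hA : 0 ≤ A) (hB : 0 ≤ B) (hAB : 0 < A + B) (hm : 0 < m) (hm1 : m < 1) :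
    (1 - m) * (A * B / (A + B) ^ 2) + A / (A + B) ≤ A / (A + m * B) := by
  have h1 : 0 < A + m * B := by
    rcases hA.eq_or_lt with h | h
    · rw [← h] at hAB ⊢; simp at hAB ⊢; positivity
    · positivity
  have e : A / (A + m * B) - A / (A + B) = (1 - m) * (A * B) / ((A + m * B) * (A + B)) := by
    field_simp; ring
  have h2 : (1 - m) * (A * B / (A + B) ^ 2) ≤ (1 - m) * (A * B) / ((A + m * B) * (A + B)) := by
    rw [← mul_div_assoc]
    apply div_le_div_of_nonneg_left
    · exact mul_nonneg (by linarith) (mul_nonneg hA hB)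
    · positivity
    · rw [sq]; gcongr; nlinarith
  linarith

theorem lintegral_D2_mun {μ : Measure SL2} [IsProbabilityMeasure μ] {f : ℂ → ℝ} (hf : Measurable f) (n : ℕ) :
    ∫⁻ g, D2 f g ∂(mun μ n) ≤ 4 ^ n * ∫⁻ g, D2 f g ∂μ := by
  induction n with
  | zero => rw [lintegral_mun_zero _ (measurable_D2 hf), D2_one]; exact bot_le
  | succ n ih =>
    rw [lintegral_mun_succ _ _ (measurable_D2 hf)]
    calc ∫⁻ g, ∫⁻ h, D2 f (g * h) ∂(mun μ n) ∂μ ≤ ∫⁻ g, (2 * D2 f g + 2 * ∫⁻ h, D2 f h ∂(mun μ n)) ∂μ := by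
          apply lintegral_mono
          intro g
          refine (lintegral_mono (fun h => D2_mul hf g h)).trans ?_
          rw [lintegral_add_left measurable_const, lintegral_const_mul _ (measurable_D2 hf)]
          simp
      _ = 2 * ∫⁻ g, D2 f g ∂μ + 2 * ∫⁻ h, D2 f h ∂(mun μ n) := by
          rw [lintegral_add_right _ measurable_const, lintegral_const_mul _ (measurable_D2 hf)]; simp
      _ ≤ 2 * ∫⁻ g, D2 f g ∂μ + 2 * (4 ^ n * ∫⁻ g, D2 f g ∂μ) := by gcongr
      _ = (2 + 2 * 4 ^ n) * ∫⁻ g, D2 f g ∂μ := by ring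
      _ ≤ 4 ^ (n + 1) * ∫⁻ g, D2 f g ∂μ := by
          gcongr
          have : (2 + 2 * 4 ^ n : ℕ) ≤ 4 ^ (n + 1) := by
            have := Nat.one_le_pow n 4 (by norm_num)
            rw [pow_succ]; omega
          exact_mod_cast this

/-- abstract form: three open sets on which the displacement cannot be small -/
theorem gap_local {A : Set SL2} (hA : ¬ IsSolvable (Subgroup.closure A)) :
    ∃ (c : ℝ) (γ : Fin 3 → SL2) (U : Fin 3 → Set SL2), 0 < c ∧ (∀ i, γ i ∈ Submonoid.closure A) ∧
      (∀ i, IsOpen (U i)) ∧ (∀ i, γ i ∈ U i) ∧ ∀ g0 ∈ U 0, ∀ g1 ∈ U 1, ∀ g2 ∈ U 2,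
      ∀ f : ℂ → ℝ, Measurable f → Q2 f ≠ ⊤ → ENNReal.ofReal c * Q2 f ≤ D2 f g0 + D2 f g1 + D2 f g2 := by
  obtain ⟨h, hh, htr⟩ := N3 hA
  obtain ⟨l, p, q, hl, hpq, hp, hq⟩ := hyper_eig htr
  obtain ⟨γ1, hγ1, a1, a2⟩ := move_pair hA (p := p) (q := q) (by rw [hpq]; norm_num)
  obtain ⟨γ2, hγ2, b1, b2⟩ := move_pair hA (p := q) (q := p) (by rw [dt_comm, hpq]; norm_num)
  have hl0 : l ≠ 0 := by rintro rfl; norm_num at hl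
  set α : ℂ → ℝ := fun u => dt u q ^ 2 with hα
  set β : ℂ → ℝ := fun u => dt p u ^ 2 with hβ
  have hα0 : ∀ u, 0 ≤ α u := fun u => sq_nonneg _
  have hβ0 : ∀ u, 0 ≤ β u := fun u => sq_nonneg _
  have hαc : Continuous α := (continuous_dt_left q).pow 2
  have hβc : Continuous β := (continuous_dt_right p).pow 2
  have hpos : ∀ u, u ≠ 0 → 0 < α u + β u := by
    intro u hu
    rcases (add_nonneg (hα0 u) (hβ0 u)).eq_or_lt with h0 | h0
    · exfalso; apply hu
      have h1 : α u = 0 := by linarith [hα0 u, hβ0 u]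
      have h2 : β u = 0 := by linarith [hα0 u, hβ0 u]
      rw [decomp hpq u, pow_eq_zero_iff (two_ne_zero) |>.1 h1, pow_eq_zero_iff (two_ne_zero) |>.1 h2]; simp
    · exact h0
  have hαs : ∀ (c : ℝ) u, α (c * u) = c ^ 2 * α u := by intro c u; simp only [hα, dt_smul]; ring
  have hβs : ∀ (c : ℝ) u, β (c * u) = c ^ 2 * β u := by intro c u; simp only [hβ, dt_smul']; ring
  set φ : ℂ → ℝ := fun u => α u / (α u + β u) with hφ
  set ξ : ℂ → ℝ := fun u => α u * β u / (α u + β u) ^ 2 with hξ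
  have hφm : Measurable φ := hαc.measurable.div (hαc.measurable.add hβc.measurable)
  have hξm : Measurable ξ := (hαc.measurable.mul hβc.measurable).div ((hαc.measurable.add hβc.measurable).pow_const 2)
  have hφ0 : ∀ u, 0 ≤ φ u := fun u => div_nonneg (hα0 u) (add_nonneg (hα0 u) (hβ0 u))
  have hξ0 : ∀ u, 0 ≤ ξ u := fun u => div_nonneg (mul_nonneg (hα0 u) (hβ0 u)) (sq_nonneg _)
  have hφ1 : ∀ u, φ u ≤ 1 := fun u => div_le_one_of_le₀ (by linarith [hβ0 u]) (add_nonneg (hα0 u) (hβ0 u))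
  have hξ1 : ∀ u, ξ u ≤ 1 := fun u => div_le_one_of_le₀ (by nlinarith [hα0 u, hβ0 u, mul_nonneg (hα0 u) (hβ0 u)]) (sq_nonneg _)
  have hφc : ContinuousOn φ {u | u ≠ 0} :=
    hαc.continuousOn.div (hαc.add hβc).continuousOn (fun u hu => (hpos u hu).ne')
  have hξc : ContinuousOn ξ {u | u ≠ 0} :=
    (hαc.mul hβc).continuousOn.div ((hαc.add hβc).pow 2).continuousOn (fun u hu => (pow_pos (hpos u hu) 2).ne')
  have hφh : ∀ (c : ℝ) (u : ℂ), c ≠ 0 → φ (c * u) = φ u := by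
    intro c u hc
    simp only [hφ, hαs, hβs, ← mul_add]
    rw [mul_div_mul_left _ _ (by positivity)]
  have hξh : ∀ (c : ℝ) (u : ℂ), c ≠ 0 → ξ (c * u) = ξ u := by
    intro c u hc
    simp only [hξ, hαs, hβs, ← mul_add]
    rw [mul_pow, show c ^ 2 * α u * (c ^ 2 * β u) = (c ^ 2) ^ 2 * (α u * β u) by ring,
      mul_div_mul_left _ _ (by positivity)]
  -- one step inequality
  set m : ℝ := (l ^ 4)⁻¹ with hm
  have hm0 : 0 < m := by positivity
  have hm1 : m < 1 := by
    apply inv_lt_one_of_one_lt₀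
    have : 1 < |l| ^ 4 := one_lt_pow₀ hl (by norm_num)
    rwa [show |l| ^ 4 = l ^ 4 by rw [← abs_pow, abs_of_nonneg (by positivity)]] at this
  have hstep : ∀ u, u ≠ 0 → (1 - m) * ξ u + φ u ≤ φ (ra u h) := by
    intro u hu
    have e1 : α (ra u h) = l ^ 2 * α u := by
      have : dt (ra u h) q = l * dt u q := by
        have h1 := dt_ra u q h
        rw [hq, dt_smul'] at h1
        rw [← h1]; field_simp
      simp only [hα, this]; ring
    have e2 : β (ra u h) = (l ^ 2)⁻¹ * β u := by
      have : dt p (ra u h) = l⁻¹ * dt p u := by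
        have h1 := dt_ra p u h
        rw [hp, dt_smul] at h1
        rw [← h1]; field_simp
      simp only [hβ, this]; ring
    have := phi_ineq (hα0 u) (hβ0 u) (hpos u hu) hm0 hm1
    refine this.trans (le_of_eq ?_)
    simp only [hφ, e1, e2]
    rw [show l ^ 2 * α u + (l ^ 2)⁻¹ * β u = l ^ 2 * (α u + m * β u) by rw [hm]; field_simp,
      mul_div_mul_left _ _ (by positivity)]
  -- lower bound
  obtain ⟨c, hc, hlow⟩ := exists_lower (φ := fun u => ξ u + ξ (ra u γ1) + ξ (ra u γ2))
    (by
      have hr : ∀ γ : SL2, ContinuousOn (fun u => ξ (ra u γ)) {u | u ≠ 0} := fun γ =>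
        hξc.comp (by fun_prop : Continuous fun u => ra u γ).continuousOn (fun u hu => ra_ne_zero hu γ)
      exact (hξc.add (hr γ1)).add (hr γ2))
    (by intro c u hc; simp only [ra_smul, hξh _ _ hc])
    (by
      intro u hu
      have hp0 : p ≠ 0 := by rintro rfl; simp [dt] at hpq
      have hq0 : q ≠ 0 := by rintro rfl; simp [dt] at hpq
      have hx : ∀ w, dt w q ≠ 0 → dt p w ≠ 0 → 0 < ξ w := by
        intro w h1 h2
        have h3 : 0 < α w := by positivity
        have h4 : 0 < β w := by positivity
        simp only [hξ]; positivity
      have n0 := hξ0 u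
      have n1 := hξ0 (ra u γ1)
      have n2 := hξ0 (ra u γ2)
      by_cases h1 : dt u q = 0
      · have : par q u := (par_iff hq0 hu).2 (by rw [dt_comm, h1, neg_zero])
        obtain ⟨k, hk, rfl⟩ := this
        have : 0 < ξ (ra (k * q) γ2) := by
          rw [ra_smul, hξh _ _ hk]
          exact hx _ (by rw [dt_comm]; exact neg_ne_zero.2 b1) b2
        linarith
      by_cases h2 : dt p u = 0
      · have : par p u := (par_iff hp0 hu).2 h2
        obtain ⟨k, hk, rfl⟩ := this
        have : 0 < ξ (ra (k * p) γ1) := by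
          rw [ra_smul, hξh _ _ hk]
          exact hx _ (by rw [dt_comm]; exact neg_ne_zero.2 a2) a1
        linarith
      have := hx u h1 h2
      linarith)
  set κ := 1 - m with hκ
  have hκ0 : 0 < κ := by rw [hκ]; linarith
  set s := (c / 2) / (6 / κ + 4) with hs
  have hs0 : 0 < s := by positivity
  have hsc : (6 / κ + 4) * s = c / 2 := by rw [hs]; field_simp
  obtain ⟨U0, hU0, hm0', happ0⟩ := homog_approx hφc hφh h hs0
  obtain ⟨U1, hU1, hm1', happ1⟩ := homog_approx hξc hξh γ1 hs0
  obtain ⟨U2, hU2, hm2', happ2⟩ := homog_approx hξc hξh γ2 hs0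
  refine ⟨(c / 2) / (3 / (κ * s) + 1 / s), ![h, γ1, γ2], ![U0, U1, U2], by positivity, ?_, ?_, ?_, ?_⟩
  · intro i; fin_cases i <;> assumption
  · intro i; fin_cases i <;> assumption
  · intro i; fin_cases i <;> assumption
  intro g0 hg0 g1 hg1 g2 hg2 f hf hQ
  have hg0' : g0 ∈ U0 := hg0
  have hg1' : g1 ∈ U1 := hg1
  have hg2' : g2 ∈ U2 := hg2
  have hne : ∀ᵐ u : ℂ, u ≠ 0 := by
    rw [ae_iff]; simp
  have hle : ∀ ψ : ℂ → ℝ, (∀ u, ψ u ≤ 1) → La f ψ ≠ ⊤ := by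
    intro ψ h1
    refine ne_top_of_le_ne_top hQ (lintegral_mono fun u => ENNReal.ofReal_le_ofReal ?_)
    nlinarith [h1 u, sq_nonneg (f u)]
  have hEi : ∀ (γ g : SL2), (∀ u, u ≠ 0 → |ξ (ra u g) - ξ (ra u γ)| < s) →
      La f (fun u => ξ (ra u γ)) ≤ La f ξ + ENNReal.ofReal s⁻¹ * D2 f g + ENNReal.ofReal s * Q2 f + ENNReal.ofReal s * Q2 f := by
    intro γ g hap
    refine le_trans ?_ (add_le_add (La_transfer hf hξm hξ0 hξ1 g hs0) le_rfl)
    unfold La Q2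
    rw [← lintegral_const_mul _ (by fun_prop), ← lintegral_add_left (by fun_prop)]
    apply lintegral_mono_ae
    filter_upwards [hne] with u hu
    have := hξ0 (ra u g)
    rw [← ENNReal.ofReal_mul (by positivity), ← ENNReal.ofReal_add (by positivity) (by positivity)]
    apply ENNReal.ofReal_le_ofReal
    have h3 := (abs_lt.1 (hap u hu)).1
    nlinarith [sq_nonneg (f u)]
  refine gap_arith (X := La f ξ) (P := La f φ) (Y1 := La f (fun u => ξ (ra u γ1)))
    (Y2 := La f (fun u => ξ (ra u γ2))) hκ0 hs0 hsc hQ (hle ξ hξ1) (hle φ hφ1) ?_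
    (hEi γ1 g1 (happ1 g1 hg1')) (hEi γ2 g2 (happ2 g2 hg2')) ?_ hc
  · refine le_trans ?_ (add_le_add (La_transfer hf hφm hφ0 hφ1 g0 hs0) le_rfl)
    unfold La Q2
    rw [← lintegral_const_mul _ (by fun_prop), ← lintegral_const_mul _ (by fun_prop), ← lintegral_add_left (by fun_prop), ← lintegral_add_left (by fun_prop)]
    apply lintegral_mono_ae
    filter_upwards [hne] with u hu
    have k1 := hφ0 (ra u g0)
    have k2 := hφ0 u
    have k3 := hξ0 u
    rw [← ENNReal.ofReal_mul (by positivity), ← ENNReal.ofReal_mul (by positivity), ← ENNReal.ofReal_add (by positivity) (by positivity),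
      ← ENNReal.ofReal_add (by positivity) (by positivity)]
    apply ENNReal.ofReal_le_ofReal
    have h3 := (abs_lt.1 (happ0 g0 hg0' u hu)).1
    have h4 := hstep u hu
    nlinarith [sq_nonneg (f u)]
  · unfold La Q2
    rw [← lintegral_const_mul _ (by fun_prop), ← lintegral_add_left (by fun_prop), ← lintegral_add_left (by fun_prop)]
    apply lintegral_mono_ae
    filter_upwards [hne] with u hu
    have k1 := hξ0 (ra u γ1)
    have k2 := hξ0 (ra u γ2)
    have k3 := hξ0 u
    rw [← ENNReal.ofReal_mul (by positivity), ← ENNReal.ofReal_add (by positivity) (by positivity),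
      ← ENNReal.ofReal_add (by positivity) (by positivity)]
    apply ENNReal.ofReal_le_ofReal
    have h4 := hlow u hu
    nlinarith [sq_nonneg (f u)]

theorem gap_disp {μ : Measure SL2} {ν : Measure ℂ} [IsProbabilityMeasure μ] [IsProbabilityMeasure ν]
    (hS : Setup μ ν) : ∃ c : ℝ, 0 < c ∧ c < 1 ∧ ∀ f : ℂ → ℝ, Measurable f → Q2 f ≠ ⊤ →
      ENNReal.ofReal c * Q2 f ≤ ∫⁻ g, D2 f g ∂μ := by
  obtain ⟨c, γ, U, hc, hγ, hU, hγU, hloc⟩ := gap_local hS.zd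
  choose n hn using fun i => mun_charge (hγ i)
  have hch : ∀ i, ∃ d : ℝ, 0 < d ∧ ENNReal.ofReal d ≤ mun μ (n i) (U i) := by
    intro i
    have h1 := hn i (U i) (hU i) (hγU i)
    refine ⟨(mun μ (n i) (U i)).toReal, ENNReal.toReal_pos h1.ne' (measure_ne_top _ _), ?_⟩
    rw [ENNReal.ofReal_toReal (measure_ne_top _ _)]
  choose d hd hdm using hch
  set e : Fin 3 → ℝ := fun i => c / 3 * d i / 4 ^ (n i) with he
  have he0 : ∀ i, 0 < e i := fun i => by have := hd i; simp only [he]; positivity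
  refine ⟨min (1/2) (min (e 0) (min (e 1) (e 2))), ?_, ?_, ?_⟩
  · simp [he0]
  · exact (min_le_left _ _).trans_lt (by norm_num)
  intro f hf hQ
  have key : ∃ i, ∀ g ∈ U i, ENNReal.ofReal (c / 3) * Q2 f ≤ D2 f g := by
    by_contra! hcon
    obtain ⟨g0, h0, h0'⟩ := hcon 0
    obtain ⟨g1, h1, h1'⟩ := hcon 1
    obtain ⟨g2, h2, h2'⟩ := hcon 2
    have h3 := hloc g0 h0 g1 h1 g2 h2 f hf hQ
    have h4 := ENNReal.add_lt_add (ENNReal.add_lt_add h0' h1') h2'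
    have h5 : ENNReal.ofReal (c / 3) * Q2 f + ENNReal.ofReal (c / 3) * Q2 f + ENNReal.ofReal (c / 3) * Q2 f = ENNReal.ofReal c * Q2 f := by
      rw [← add_mul, ← add_mul, ← ENNReal.ofReal_add (by positivity) (by positivity), ← ENNReal.ofReal_add (by positivity) (by positivity)]
      congr 2; ring
    rw [h5] at h4
    exact absurd h3 (not_le.2 h4)
  obtain ⟨i, hi⟩ := key
  have h1 : ENNReal.ofReal (c / 3) * Q2 f * ENNReal.ofReal (d i) ≤ 4 ^ (n i) * ∫⁻ g, D2 f g ∂μ := by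
    refine le_trans ?_ (lintegral_D2_mun hf (n i))
    calc _ ≤ ENNReal.ofReal (c / 3) * Q2 f * mun μ (n i) (U i) := by gcongr; exact hdm i
      _ = ∫⁻ g in U i, ENNReal.ofReal (c / 3) * Q2 f ∂(mun μ (n i)) := by rw [setLIntegral_const]
      _ ≤ ∫⁻ g in U i, D2 f g ∂(mun μ (n i)) := setLIntegral_mono (measurable_D2 hf) hi
      _ ≤ _ := setLIntegral_le_lintegral _ _
  have h2 : ENNReal.ofReal (e i) * Q2 f ≤ ∫⁻ g, D2 f g ∂μ := by
    have h4 : ENNReal.ofReal (4 ^ (n i)) = 4 ^ (n i) := by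
      rw [ENNReal.ofReal_pow (by norm_num)]; norm_num
    rw [← ENNReal.mul_le_mul_iff_right (a := 4 ^ (n i)) (by positivity) (by simp)]
    refine le_trans (le_of_eq ?_) h1
    rw [← h4, ← mul_assoc, ← ENNReal.ofReal_mul (by positivity), mul_right_comm, ← ENNReal.ofReal_mul (by positivity)]
    congr 2
    simp only [he]; field_simp
  refine le_trans ?_ h2
  gcongr
  fin_cases i <;> simp

end

section

open scoped ENNReal NNReal Topology

/-! ### Decay of negative moments -/

section
variable {μ : Measure SL2} [IsProbabilityMeasure μ]

theorem lazy_var {X : SL2 → ℝ} (hX : Measurable X) (h0 : ∀ g, 0 ≤ X g) (h1 : ∀ g, X g ≤ 1)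
    (hl : 1 / 2 ≤ μ {1}) :
    (∫ g, X g ∂μ) ^ 2 + 1 / 2 * ∫ g, (X g - X 1) ^ 2 ∂μ ≤ ∫ g, X g ^ 2 ∂μ := by
  have hms : MeasurableSet ({1} : Set SL2) := measurableSet_singleton 1
  have bdd : ∀ (Z : SL2 → ℝ) (C : ℝ), Measurable Z → (∀ g, |Z g| ≤ C) → Integrable Z μ := fun Z C hZ hC =>
    Integrable.of_bound hZ.aestronglyMeasurable C (ae_of_all _ hC)
  have iX := bdd X 1 hX (fun g => by rw [abs_le]; constructor <;> linarith [h0 g, h1 g])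
  set x := X 1
  have iY2 := bdd (fun g => (X g - x) ^ 2) 1 (by fun_prop) (fun g => by
    rw [abs_le]; constructor <;> nlinarith [h0 g, h1 g, h0 1, h1 1])
  set m := ∫ g, (X g - x) ∂μ with hm
  set I : SL2 → ℝ := ({1} : Set SL2)ᶜ.indicator 1 with hI
  have iI : Integrable I μ := bdd I 1 (measurable_one.indicator hms.compl) (fun g => by
    by_cases h : g ∈ ({1} : Set SL2)ᶜ <;> simp [hI, h])
  have eI : ∫ g, I g ∂μ ≤ 1 / 2 := by
    rw [hI, integral_indicator_one hms.compl, measureReal_compl hms, probReal_univ]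
    have : (1 / 2 : ℝ) ≤ μ.real {1} := by
      have := ENNReal.toReal_mono (measure_ne_top μ {1}) hl
      simpa [Measure.real] using this
    linarith
  have key : 0 ≤ ∫ g, ((X g - x) - 2 * m * I g) ^ 2 ∂μ := integral_nonneg (fun g => sq_nonneg _)
  have e1 : ∀ g, ((X g - x) - 2 * m * I g) ^ 2 = (X g - x) ^ 2 - 4 * m * (X g - x) + 4 * m ^ 2 * I g := by
    intro g
    by_cases h : g = 1
    · subst h; simp [hI, x]
    · have : I g = 1 := by simp [hI, h]
      rw [this]; ring
  have iY : Integrable (fun g => X g - x) μ := iX.sub (integrable_const _)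
  simp only [e1] at key
  have hkk : ∫ g, ((X g - x) ^ 2 - 4 * m * (X g - x) + 4 * m ^ 2 * I g) ∂μ
      = ∫ g, (X g - x) ^ 2 ∂μ - 4 * m * m + 4 * m ^ 2 * ∫ g, I g ∂μ := by
    rw [integral_add (f := fun g => (X g - x) ^ 2 - 4 * m * (X g - x)) (iY2.sub (iY.const_mul _)) (iI.const_mul _),
      integral_sub iY2 (iY.const_mul _), integral_const_mul, integral_const_mul, ← hm]
  rw [hkk] at key
  have e2 : ∫ g, X g ∂μ = x + m := by
    rw [hm, integral_sub iX (integrable_const _)]; simp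
  have e3 : ∫ g, X g ^ 2 ∂μ = x ^ 2 + 2 * x * m + ∫ g, (X g - x) ^ 2 ∂μ := by
    have : ∀ g, X g ^ 2 = (x ^ 2 + 2 * x * (X g - x)) + (X g - x) ^ 2 := fun g => by ring
    simp only [this]
    rw [integral_add (f := fun g => x ^ 2 + 2 * x * (X g - x)) ((integrable_const _).add (iY.const_mul _)) iY2,
      integral_add (integrable_const _) (iY.const_mul _), integral_const_mul, ← hm]
    simp
  rw [e2, e3]
  nlinarith [mul_nonneg (sq_nonneg m) (sub_nonneg.2 eI)]

/-- the probability that the walk stays in the unit ball -/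
def FF (μ : Measure SL2) : ℕ → ℂ → ℝ
  | 0 => (Metric.ball (0 : ℂ) 1).indicator 1
  | n + 1 => fun u => ∫ g, FF μ n (ra u g) ∂μ

theorem FF_props (n : ℕ) : Measurable (FF μ n) ∧ (∀ u, 0 ≤ FF μ n u) ∧ ∀ u, FF μ n u ≤ 1 := by
  induction n with
  | zero =>
    refine ⟨measurable_one.indicator measurableSet_ball, fun u => ?_, fun u => ?_⟩
    · exact Set.indicator_nonneg (fun _ _ => zero_le_one) _
    · exact Set.indicator_le_self' (fun _ _ => zero_le_one) _
  | succ n ih =>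
    obtain ⟨h1, h2, h3⟩ := ih
    refine ⟨?_, fun u => integral_nonneg fun g => h2 _, fun u => ?_⟩
    · have : Measurable (fun p : ℂ × SL2 => FF μ n (ra p.1 p.2)) := by fun_prop
      exact (this.stronglyMeasurable.integral_prod_right' (ν := μ)).measurable
    · calc ∫ g, FF μ n (ra u g) ∂μ ≤ ∫ g, (1 : ℝ) ∂μ := by
            apply integral_mono_of_nonneg (ae_of_all _ fun g => h2 _) (integrable_const _) (ae_of_all _ fun g => h3 _)
        _ = 1 := by simp

theorem FF_ofReal (n : ℕ) (u : ℂ) :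
    ENNReal.ofReal (FF μ n u) = ∫⁻ g, (Metric.ball (0 : ℂ) 1).indicator 1 (ra u g) ∂(mun μ n) := by
  have hmi : Measurable ((Metric.ball (0 : ℂ) 1).indicator (1 : ℂ → ℝ≥0∞)) := measurable_one.indicator measurableSet_ball
  induction n generalizing u with
  | zero =>
    rw [lintegral_mun_zero (fun g => (Metric.ball (0 : ℂ) 1).indicator 1 (ra u g)) (by fun_prop), ra_one]
    by_cases h : u ∈ Metric.ball (0 : ℂ) 1 <;> simp only [FF, Set.indicator, h] <;> simp
  | succ n ih =>
    obtain ⟨h1, h2, h3⟩ := FF_props (μ := μ) n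
    rw [lintegral_mun_succ n (fun g => (Metric.ball (0 : ℂ) 1).indicator 1 (ra u g)) (by fun_prop)]
    simp only [ra_mul, ← ih]
    rw [FF, ofReal_integral_eq_lintegral_ofReal _ (ae_of_all _ fun g => h2 _)]
    refine Integrable.of_bound (by fun_prop : Measurable fun g => FF μ n (ra u g)).aestronglyMeasurable 1 (ae_of_all _ fun g => ?_)
    rw [Real.norm_eq_abs, abs_of_nonneg (h2 _)]; exact h3 _

theorem FF_step {ν : Measure ℂ} [IsProbabilityMeasure ν] (hS : Setup μ ν) (n : ℕ) :
    Q2 (FF μ (n + 1)) + ENNReal.ofReal (1 / 2) * ∫⁻ g, D2 (FF μ n) g ∂μ ≤ Q2 (FF μ n) := by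
  obtain ⟨h1, h2, h3⟩ := FF_props (μ := μ) n
  obtain ⟨k1, k2, k3⟩ := FF_props (μ := μ) (n + 1)
  have hm : Measurable (fun p : ℂ × SL2 => ENNReal.ofReal ((FF μ n (ra p.1 p.2) - FF μ n p.1) ^ 2)) := by fun_prop
  have hm2 : Measurable (fun p : ℂ × SL2 => ENNReal.ofReal ((FF μ n (ra p.1 p.2)) ^ 2)) := by fun_prop
  have e1 : ∫⁻ g, D2 (FF μ n) g ∂μ = ∫⁻ u, ∫⁻ g, ENNReal.ofReal ((FF μ n (ra u g) - FF μ n u) ^ 2) ∂μ := by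
    unfold D2
    exact lintegral_lintegral_swap (hm.comp measurable_swap).aemeasurable
  have e2 : Q2 (FF μ n) = ∫⁻ u, ∫⁻ g, ENNReal.ofReal ((FF μ n (ra u g)) ^ 2) ∂μ := by
    rw [lintegral_lintegral_swap hm2.aemeasurable]
    have : ∀ g, ∫⁻ u, ENNReal.ofReal ((FF μ n (ra u g)) ^ 2) = Q2 (FF μ n) := fun g =>
      lintegral_ra g (fun u => ENNReal.ofReal (FF μ n u ^ 2)) (by fun_prop)
    simp [this]
  rw [e1, e2, ← lintegral_const_mul _ hm.lintegral_prod_right', Q2, ← lintegral_add_left (by fun_prop)]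
  apply lintegral_mono
  intro u
  simp only
  have bdd : ∀ (Z : SL2 → ℝ), Measurable Z → (∀ g, 0 ≤ Z g) → (∀ g, Z g ≤ 1) → Integrable Z μ := fun Z hZ hC hD =>
    Integrable.of_bound hZ.aestronglyMeasurable 1 (ae_of_all _ fun g => by
      rw [Real.norm_eq_abs, abs_of_nonneg (hC g)]; exact hD g)
  rw [← ofReal_integral_eq_lintegral_ofReal (bdd _ (by fun_prop) (fun g => sq_nonneg _) (fun g => by
      nlinarith [h2 u, h3 u, h2 (ra u g), h3 (ra u g)])) (ae_of_all _ fun g => sq_nonneg _),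
    ← ofReal_integral_eq_lintegral_ofReal (bdd _ (by fun_prop) (fun g => sq_nonneg _) (fun g => by
      nlinarith [h2 u, h3 u, h2 (ra u g), h3 (ra u g)])) (ae_of_all _ fun g => sq_nonneg _),
    ← ENNReal.ofReal_mul (by norm_num), ← ENNReal.ofReal_add (sq_nonneg _)
      (mul_nonneg (by norm_num) (integral_nonneg fun g => sq_nonneg _))]
  apply ENNReal.ofReal_le_ofReal
  have := lazy_var (X := fun g => FF μ n (ra u g)) (by fun_prop) (fun g => h2 _) (fun g => h3 _) hS.lazy
  simpa only [ra_one, FF] using this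

theorem FF_decay {ν : Measure ℂ} [IsProbabilityMeasure ν] (hS : Setup μ ν) :
    ∃ r : ℝ, 0 < r ∧ r < 1 ∧ ∀ n, Q2 (FF μ n) ≤ ENNReal.ofReal (r ^ (2 * n)) * volume (Metric.ball (0 : ℂ) 1) := by
  obtain ⟨c, hc, hc1, hgap⟩ := gap_disp hS
  refine ⟨Real.sqrt (1 - c / 2), Real.sqrt_pos.2 (by linarith), ?_, fun n => ?_⟩
  · rw [Real.sqrt_lt' one_pos]; linarith
  rw [pow_mul, Real.sq_sqrt (by linarith)]
  have hvol : volume (Metric.ball (0 : ℂ) 1) ≠ ⊤ := measure_ball_lt_top.ne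
  induction n with
  | zero =>
    simp only [pow_zero, ENNReal.ofReal_one, one_mul]
    rw [Q2, ← lintegral_indicator_one measurableSet_ball]
    apply lintegral_mono
    intro u
    by_cases h : u ∈ Metric.ball (0 : ℂ) 1 <;> simp only [FF, Set.indicator, h] <;> simp
  | succ n ih =>
    have hfin : Q2 (FF μ n) ≠ ⊤ := ne_top_of_le_ne_top (ENNReal.mul_ne_top ENNReal.ofReal_ne_top hvol) ih
    have h1 := hgap (FF μ n) (FF_props n).1 hfin
    have h2 := FF_step hS n
    have h3 : Q2 (FF μ (n + 1)) + ENNReal.ofReal (c / 2) * Q2 (FF μ n) ≤ Q2 (FF μ n) := by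
      refine le_trans ?_ h2
      refine add_le_add le_rfl ?_
      rw [show c / 2 = 1 / 2 * c by ring, ENNReal.ofReal_mul (by norm_num), mul_assoc]
      gcongr
    have h4 : Q2 (FF μ (n + 1)) ≤ ENNReal.ofReal (1 - c / 2) * Q2 (FF μ n) := by
      have e : Q2 (FF μ n) = ENNReal.ofReal (1 - c / 2) * Q2 (FF μ n) + ENNReal.ofReal (c / 2) * Q2 (FF μ n) := by
        rw [← add_mul, ← ENNReal.ofReal_add (by linarith) (by linarith)]; simp
      rw [e] at h3
      have h5 : ENNReal.ofReal (c / 2) * Q2 (FF μ n) ≠ ⊤ := ENNReal.mul_ne_top ENNReal.ofReal_ne_top hfin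
      have h6 : Q2 (FF μ (n + 1)) + ENNReal.ofReal (c / 2) * Q2 (FF μ n)
          ≤ ENNReal.ofReal (1 - c / 2) * Q2 (FF μ n) + ENNReal.ofReal (c / 2) * Q2 (FF μ n) := by
        refine le_trans ?_ h3
        rw [← e]
      exact (ENNReal.add_le_add_iff_right h5).1 h6
    calc _ ≤ _ := h4
      _ ≤ ENNReal.ofReal (1 - c / 2) * (ENNReal.ofReal ((1 - c / 2) ^ n) * volume (Metric.ball (0 : ℂ) 1)) := by gcongr
      _ = _ := by rw [← mul_assoc, ← ENNReal.ofReal_mul (by linarith), pow_succ']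

theorem NN_decay {ν : Measure ℂ} [IsProbabilityMeasure ν] (hS : Setup μ ν) :
    ∃ r : ℝ, 0 < r ∧ r < 1 ∧ ∀ n, ∫⁻ g, ENNReal.ofReal ((NN g)⁻¹ ^ 2) ∂(mun μ n) ≤ ENNReal.ofReal (r ^ n) := by
  obtain ⟨r, hr, hr1, hd⟩ := FF_decay hS
  refine ⟨r, hr, hr1, fun n => ?_⟩
  set V := volume (Metric.ball (0 : ℂ) 1) with hV
  have hV0 : V ≠ 0 := (Metric.measure_ball_pos _ _ one_pos).ne'
  have hVt : V ≠ ⊤ := measure_ball_lt_top.ne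
  have hmi : Measurable ((Metric.ball (0 : ℂ) 1).indicator (1 : ℂ → ℝ≥0∞)) := measurable_one.indicator measurableSet_ball
  have hF := (FF_props (μ := μ) n)
  have hFm := hF.1
  rw [← ENNReal.mul_le_mul_iff_left hV0 hVt]
  calc (∫⁻ g, ENNReal.ofReal ((NN g)⁻¹ ^ 2) ∂(mun μ n)) * V
      = ∫⁻ g, volume (Metric.ball (0 : ℂ) (NN g)⁻¹) ∂(mun μ n) := by
        rw [← lintegral_mul_const _ (by fun_prop)]
        congr 1; ext g
        have := Measure.addHaar_ball (volume : Measure ℂ) 0 (inv_nonneg.2 (NN_nonneg g))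
        rw [this, Complex.finrank_real_complex]
    _ ≤ ∫⁻ g, (∫⁻ u in Metric.ball (0 : ℂ) 1, (Metric.ball (0 : ℂ) 1).indicator 1 (ra u g)) ∂(mun μ n) := by
        apply lintegral_mono
        intro g
        simp only
        rw [← lintegral_indicator_one measurableSet_ball, ← lintegral_indicator measurableSet_ball]
        apply lintegral_mono
        intro u
        by_cases h : u ∈ Metric.ball (0 : ℂ) (NN g)⁻¹
        · rw [mem_ball_zero_iff] at h
          have hp := NN_pos g
          have h1 : ‖u‖ < 1 := h.trans_le (inv_le_one_of_one_le₀ (one_le_NN g))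
          have h2 : ‖ra u g‖ < 1 := by
            calc ‖ra u g‖ ≤ NN g * ‖u‖ := norm_ra_le u g
              _ < NN g * (NN g)⁻¹ := by gcongr
              _ = 1 := mul_inv_cancel₀ hp.ne'
          have h1' : u ∈ Metric.ball (0 : ℂ) 1 := mem_ball_zero_iff.2 h1
          have h2' : ra u g ∈ Metric.ball (0 : ℂ) 1 := mem_ball_zero_iff.2 h2
          simp only [Set.indicator_of_mem h1', Set.indicator_of_mem h2']
          exact Set.indicator_le_self' (fun _ _ => zero_le_one) _
        · simp [h]
    _ = ∫⁻ u in Metric.ball (0 : ℂ) 1, ENNReal.ofReal (FF μ n u) := by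
        rw [lintegral_lintegral_swap]
        · simp only [FF_ofReal]
        · exact (hmi.comp (measurable_ra.comp measurable_swap)).aemeasurable
    _ ≤ ∫⁻ u in Metric.ball (0 : ℂ) 1, (ENNReal.ofReal (r ^ n / 2) + ENNReal.ofReal ((r ^ n)⁻¹ / 2) * ENNReal.ofReal (FF μ n u ^ 2)) := by
        apply lintegral_mono
        intro u
        simp only
        rw [← ENNReal.ofReal_mul (by positivity), ← ENNReal.ofReal_add (by positivity) (by positivity)]
        apply ENNReal.ofReal_le_ofReal
        have hs : 0 < r ^ n := by positivity
        have h4 : r ^ n / 2 + (r ^ n)⁻¹ / 2 * FF μ n u ^ 2 - FF μ n u = (r ^ n)⁻¹ / 2 * (FF μ n u - r ^ n) ^ 2 := by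
          field_simp; ring
        have : 0 ≤ (r ^ n)⁻¹ / 2 * (FF μ n u - r ^ n) ^ 2 := by positivity
        linarith
    _ ≤ ENNReal.ofReal (r ^ n / 2) * V + ENNReal.ofReal ((r ^ n)⁻¹ / 2) * Q2 (FF μ n) := by
        rw [lintegral_add_left (by fun_prop), lintegral_const_mul _ (by fun_prop)]
        simp only [lintegral_const, Measure.restrict_apply MeasurableSet.univ, Set.univ_inter]
        gcongr
        exact setLIntegral_le_lintegral _ _
    _ ≤ ENNReal.ofReal (r ^ n / 2) * V + ENNReal.ofReal ((r ^ n)⁻¹ / 2) * (ENNReal.ofReal (r ^ (2 * n)) * V) := by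
        gcongr; exact hd n
    _ = ENNReal.ofReal (r ^ n) * V := by
        rw [← mul_assoc, ← ENNReal.ofReal_mul (by positivity), ← add_mul, ← ENNReal.ofReal_add (by positivity) (by positivity)]
        congr 2
        rw [two_mul, pow_add]; field_simp; ring

end

end

section

open scoped ENNReal NNReal Topology

/-! ### Contraction -/

section
variable {μ : Measure SL2} [IsProbabilityMeasure μ]

theorem jensen_rpow {α : Type*} [MeasurableSpace α] {ρ : Measure α} [IsProbabilityMeasure ρ] {f : α → ℝ}
    (hf : Measurable f) (h0 : ∀ x, 0 ≤ f x) {c t : ℝ} (hc : 0 < c) (ht0 : 0 ≤ t) (ht1 : t ≤ 1)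
    (h : ∫⁻ x, ENNReal.ofReal (f x) ∂ρ ≤ ENNReal.ofReal c) :
    ∫⁻ x, ENNReal.ofReal (f x ^ t) ∂ρ ≤ ENNReal.ofReal (c ^ t) := by
  have hct : 0 < c ^ t := Real.rpow_pos_of_pos hc t
  have key : ∀ x, f x ^ t ≤ c ^ t * (1 - t) + c ^ t * t / c * f x := by
    intro x
    have := Real.geom_mean_le_arith_mean2_weighted (w₁ := t) (w₂ := 1 - t) ht0 (by linarith)
      (div_nonneg (h0 x) hc.le) zero_le_one (by ring)
    rw [Real.one_rpow, mul_one, Real.div_rpow (h0 x) hc.le, div_le_iff₀ hct] at this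
    calc f x ^ t ≤ _ := this
      _ = _ := by field_simp; ring
  calc ∫⁻ x, ENNReal.ofReal (f x ^ t) ∂ρ
      ≤ ∫⁻ x, (ENNReal.ofReal (c ^ t * (1 - t)) + ENNReal.ofReal (c ^ t * t / c) * ENNReal.ofReal (f x)) ∂ρ := by
        apply lintegral_mono
        intro x
        simp only
        have h1 : 0 ≤ c ^ t * (1 - t) := mul_nonneg hct.le (by linarith)
        have h2 : 0 ≤ c ^ t * t / c := by positivity
        rw [← ENNReal.ofReal_mul h2, ← ENNReal.ofReal_add h1 (mul_nonneg h2 (h0 x))]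
        exact ENNReal.ofReal_le_ofReal (key x)
    _ ≤ ENNReal.ofReal (c ^ t * (1 - t)) + ENNReal.ofReal (c ^ t * t / c) * ENNReal.ofReal c := by
        rw [lintegral_add_left (by fun_prop), lintegral_const_mul _ (by fun_prop)]
        simp only [lintegral_const, measure_univ, mul_one]
        gcongr
    _ = _ := by
        have h1 : 0 ≤ c ^ t * (1 - t) := mul_nonneg hct.le (by linarith)
        have h2 : 0 ≤ c ^ t * t / c := by positivity
        rw [← ENNReal.ofReal_mul h2, ← ENNReal.ofReal_add h1 (by positivity)]
        congr 1; field_simp; ring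

theorem mom_mun {a M : ℝ} (ha : 0 ≤ a) (hM : 0 ≤ M) (h : ∫⁻ g, ENNReal.ofReal (NN g ^ a) ∂μ ≤ ENNReal.ofReal M) (n : ℕ) :
    ∫⁻ g, ENNReal.ofReal (NN g ^ a) ∂(mun μ n) ≤ ENNReal.ofReal (M ^ n) * ENNReal.ofReal (NN 1 ^ a) := by
  have hm : Measurable (fun g : SL2 => ENNReal.ofReal (NN g ^ a)) := by fun_prop
  induction n with
  | zero => rw [lintegral_mun_zero _ hm]; simp
  | succ n ih =>
    rw [lintegral_mun_succ _ _ hm]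
    calc _ ≤ ∫⁻ g, ENNReal.ofReal (NN g ^ a) * ∫⁻ h, ENNReal.ofReal (NN h ^ a) ∂(mun μ n) ∂μ := by
          apply lintegral_mono
          intro g
          simp only
          rw [← lintegral_const_mul _ hm]
          apply lintegral_mono
          intro k
          simp only
          rw [← ENNReal.ofReal_mul (Real.rpow_nonneg (NN_nonneg g) _), ← Real.mul_rpow (NN_nonneg _) (NN_nonneg _)]
          exact ENNReal.ofReal_le_ofReal (Real.rpow_le_rpow (NN_nonneg _) (NN_mul_le _ _) ha)
      _ = (∫⁻ g, ENNReal.ofReal (NN g ^ a) ∂μ) * ∫⁻ h, ENNReal.ofReal (NN h ^ a) ∂(mun μ n) := lintegral_mul_const _ hm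
      _ ≤ ENNReal.ofReal M * (ENNReal.ofReal (M ^ n) * ENNReal.ofReal (NN 1 ^ a)) := by gcongr
      _ = _ := by rw [← mul_assoc, ← ENNReal.ofReal_mul hM, pow_succ']

theorem row_big (g : SL2) : NN g / 2 ≤ ‖ra 1 g‖ ∨ NN g / 2 ≤ ‖ra Complex.I g‖ := by
  by_contra! h
  have h1 : ‖ra 1 g‖ ^ 2 = g.1 0 0 ^ 2 + g.1 0 1 ^ 2 := by rw [normsq]; simp [ra]
  have h2 : ‖ra Complex.I g‖ ^ 2 = g.1 1 0 ^ 2 + g.1 1 1 ^ 2 := by rw [normsq]; simp [ra]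
  have h3 := NN_sq g
  have h4 := NN_pos g
  have h5 := norm_nonneg (ra 1 g)
  have h6 := norm_nonneg (ra Complex.I g)
  nlinarith

theorem bad_set {ν : Measure ℂ} [IsProbabilityMeasure ν] (hS : Setup μ ν) {δ : ℝ} {e : ℝ≥0∞} (hδ : 0 < δ)
    (hlm : ∀ u, u ≠ 0 → lm ν u δ ≤ e) (n : ℕ) {u : ℂ} (hu : u ≠ 0) :
    mun μ n {g | ‖ra u g‖ < δ ^ 2 * NN g / 2 * ‖u‖} ≤ 2 * e := by
  have hms : MeasurableSet {g : SL2 | ‖ra u g‖ < δ ^ 2 * NN g / 2 * ‖u‖} :=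
    measurableSet_lt (by fun_prop) (by fun_prop)
  rw [← lintegral_indicator_one hms]
  have hst := hS.stat_mun n ({x : ℂ | |pr u x| ≤ δ * (‖u‖ * ‖x‖)}.indicator 1)
    (measurable_one.indicator (measurableSet_lm u δ)) (by
      intro c x hc
      have : (c : ℂ) * x ∈ {x : ℂ | |pr u x| ≤ δ * (‖u‖ * ‖x‖)} ↔ x ∈ {x : ℂ | |pr u x| ≤ δ * (‖u‖ * ‖x‖)} := by
        simp only [Set.mem_ofPred_eq, pr_smul', abs_mul, norm_mul, Complex.norm_real, Real.norm_eq_abs]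
        have h1 : 0 < |c| := abs_pos.2 hc
        rw [show δ * (‖u‖ * (|c| * ‖x‖)) = |c| * (δ * (‖u‖ * ‖x‖)) by ring]
        exact mul_le_mul_iff_right₀ h1
      by_cases h : x ∈ {x : ℂ | |pr u x| ≤ δ * (‖u‖ * ‖x‖)}
      · rw [Set.indicator_of_mem h, Set.indicator_of_mem (this.2 h)]; rfl
      · rw [Set.indicator_of_notMem h, Set.indicator_of_notMem (fun h' => h (this.1 h'))])
  rw [lintegral_indicator_one (measurableSet_lm u δ)] at hst
  have hA : ∀ g : SL2, ∫⁻ x, ({x : ℂ | |pr u x| ≤ δ * (‖u‖ * ‖x‖)}.indicator 1 (ca g x) : ℝ≥0∞) ∂ν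
      = ν {x | |pr u (ca g x)| ≤ δ * (‖u‖ * ‖ca g x‖)} := by
    intro g
    have hm : MeasurableSet {x | |pr u (ca g x)| ≤ δ * (‖u‖ * ‖ca g x‖)} :=
      (measurable_ca.comp measurable_prodMk_left : Measurable (fun x => ca g x)) (measurableSet_lm u δ)
    rw [← lintegral_indicator_one hm]; rfl
  have hB : ∀ g : SL2, g ∈ {g | ‖ra u g‖ < δ ^ 2 * NN g / 2 * ‖u‖} →
      1 ≤ ν {x | |pr u (ca g x)| ≤ δ * (‖u‖ * ‖ca g x‖)} + e := by
    intro g hg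
    obtain ⟨e1, he1, he1n, hrow⟩ : ∃ e1 : ℂ, e1 ≠ 0 ∧ ‖e1‖ ≤ 1 ∧ NN g / 2 ≤ ‖ra e1 g‖ := by
      rcases row_big g with h | h
      · exact ⟨1, one_ne_zero, by simp, h⟩
      · exact ⟨Complex.I, Complex.I_ne_zero, by simp, h⟩
    have h2 := hlm (ra e1 g) (ra_ne_zero he1 g)
    calc (1 : ℝ≥0∞) = ν Set.univ := measure_univ.symm
      _ ≤ ν ({x | |pr u (ca g x)| ≤ δ * (‖u‖ * ‖ca g x‖)} ∪ {x | |pr (ra e1 g) x| ≤ δ * (‖ra e1 g‖ * ‖x‖)}) := by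
          apply measure_mono_ae
          filter_upwards [hS.unit] with x hx _
          by_contra hcon
          have hcon1 : ¬ (|pr u (ca g x)| ≤ δ * (‖u‖ * ‖ca g x‖)) := fun h => hcon (Or.inl h)
          have hcon2 : ¬ (|pr (ra e1 g) x| ≤ δ * (‖ra e1 g‖ * ‖x‖)) := fun h => hcon (Or.inr h)
          push Not at hcon1 hcon2
          rw [hx, mul_one, pr_ra] at hcon2
          have h3 := abs_pr_le e1 (ca g x)
          have h4 := abs_pr_le (ra u g) x
          rw [hx, mul_one, pr_ra] at h4
          have hg' : ‖ra u g‖ < δ ^ 2 * NN g / 2 * ‖u‖ := hg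
          have h5 : δ * (NN g / 2) ≤ ‖ca g x‖ := by
            have : δ * (NN g / 2) ≤ δ * ‖ra e1 g‖ := by gcongr
            have : ‖e1‖ * ‖ca g x‖ ≤ ‖ca g x‖ := mul_le_of_le_one_left (norm_nonneg _) he1n
            linarith
          have h6 : δ * (‖u‖ * (δ * (NN g / 2))) ≤ δ * (‖u‖ * ‖ca g x‖) := by gcongr
          nlinarith
      _ ≤ _ := measure_union_le _ _
      _ ≤ _ := by
          gcongr
          exact h2
  calc ∫⁻ g, {g | ‖ra u g‖ < δ ^ 2 * NN g / 2 * ‖u‖}.indicator 1 g ∂(mun μ n)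
      ≤ ∫⁻ g, (ν {x | |pr u (ca g x)| ≤ δ * (‖u‖ * ‖ca g x‖)} + e) ∂(mun μ n) := by
        apply lintegral_mono
        intro g
        by_cases h : g ∈ {g | ‖ra u g‖ < δ ^ 2 * NN g / 2 * ‖u‖}
        · simp only [Set.indicator_of_mem h]; exact hB g h
        · simp only [Set.indicator_of_notMem h]; exact zero_le
    _ = lm ν u δ + e := by
        rw [lintegral_add_right _ measurable_const, lm, hst]
        simp only [hA, lintegral_const, measure_univ, mul_one]
    _ ≤ 2 * e := by rw [two_mul]; gcongr; exact hlm u hu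


theorem contraction {ν : Measure ℂ} [IsProbabilityMeasure ν] (hS : Setup μ ν) :
    ∃ (n : ℕ) (ε θ : ℝ), 0 < n ∧ 0 < ε ∧ ε ≤ 1 ∧ 0 < θ ∧ θ < 1 ∧ ∫⁻ g, ENNReal.ofReal (NN g ^ ε) ∂μ < ⊤ ∧
      ∀ u, u ≠ 0 → ∫⁻ g, ENNReal.ofReal (‖ra u g‖ ^ (-ε)) ∂(mun μ n) ≤ ENNReal.ofReal (θ * ‖u‖ ^ (-ε)) := by
  obtain ⟨a, ha, hmom⟩ := hS.mom
  obtain ⟨r, hr, hr1, hdec⟩ := NN_decay hS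
  set M := (∫⁻ g, ENNReal.ofReal (NN g ^ a) ∂μ).toReal with hM
  have hMM : ∫⁻ g, ENNReal.ofReal (NN g ^ a) ∂μ ≤ ENNReal.ofReal M := by rw [hM, ENNReal.ofReal_toReal hmom.ne]
  have hM0 : 0 ≤ M := ENNReal.toReal_nonneg
  set K := (M + 1) * NN 1 ^ a with hK
  have hN1 : 1 ≤ NN 1 ^ a := Real.one_le_rpow (one_le_NN 1) ha.le
  have hK0 : 0 < K := by positivity
  have hKn : ∀ n : ℕ, 0 < n → ∫⁻ g, ENNReal.ofReal (NN g ^ a) ∂(mun μ n) ≤ ENNReal.ofReal (K ^ n) := by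
    intro n hn
    refine (mom_mun ha.le hM0 hMM n).trans ?_
    rw [← ENNReal.ofReal_mul (by positivity)]
    apply ENNReal.ofReal_le_ofReal
    rw [hK, mul_pow]
    have h1 : M ^ n ≤ (M + 1) ^ n := by gcongr; linarith
    have h2 : NN 1 ^ a ≤ (NN 1 ^ a) ^ n := le_self_pow₀ hN1 hn.ne'
    gcongr
  set ρ := r ^ (a / 4) with hρ
  have hρ0 : 0 < ρ := Real.rpow_pos_of_pos hr _
  have hρ1 : ρ < 1 := Real.rpow_lt_one hr.le hr1 (by positivity)
  set s := (1 - ρ) / (2 * K) with hs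
  have hs0 : 0 < s := div_pos (by linarith) (by positivity)
  set e := s * (1 - ρ) / 4 with he
  have he0 : 0 < e := by
    have : 0 < 1 - ρ := by linarith
    positivity
  obtain ⟨δ, hδ, hδ1, hlm⟩ := lm_unif hS (ε := ENNReal.ofReal e) (ENNReal.ofReal_pos.2 he0)
  have hd : 0 < 2 / δ ^ 2 := by positivity
  have t1 : Tendsto (fun n : ℕ => a / (2 * n)) atTop (𝓝 0) := by
    have : Tendsto (fun n : ℕ => (2 * n : ℝ)) atTop atTop :=
      tendsto_natCast_atTop_atTop.const_mul_atTop (by norm_num)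
    exact this.const_div_atTop a
  have t2 : Tendsto (fun n : ℕ => (2 / δ ^ 2) ^ (a / (2 * n))) atTop (𝓝 1) := by
    have := (Real.continuous_const_rpow hd.ne').tendsto 0 |>.comp t1
    simpa [Function.comp_def] using this
  have ev := ((t1.eventually (gt_mem_nhds (zero_lt_one' ℝ))).and (t1.eventually (gt_mem_nhds ha))).and
    ((t2.eventually (gt_mem_nhds (show (1 : ℝ) < 1 + (1 - ρ) / 4 by linarith))).and (eventually_gt_atTop 0))
  obtain ⟨n, ⟨hn1, hna⟩, hn2, hn0⟩ := ev.exists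
  have hnR : (0 : ℝ) < n := Nat.cast_pos.2 hn0
  set ε := a / (2 * n) with hε
  have hε0 : 0 < ε := by positivity
  refine ⟨n, ε, ρ + 3 * (1 - ρ) / 4, hn0, hε0, hn1.le, by nlinarith, by linarith, ?_, ?_⟩
  · refine lt_of_le_of_lt (lintegral_mono fun g => ?_) hmom
    exact ENNReal.ofReal_le_ofReal (Real.rpow_le_rpow_of_exponent_le (one_le_NN g) hna.le)
  intro u hu
  have hun : 0 < ‖u‖ := norm_pos_iff.2 hu
  -- three moment bounds
  have b1 : ∫⁻ g, ENNReal.ofReal (NN g ^ (-ε)) ∂(mun μ n) ≤ ENNReal.ofReal ρ := by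
    have := jensen_rpow (ρ := mun μ n) (f := fun g => (NN g)⁻¹ ^ 2) (by fun_prop) (fun g => by positivity) (c := r ^ n) (t := ε / 2)
      (by positivity) (by positivity) (by linarith) (hdec n)
    convert this using 2
    · ext g
      rw [← Real.rpow_natCast, ← Real.rpow_mul (inv_nonneg.2 (NN_nonneg g)), Real.inv_rpow (NN_nonneg g), Real.rpow_neg (NN_nonneg g)]
      congr 3; push_cast; ring
    · rw [hρ, ← Real.rpow_natCast, ← Real.rpow_mul hr.le]; congr 1; rw [hε]; field_simp; ring
  have b2 : ∫⁻ g, ENNReal.ofReal (NN g ^ (2 * ε)) ∂(mun μ n) ≤ ENNReal.ofReal K := by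
    have := jensen_rpow (ρ := mun μ n) (f := fun g => NN g ^ a) (by fun_prop) (fun g => Real.rpow_nonneg (NN_nonneg g) _) (c := K ^ n) (t := 1 / n)
      (by positivity) (by positivity) (by rw [div_le_one hnR]; exact_mod_cast hn0) (hKn n hn0)
    convert this using 2
    · ext g
      rw [← Real.rpow_mul (NN_nonneg g)]
      congr 2; rw [hε]; field_simp
    · rw [← Real.rpow_natCast, ← Real.rpow_mul hK0.le, mul_one_div_cancel hnR.ne', Real.rpow_one]
  have b3 := bad_set hS hδ hlm n hu
  set bad : Set SL2 := {g | ‖ra u g‖ < δ ^ 2 * NN g / 2 * ‖u‖} with hbad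
  have hms : MeasurableSet bad := measurableSet_lt (by fun_prop) (by fun_prop)
  have hmi : Measurable (bad.indicator (1 : SL2 → ℝ≥0∞)) := measurable_one.indicator hms
  have pt : ∀ g, ENNReal.ofReal (‖ra u g‖ ^ (-ε)) ≤ ENNReal.ofReal (‖u‖ ^ (-ε)) *
      (ENNReal.ofReal ((2 / δ ^ 2) ^ ε) * ENNReal.ofReal (NN g ^ (-ε)) +
        (ENNReal.ofReal (s / 2) * ENNReal.ofReal (NN g ^ (2 * ε)) + ENNReal.ofReal (s⁻¹ / 2) * bad.indicator 1 g)) := by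
    intro g
    have hg0 := NN_pos g
    have hra : 0 < ‖ra u g‖ := norm_pos_iff.2 (ra_ne_zero hu g)
    by_cases h : g ∈ bad
    · rw [Set.indicator_of_mem h, Pi.one_apply, mul_one]
      have h1 : ‖ra u g‖ ^ (-ε) ≤ ‖u‖ ^ (-ε) * NN g ^ ε := by
        have h2 : ‖u‖ / NN g ≤ ‖ra u g‖ := by
          rw [div_le_iff₀ hg0, mul_comm]; exact norm_le_ra u g
        calc ‖ra u g‖ ^ (-ε) ≤ (‖u‖ / NN g) ^ (-ε) :=
              Real.rpow_le_rpow_of_nonpos (by positivity) h2 (by linarith)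
          _ = _ := by
              rw [Real.div_rpow hun.le hg0.le, Real.rpow_neg hg0.le]; field_simp
      have h3 : NN g ^ ε ≤ s / 2 * NN g ^ (2 * ε) + s⁻¹ / 2 := by
        have e2 : NN g ^ (2 * ε) = (NN g ^ ε) ^ 2 := by
          rw [mul_comm, Real.rpow_mul hg0.le]; norm_cast
        rw [e2]
        set y := NN g ^ ε
        have : s / 2 * y ^ 2 + s⁻¹ / 2 - y = s / 2 * (y - s⁻¹) ^ 2 := by field_simp; ring
        have : 0 ≤ s / 2 * (y - s⁻¹) ^ 2 := by positivity
        linarith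
      calc ENNReal.ofReal (‖ra u g‖ ^ (-ε)) ≤ ENNReal.ofReal (‖u‖ ^ (-ε)) *
            (ENNReal.ofReal (s / 2) * ENNReal.ofReal (NN g ^ (2 * ε)) + ENNReal.ofReal (s⁻¹ / 2)) := by
            rw [← ENNReal.ofReal_mul (by positivity), ← ENNReal.ofReal_add (by positivity) (by positivity), ← ENNReal.ofReal_mul (by positivity)]
            apply ENNReal.ofReal_le_ofReal
            refine h1.trans ?_
            gcongr
        _ ≤ _ := mul_le_mul_right le_add_self _
    · have h0 : δ ^ 2 * NN g / 2 * ‖u‖ ≤ ‖ra u g‖ := not_lt.1 h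
      calc ENNReal.ofReal (‖ra u g‖ ^ (-ε)) ≤ ENNReal.ofReal (‖u‖ ^ (-ε)) *
            (ENNReal.ofReal ((2 / δ ^ 2) ^ ε) * ENNReal.ofReal (NN g ^ (-ε))) := by
            rw [← ENNReal.ofReal_mul (by positivity), ← ENNReal.ofReal_mul (by positivity)]
            apply ENNReal.ofReal_le_ofReal
            calc ‖ra u g‖ ^ (-ε) ≤ (δ ^ 2 * NN g / 2 * ‖u‖) ^ (-ε) :=
                  Real.rpow_le_rpow_of_nonpos (by positivity) h0 (by linarith)
              _ = _ := by
                  rw [show δ ^ 2 * NN g / 2 * ‖u‖ = ‖u‖ * ((2 / δ ^ 2)⁻¹ * NN g) by field_simp,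
                    Real.mul_rpow hun.le (by positivity), Real.mul_rpow (by positivity) hg0.le,
                    Real.inv_rpow hd.le, Real.rpow_neg hd.le, inv_inv]
        _ ≤ _ := mul_le_mul_right le_self_add _
  calc ∫⁻ g, ENNReal.ofReal (‖ra u g‖ ^ (-ε)) ∂(mun μ n) ≤ _ := lintegral_mono pt
    _ = ENNReal.ofReal (‖u‖ ^ (-ε)) * (ENNReal.ofReal ((2 / δ ^ 2) ^ ε) * (∫⁻ g, ENNReal.ofReal (NN g ^ (-ε)) ∂(mun μ n)) +
        (ENNReal.ofReal (s / 2) * (∫⁻ g, ENNReal.ofReal (NN g ^ (2 * ε)) ∂(mun μ n)) + ENNReal.ofReal (s⁻¹ / 2) * mun μ n bad)) := by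
        rw [lintegral_const_mul _ (by fun_prop), lintegral_add_left (by fun_prop), lintegral_const_mul _ (by fun_prop),
          lintegral_add_left (by fun_prop), lintegral_const_mul _ (by fun_prop), lintegral_const_mul _ (by fun_prop),
          lintegral_indicator_one hms]
    _ ≤ ENNReal.ofReal (‖u‖ ^ (-ε)) * (ENNReal.ofReal ((2 / δ ^ 2) ^ ε) * ENNReal.ofReal ρ +
        (ENNReal.ofReal (s / 2) * ENNReal.ofReal K + ENNReal.ofReal (s⁻¹ / 2) * (2 * ENNReal.ofReal e))) := by
        gcongr
    _ ≤ _ := by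
        rw [← ENNReal.ofReal_ofNat 2, ← ENNReal.ofReal_mul (by positivity), ← ENNReal.ofReal_mul (by positivity),
          ← ENNReal.ofReal_mul (by positivity), ← ENNReal.ofReal_mul (by positivity), ← ENNReal.ofReal_add (by positivity) (by positivity),
          ← ENNReal.ofReal_add (by positivity) (by positivity), ← ENNReal.ofReal_mul (by positivity)]
        apply ENNReal.ofReal_le_ofReal
        rw [mul_comm]
        refine mul_le_mul_of_nonneg_right ?_ (by positivity)
        have h1 : s / 2 * K = (1 - ρ) / 4 := by rw [hs]; field_simp; ring
        have h2 : s⁻¹ / 2 * (2 * e) = (1 - ρ) / 4 := by rw [he]; field_simp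
        rw [h1, h2]
        nlinarith

/-- Contraction package -/
structure Contr (μ : Measure SL2) (ε C M : ℝ) : Prop where
  pos : 0 < ε
  le1 : ε ≤ 1
  C1 : 1 ≤ C
  M1 : 1 ≤ M
  mom : ∫⁻ g, ENNReal.ofReal (NN g ^ ε) ∂μ ≤ ENNReal.ofReal M
  green : ∀ u, u ≠ 0 → ∫⁻ g, ENNReal.ofReal (‖ra u g‖ ^ (-ε)) ∂(Gr μ) ≤ ENNReal.ofReal (C * ‖u‖ ^ (-ε))

theorem exists_Contr {ν : Measure ℂ} [IsProbabilityMeasure ν] (hS : Setup μ ν) : ∃ ε C M, Contr μ ε C M := by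
  obtain ⟨n, ε, θ, hn, hε, hε1, hθ, hθ1, hmom, hc⟩ := contraction hS
  set M := (∫⁻ g, ENNReal.ofReal (NN g ^ ε) ∂μ).toReal + 1 with hM
  have hM0 : 1 ≤ M := by rw [hM]; linarith [ENNReal.toReal_nonneg (a := ∫⁻ g, ENNReal.ofReal (NN g ^ ε) ∂μ)]
  have hMM : ∫⁻ g, ENNReal.ofReal (NN g ^ ε) ∂μ ≤ ENNReal.ofReal M := by
    calc _ = ENNReal.ofReal (∫⁻ g, ENNReal.ofReal (NN g ^ ε) ∂μ).toReal := (ENNReal.ofReal_toReal hmom.ne).symm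
      _ ≤ _ := ENNReal.ofReal_le_ofReal (by linarith)
  set K := M ^ n * NN 1 ^ ε with hK
  have hN1 : 1 ≤ NN 1 ^ ε := Real.one_le_rpow (one_le_NN 1) hε.le
  have hK0 : 1 ≤ K := by
    have := one_le_pow₀ (n := n) hM0
    nlinarith
  have hf : ∀ u : ℂ, Measurable (fun g : SL2 => ENNReal.ofReal (‖ra u g‖ ^ (-ε))) := fun u => by fun_prop
  -- small times
  have h1 : ∀ j < n, ∀ u, u ≠ 0 → ∫⁻ g, ENNReal.ofReal (‖ra u g‖ ^ (-ε)) ∂(mun μ j) ≤ ENNReal.ofReal (K * ‖u‖ ^ (-ε)) := by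
    intro j hj u hu
    have hun : 0 < ‖u‖ := norm_pos_iff.2 hu
    calc _ ≤ ∫⁻ g, ENNReal.ofReal (‖u‖ ^ (-ε)) * ENNReal.ofReal (NN g ^ ε) ∂(mun μ j) := by
          apply lintegral_mono
          intro g
          have hg0 := NN_pos g
          have hra : 0 < ‖ra u g‖ := norm_pos_iff.2 (ra_ne_zero hu g)
          simp only
          rw [← ENNReal.ofReal_mul (by positivity)]
          apply ENNReal.ofReal_le_ofReal
          have h2 : ‖u‖ / NN g ≤ ‖ra u g‖ := by
            rw [div_le_iff₀ hg0, mul_comm]; exact norm_le_ra u g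
          calc ‖ra u g‖ ^ (-ε) ≤ (‖u‖ / NN g) ^ (-ε) :=
                Real.rpow_le_rpow_of_nonpos (by positivity) h2 (by linarith)
            _ = _ := by
                rw [Real.div_rpow hun.le hg0.le, Real.rpow_neg hg0.le]; field_simp
      _ = ENNReal.ofReal (‖u‖ ^ (-ε)) * ∫⁻ g, ENNReal.ofReal (NN g ^ ε) ∂(mun μ j) := lintegral_const_mul _ (by fun_prop)
      _ ≤ ENNReal.ofReal (‖u‖ ^ (-ε)) * (ENNReal.ofReal (M ^ j) * ENNReal.ofReal (NN 1 ^ ε)) := by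
          gcongr; exact mom_mun hε.le (by linarith) hMM j
      _ ≤ _ := by
          rw [← ENNReal.ofReal_mul (by positivity), ← ENNReal.ofReal_mul (by positivity), mul_comm]
          apply ENNReal.ofReal_le_ofReal
          rw [hK]
          have : M ^ j ≤ M ^ n := pow_le_pow_right₀ hM0 hj.le
          gcongr
  have h2 : ∀ (m j : ℕ), j < n → ∀ u, u ≠ 0 → ∫⁻ g, ENNReal.ofReal (‖ra u g‖ ^ (-ε)) ∂(mun μ (j + n * m)) ≤ ENNReal.ofReal (θ ^ m) * ENNReal.ofReal (K * ‖u‖ ^ (-ε)) := by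
    intro m j hj
    induction m with
    | zero => intro u hu; simpa using h1 j hj u hu
    | succ m ih =>
      intro u hu
      rw [show j + n * (m + 1) = (j + n * m) + n by ring, lintegral_mun_add _ _ _ (hf u)]
      calc _ ≤ ∫⁻ g, ENNReal.ofReal θ * ENNReal.ofReal (‖ra u g‖ ^ (-ε)) ∂(mun μ (j + n * m)) := by
            apply lintegral_mono
            intro g
            simp only [ra_mul]
            rw [← ENNReal.ofReal_mul hθ.le]
            exact hc _ (ra_ne_zero hu g)
        _ = ENNReal.ofReal θ * ∫⁻ g, ENNReal.ofReal (‖ra u g‖ ^ (-ε)) ∂(mun μ (j + n * m)) := lintegral_const_mul _ (hf u)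
        _ ≤ ENNReal.ofReal θ * (ENNReal.ofReal (θ ^ m) * ENNReal.ofReal (K * ‖u‖ ^ (-ε))) := by gcongr; exact ih u hu
        _ = _ := by rw [← mul_assoc, ← ENNReal.ofReal_mul hθ.le, pow_succ']
  have hnr : (1 : ℝ) ≤ n := by exact_mod_cast hn
  have h1θ : 1 ≤ (1 - θ)⁻¹ := by
    rw [one_le_inv₀ (by linarith)]; linarith
  refine ⟨ε, n * (1 - θ)⁻¹ * K, M, hε, hε1, ?_, hM0, hMM, fun u hu => ?_⟩
  · have : 1 ≤ (n : ℝ) * (1 - θ)⁻¹ := by nlinarith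
    nlinarith
  rw [lintegral_Gr]
  haveI : NeZero n := ⟨hn.ne'⟩
  rw [← (Nat.divModEquiv n).symm.tsum_eq]
  rw [ENNReal.tsum_prod (f := fun m j => ∫⁻ g, ENNReal.ofReal (‖ra u g‖ ^ (-ε)) ∂(mun μ ((Nat.divModEquiv n).symm (m, j))))]
  calc _ ≤ ∑' (m : ℕ) (j : Fin n), ENNReal.ofReal (θ ^ m) * ENNReal.ofReal (K * ‖u‖ ^ (-ε)) := by
        apply ENNReal.tsum_le_tsum
        intro m
        apply ENNReal.tsum_le_tsum
        intro j
        have := h2 m j j.2 u hu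
        simp only [Nat.divModEquiv_symm_apply]
        rw [show m * n + (j : ℕ) = j + n * m by ring]
        exact this
    _ = n * (∑' m : ℕ, ENNReal.ofReal (θ ^ m)) * ENNReal.ofReal (K * ‖u‖ ^ (-ε)) := by
        simp only [tsum_fintype, Finset.sum_const, Finset.card_univ, Fintype.card_fin, nsmul_eq_mul]
        rw [ENNReal.tsum_mul_left, ENNReal.tsum_mul_right]; exact (mul_assoc _ _ _).symm
    _ = _ := by
        rw [← ENNReal.ofReal_tsum_of_nonneg (fun m => by positivity) (summable_geometric_of_lt_one hθ.le hθ1),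
          tsum_geometric_of_lt_one hθ.le hθ1, ← ENNReal.ofReal_natCast, ← ENNReal.ofReal_mul (by positivity),
          ← ENNReal.ofReal_mul (by have : 0 < 1 - θ := by linarith
                                   positivity)]
        congr 1; ring

end

end

section

open scoped ENNReal NNReal Topology

/-! ### Green function estimates and hitting -/

section
variable {μ : Measure SL2} [IsProbabilityMeasure μ]

theorem max_principle {q h : ℂ → ℝ≥0∞} (hq : Measurable q)
    (H : ∀ u, u ≠ 0 → (∫⁻ g, q (ra u g) ∂(Gr μ) ≤ h u) ∨ (q u + ∫⁻ g, h (ra u g) ∂μ ≤ h u)) :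
    ∀ u, u ≠ 0 → ∫⁻ g, q (ra u g) ∂(Gr μ) ≤ h u := by
  have hqm : ∀ u, Measurable (fun g : SL2 => q (ra u g)) := fun u => by fun_prop
  have key : ∀ n : ℕ, ∀ u, u ≠ 0 → ∑ k ∈ Finset.range n, ∫⁻ g, q (ra u g) ∂(mun μ k) ≤ h u := by
    intro n
    induction n with
    | zero => intro u hu; simp
    | succ n ih =>
      intro u hu
      rcases H u hu with h1 | h1
      · refine le_trans ?_ h1
        rw [lintegral_Gr]
        exact ENNReal.sum_le_tsum _
      · refine le_trans ?_ h1
        rw [Finset.sum_range_succ', lintegral_mun_zero _ (hqm u), ra_one, add_comm]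
        gcongr
        have e : ∀ k, ∫⁻ g, q (ra u g) ∂(mun μ (k + 1)) = ∫⁻ g, ∫⁻ h, q (ra (ra u g) h) ∂(mun μ k) ∂μ := by
          intro k
          rw [lintegral_mun_succ _ _ (hqm u)]; simp only [ra_mul]
        simp only [e]
        rw [← lintegral_finset_sum]
        · apply lintegral_mono
          intro g
          exact ih _ (ra_ne_zero hu g)
        · intro k _
          have := measurable_shift0 (ρ := mun μ k) (hqm u)
          simpa only [ra_mul] using this
  intro u hu
  rw [lintegral_Gr]
  rw [ENNReal.tsum_eq_iSup_nat]
  exact iSup_le fun n => key n u hu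

def bandS (r B : ℝ) : Set ℂ := {u | r ≤ ‖u‖ ∧ ‖u‖ ≤ B * r}

theorem measurableSet_bandS (r B : ℝ) : MeasurableSet (bandS r B) := by
  have h1 : MeasurableSet {u : ℂ | r ≤ ‖u‖} := measurableSet_le measurable_const (by fun_prop)
  have h2 : MeasurableSet {u : ℂ | ‖u‖ ≤ B * r} := measurableSet_le (by fun_prop) measurable_const
  exact h1.inter h2

theorem measurable_band_ind (r B : ℝ) : Measurable ((bandS r B).indicator (1 : ℂ → ℝ≥0∞)) :=
  measurable_one.indicator (measurableSet_bandS r B)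

variable {ε C M : ℝ}

theorem green_band (hC : Contr μ ε C M) {r B : ℝ} (hr : 0 < r) (hB : 0 < B) {u : ℂ} (hu : u ≠ 0) :
    ∫⁻ g, (bandS r B).indicator 1 (ra u g) ∂(Gr μ) ≤ ENNReal.ofReal (C * B ^ ε) := by
  have hε := hC.pos
  have hC0 : 0 < C := lt_of_lt_of_le one_pos hC.C1
  refine max_principle (μ := μ) (h := fun _ => ENNReal.ofReal (C * B ^ ε)) (measurable_band_ind r B) (fun u hu => ?_) u hu
  by_cases h : r ≤ ‖u‖
  · left
    have hun : 0 < ‖u‖ := norm_pos_iff.2 hu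
    calc _ ≤ ∫⁻ g, ENNReal.ofReal ((B * r) ^ ε) * ENNReal.ofReal (‖ra u g‖ ^ (-ε)) ∂(Gr μ) := by
          apply lintegral_mono
          intro g
          by_cases hg : ra u g ∈ bandS r B
          · simp only [Set.indicator_of_mem hg, Pi.one_apply]
            rw [← ENNReal.ofReal_mul (by positivity), ← ENNReal.ofReal_one]
            apply ENNReal.ofReal_le_ofReal
            have hg0 : 0 < ‖ra u g‖ := norm_pos_iff.2 (ra_ne_zero hu g)
            rw [Real.rpow_neg hg0.le, ← div_eq_mul_inv, one_le_div (by positivity)]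
            exact Real.rpow_le_rpow hg0.le hg.2 hε.le
          · simp [Set.indicator_of_notMem hg]
      _ = ENNReal.ofReal ((B * r) ^ ε) * ∫⁻ g, ENNReal.ofReal (‖ra u g‖ ^ (-ε)) ∂(Gr μ) :=
          lintegral_const_mul _ (by fun_prop)
      _ ≤ ENNReal.ofReal ((B * r) ^ ε) * ENNReal.ofReal (C * ‖u‖ ^ (-ε)) := by gcongr; exact hC.green u hu
      _ ≤ _ := by
          rw [← ENNReal.ofReal_mul (by positivity)]
          apply ENNReal.ofReal_le_ofReal
          rw [Real.mul_rpow hB.le hr.le, Real.rpow_neg hun.le]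
          have : r ^ ε ≤ ‖u‖ ^ ε := Real.rpow_le_rpow hr.le h hε.le
          have h2 : r ^ ε * (‖u‖ ^ ε)⁻¹ ≤ 1 := by
            rw [← div_eq_mul_inv, div_le_one (by positivity)]; exact this
          calc B ^ ε * r ^ ε * (C * (‖u‖ ^ ε)⁻¹) = C * B ^ ε * (r ^ ε * (‖u‖ ^ ε)⁻¹) := by ring
            _ ≤ C * B ^ ε * 1 := by gcongr
            _ = _ := mul_one _
  · right
    have : u ∉ bandS r B := fun h' => h h'.1
    rw [Set.indicator_of_notMem this]
    simp

/-- sum below level r -/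
theorem green_below (hC : Contr μ ε C M) : ∃ C' : ℝ, 0 < C' ∧ ∀ r : ℝ, 0 < r → ∀ u : ℂ, u ≠ 0 →
    ∫⁻ g, (Metric.ball (0 : ℂ) r).indicator (fun w => ENNReal.ofReal (‖w‖ ^ ε)) (ra u g) ∂(Gr μ) ≤ ENNReal.ofReal (C' * r ^ ε) := by
  have hε := hC.pos
  have hC0 : 0 < C := lt_of_lt_of_le one_pos hC.C1
  set q : ℝ := (1 / 2 : ℝ) ^ ε with hq
  have hq0 : 0 < q := by positivity
  have hq1 : q < 1 := Real.rpow_lt_one (by norm_num) (by norm_num) hε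
  have hq2 : 0 < 1 - q := by linarith
  refine ⟨C * 2 ^ ε * (1 - q)⁻¹, by positivity, fun r hr u hu => ?_⟩
  have pt : ∀ w : ℂ, w ≠ 0 → (Metric.ball (0 : ℂ) r).indicator (fun w => ENNReal.ofReal (‖w‖ ^ ε)) w ≤
      ∑' j : ℕ, ENNReal.ofReal (q ^ j * r ^ ε) * (bandS (r * (1 / 2) ^ (j + 1)) 2).indicator 1 w := by
    intro w hw
    by_cases hwr : w ∈ Metric.ball (0 : ℂ) r
    · rw [Set.indicator_of_mem hwr]
      rw [mem_ball_zero_iff] at hwr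
      have hw0 : 0 < ‖w‖ := norm_pos_iff.2 hw
      obtain ⟨j, hj1, hj2⟩ := exists_nat_pow_near_of_lt_one (x := ‖w‖ / r) (y := 1 / 2) (by positivity)
        (by rw [div_le_one hr]; exact hwr.le) (by norm_num) (by norm_num)
      rw [lt_div_iff₀ hr] at hj1
      rw [div_le_iff₀ hr] at hj2
      have hm : w ∈ bandS (r * (1 / 2) ^ (j + 1)) 2 := by
        refine ⟨by linarith, ?_⟩
        rw [pow_succ]; linarith
      refine le_trans ?_ (ENNReal.le_tsum j)
      rw [Set.indicator_of_mem hm, Pi.one_apply, mul_one]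
      apply ENNReal.ofReal_le_ofReal
      calc ‖w‖ ^ ε ≤ ((1 / 2) ^ j * r) ^ ε := Real.rpow_le_rpow hw0.le hj2 hε.le
        _ = _ := by
          rw [Real.mul_rpow (by positivity) hr.le, hq, ← Real.rpow_natCast, ← Real.rpow_natCast, ← Real.rpow_mul (by norm_num),
            ← Real.rpow_mul (by norm_num), mul_comm ε]
    · rw [Set.indicator_of_notMem hwr]; exact zero_le
  calc _ ≤ ∫⁻ g, ∑' j : ℕ, ENNReal.ofReal (q ^ j * r ^ ε) * (bandS (r * (1 / 2) ^ (j + 1)) 2).indicator 1 (ra u g) ∂(Gr μ) :=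
        lintegral_mono fun g => pt _ (ra_ne_zero hu g)
    _ = ∑' j : ℕ, ENNReal.ofReal (q ^ j * r ^ ε) * ∫⁻ g, (bandS (r * (1 / 2) ^ (j + 1)) 2).indicator 1 (ra u g) ∂(Gr μ) := by
        rw [lintegral_tsum]
        · congr 1; ext j
          rw [lintegral_const_mul]
          have := measurable_band_ind (r * (1 / 2) ^ (j + 1)) 2
          fun_prop
        · intro j
          have := measurable_band_ind (r * (1 / 2) ^ (j + 1)) 2
          exact Measurable.aemeasurable (by fun_prop)
    _ ≤ ∑' j : ℕ, ENNReal.ofReal (q ^ j * r ^ ε) * ENNReal.ofReal (C * 2 ^ ε) := by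
        apply ENNReal.tsum_le_tsum
        intro j
        gcongr
        exact green_band hC (by positivity) (by norm_num) hu
    _ = _ := by
        simp only [← ENNReal.ofReal_mul' (show 0 ≤ C * 2 ^ ε by positivity)]
        have hs := ((hasSum_geometric_of_lt_one hq0.le hq1).mul_right (r ^ ε)).mul_right (C * 2 ^ ε)
        rw [← ENNReal.ofReal_tsum_of_nonneg (fun m => by positivity) hs.summable, hs.tsum_eq]
        congr 1; ring

theorem green_tendsto (hC : Contr μ ε C M) {v : ℂ} (hv : v ≠ 0) {R : ℝ} (hR : 0 < R) :
    Tendsto (fun n => mun μ n {g | ‖ra v g‖ ≤ R}) atTop (𝓝 0) := by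
  have hε := hC.pos
  have h1 : ∑' n, ∫⁻ g, ENNReal.ofReal (‖ra v g‖ ^ (-ε)) ∂(mun μ n) ≠ ⊤ := by
    rw [← lintegral_Gr]; exact ne_top_of_le_ne_top ENNReal.ofReal_ne_top (hC.green v hv)
  have h2 := ENNReal.tendsto_atTop_zero_of_tsum_ne_top h1
  have h3 := ENNReal.Tendsto.const_mul (a := ENNReal.ofReal (R ^ ε)) h2 (Or.inr ENNReal.ofReal_ne_top)
  rw [mul_zero] at h3
  refine tendsto_of_tendsto_of_tendsto_of_le_of_le tendsto_const_nhds h3 (fun n => zero_le) (fun n => ?_)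
  have hms : MeasurableSet {g : SL2 | ‖ra v g‖ ≤ R} := measurableSet_le (by fun_prop) measurable_const
  simp only
  rw [← lintegral_indicator_one hms, ← lintegral_const_mul _ (by fun_prop)]
  apply lintegral_mono
  intro g
  by_cases hg : g ∈ {g : SL2 | ‖ra v g‖ ≤ R}
  · simp only [Set.indicator_of_mem hg, Pi.one_apply]
    rw [← ENNReal.ofReal_mul (by positivity), ← ENNReal.ofReal_one]
    apply ENNReal.ofReal_le_ofReal
    have hg0 : 0 < ‖ra v g‖ := norm_pos_iff.2 (ra_ne_zero hv g)
    rw [Real.rpow_neg hg0.le, ← div_eq_mul_inv, one_le_div (by positivity)]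
    exact Real.rpow_le_rpow hg0.le hg hε.le
  · simp [hg]

theorem hit (hC : Contr μ ε C M) : ∃ C' : ℝ, 0 < C' ∧ ∀ (W : SL2 → ℝ≥0∞), Measurable W → (∀ g, W g ≤ 1) →
    (∀ g, W g ≤ ∫⁻ h, W (g * h) ∂μ) → ∀ (v : ℂ) (r B : ℝ), v ≠ 0 → 0 < r → 1 ≤ B → ‖v‖ ≤ B * r →
    W 1 ≤ ∫⁻ g, {g | ra v g ∈ bandS r B}.indicator W g ∂(Gr μ) + ENNReal.ofReal (C' * B ^ (-ε)) := by
  have hε := hC.pos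
  have hM0 : 0 < M := lt_of_lt_of_le one_pos hC.M1
  obtain ⟨C2, hC2, hbel⟩ := green_below hC
  refine ⟨M * C2, by positivity, fun W hW hW1 hsub v r B hv hr hB hvB => ?_⟩
  have hB0 : 0 < B := lt_of_lt_of_le one_pos hB
  set D : Set SL2 := {g | ra v g ∈ bandS r B} with hD
  have hDm : MeasurableSet D := (by fun_prop : Measurable (fun g : SL2 => ra v g)) (measurableSet_bandS r B)
  set na : Set SL2 := {g | ‖ra v g‖ ≤ B * r} with hna
  have hnam : MeasurableSet na := measurableSet_le (by fun_prop) measurable_const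
  set be : Set SL2 := {g | ‖ra v g‖ < r} with hbe
  have hbem : MeasurableSet be := measurableSet_lt (by fun_prop) measurable_const
  set cr : SL2 → ℝ≥0∞ := fun g => be.indicator (fun g => ∫⁻ h, naᶜ.indicator 1 (g * h) ∂μ) g with hcr
  have hcrm : Measurable cr := by
    apply Measurable.indicator _ hbem
    exact measurable_shift0 (measurable_one.indicator hnam.compl)
  set A : SL2 → ℝ≥0∞ := fun g => D.indicator W g + cr g with hA
  have hAm : Measurable A := (hW.indicator hDm).add hcrm
  have hn1 : Measurable (na.indicator (1 : SL2 → ℝ≥0∞)) := measurable_one.indicator hnam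
  have ind : ∀ n : ℕ, ∀ g, na.indicator W g ≤ ∑ k ∈ Finset.range n, ∫⁻ h, A (g * h) ∂(mun μ k) + ∫⁻ h, na.indicator 1 (g * h) ∂(mun μ n) := by
    intro n
    induction n with
    | zero =>
      intro g
      rw [lintegral_mun_zero (fun h => na.indicator 1 (g * h)) (hn1.comp (measurable_const_mul g))]
      simp only [Finset.range_zero, Finset.sum_empty, zero_add, mul_one]
      exact Set.indicator_le_indicator (hW1 g)
    | succ n ih =>
      intro g
      by_cases hg : g ∈ na
      swap
      · rw [Set.indicator_of_notMem hg]; exact zero_le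
      rw [Set.indicator_of_mem hg, Finset.sum_range_succ', lintegral_mun_zero (fun h => A (g * h)) (hAm.comp (measurable_const_mul g)), mul_one]
      by_cases hgD : g ∈ D
      · have : W g ≤ A g := by
          simp only [hA, Set.indicator_of_mem hgD]; exact le_self_add
        refine this.trans ?_
        refine le_trans le_add_self le_self_add
      · have hgb : g ∈ be := by
          by_contra h
          exact hgD ⟨not_lt.1 h, hg⟩
        have e : ∀ k, ∫⁻ h, A (g * h) ∂(mun μ (k + 1)) = ∫⁻ h, ∫⁻ h', A ((g * h) * h') ∂(mun μ k) ∂μ := by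
          intro k
          rw [lintegral_mun_succ _ (fun h => A (g * h)) (hAm.comp (measurable_const_mul g))]; simp only [mul_assoc]
        have e2 : ∫⁻ h, na.indicator (1 : SL2 → ℝ≥0∞) (g * h) ∂(mun μ (n + 1)) = ∫⁻ h, ∫⁻ h', na.indicator 1 ((g * h) * h') ∂(mun μ n) ∂μ := by
          rw [lintegral_mun_succ _ (fun h => na.indicator 1 (g * h)) (hn1.comp (measurable_const_mul g))]; simp only [mul_assoc]
        have hmA : ∀ k, Measurable (fun h => ∫⁻ h', A ((g * h) * h') ∂(mun μ k)) := fun k =>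
          measurable_shift hAm (measurable_const_mul g)
        have hmN : Measurable (fun h => ∫⁻ h', na.indicator (1 : SL2 → ℝ≥0∞) ((g * h) * h') ∂(mun μ n)) :=
          measurable_shift hn1 (measurable_const_mul g)
        simp only [e, e2]
        rw [← lintegral_finset_sum _ (fun k _ => hmA k)]
        have hAg : cr g ≤ A g := le_add_self
        have hcg : cr g = ∫⁻ h, naᶜ.indicator 1 (g * h) ∂μ := by simp only [hcr, Set.indicator_of_mem hgb]
        calc W g ≤ ∫⁻ h, W (g * h) ∂μ := hsub g
          _ ≤ ∫⁻ h, (naᶜ.indicator 1 (g * h) + na.indicator W (g * h)) ∂μ := by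
              apply lintegral_mono
              intro h
              by_cases hh : g * h ∈ na
              · simp [hh]
              · simp only [Set.indicator_of_mem (show g * h ∈ naᶜ from hh)]
                exact (hW1 _).trans le_self_add
          _ = cr g + ∫⁻ h, na.indicator W (g * h) ∂μ := by
              rw [hcg, lintegral_add_left]
              exact (measurable_one.indicator hnam.compl).comp (measurable_const_mul g)
          _ ≤ A g + ∫⁻ h, (∑ k ∈ Finset.range n, ∫⁻ h', A ((g * h) * h') ∂(mun μ k) + ∫⁻ h', na.indicator 1 ((g * h) * h') ∂(mun μ n)) ∂μ :=
              add_le_add hAg (lintegral_mono fun h => ih (g * h))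
          _ = _ := by
              rw [lintegral_add_left]
              · ring
              · exact Finset.measurable_sum _ (fun k _ => hmA k)
  have h1na : (1 : SL2) ∈ na := by simp only [hna, Set.mem_ofPred_eq, ra_one]; exact hvB
  have lim : W 1 ≤ ∫⁻ h, A h ∂(Gr μ) := by
    have ht := green_tendsto hC hv (R := B * r) (by positivity)
    have ht2 : Tendsto (fun n => ∫⁻ h, A h ∂(Gr μ) + mun μ n na) atTop (𝓝 (∫⁻ h, A h ∂(Gr μ) + 0)) :=
      tendsto_const_nhds.add ht
    rw [add_zero] at ht2
    refine ge_of_tendsto' ht2 (fun n => ?_)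
    have := ind n 1
    simp only [one_mul, Set.indicator_of_mem h1na, lintegral_indicator_one hnam] at this
    refine this.trans ?_
    gcongr
    rw [lintegral_Gr]
    exact ENNReal.sum_le_tsum _
  refine lim.trans ?_
  rw [hA, lintegral_add_left (hW.indicator hDm)]
  gcongr
  -- crossing estimate
  have pt : ∀ g, cr g ≤ ENNReal.ofReal (M * (B * r) ^ (-ε)) * (Metric.ball (0 : ℂ) r).indicator (fun w => ENNReal.ofReal (‖w‖ ^ ε)) (ra v g) := by
    intro g
    by_cases hg : g ∈ be
    · have hg' : ra v g ∈ Metric.ball (0 : ℂ) r := mem_ball_zero_iff.2 hg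
      simp only [hcr, Set.indicator_of_mem hg, Set.indicator_of_mem hg']
      have hg0 : 0 < ‖ra v g‖ := norm_pos_iff.2 (ra_ne_zero hv g)
      calc _ ≤ ∫⁻ h, ENNReal.ofReal (‖ra v g‖ ^ ε * (B * r) ^ (-ε)) * ENNReal.ofReal (NN h ^ ε) ∂μ := by
            apply lintegral_mono
            intro h
            by_cases hh : g * h ∈ na
            · simp [hh]
            · simp only [Set.indicator_of_mem (show g * h ∈ naᶜ from hh), Pi.one_apply]
              rw [← ENNReal.ofReal_mul (by positivity), ← ENNReal.ofReal_one]
              apply ENNReal.ofReal_le_ofReal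
              have h1 : B * r < ‖ra v (g * h)‖ := not_le.1 hh
              rw [ra_mul] at h1
              have h2 := norm_ra_le (ra v g) h
              have h3 : B * r ≤ ‖ra v g‖ * NN h := by linarith
              have hN := NN_pos h
              have h4 := Real.rpow_le_rpow (by positivity) h3 hε.le
              rw [Real.mul_rpow hg0.le hN.le] at h4
              rw [Real.rpow_neg (by positivity)]
              calc (1 : ℝ) = (B * r) ^ ε * ((B * r) ^ ε)⁻¹ := (mul_inv_cancel₀ (by positivity)).symm
                _ ≤ ‖ra v g‖ ^ ε * NN h ^ ε * ((B * r) ^ ε)⁻¹ := by gcongr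
                _ = _ := by ring
        _ = ENNReal.ofReal (‖ra v g‖ ^ ε * (B * r) ^ (-ε)) * ∫⁻ h, ENNReal.ofReal (NN h ^ ε) ∂μ := lintegral_const_mul _ (by fun_prop)
        _ ≤ ENNReal.ofReal (‖ra v g‖ ^ ε * (B * r) ^ (-ε)) * ENNReal.ofReal M := by gcongr; exact hC.mom
        _ = _ := by
            rw [← ENNReal.ofReal_mul (by positivity), ← ENNReal.ofReal_mul (by positivity)]
            congr 1; ring
    · simp only [hcr, Set.indicator_of_notMem hg]; exact zero_le
  have hmb : Measurable ((Metric.ball (0 : ℂ) r).indicator (fun w => ENNReal.ofReal (‖w‖ ^ ε))) :=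
    Measurable.indicator (by fun_prop) measurableSet_ball
  calc ∫⁻ g, cr g ∂(Gr μ) ≤ _ := lintegral_mono pt
    _ = ENNReal.ofReal (M * (B * r) ^ (-ε)) * ∫⁻ g, (Metric.ball (0 : ℂ) r).indicator (fun w => ENNReal.ofReal (‖w‖ ^ ε)) (ra v g) ∂(Gr μ) :=
        lintegral_const_mul _ (by fun_prop)
    _ ≤ ENNReal.ofReal (M * (B * r) ^ (-ε)) * ENNReal.ofReal (C2 * r ^ ε) := by gcongr; exact hbel r hr v hv
    _ = _ := by
        rw [← ENNReal.ofReal_mul (by positivity)]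
        congr 1
        rw [Real.mul_rpow hB0.le hr.le, Real.rpow_neg hr.le]
        have : 0 < r ^ ε := by positivity
        field_simp

end

end

section

open scoped ENNReal NNReal Topology

/-! ### Equicontinuity of Green potentials -/

section
variable {μ : Measure SL2} [IsProbabilityMeasure μ]

theorem super_sol {q h : ℂ → ℂ → ℝ≥0∞} (hq : Measurable (fun p : ℂ × ℂ => q p.1 p.2))
    (H : ∀ u w, u ≠ 0 → q u w + ∫⁻ g, h (ra u g) (ra w g) ∂μ ≤ h u w) :
    ∀ u w, u ≠ 0 → ∫⁻ g, q (ra u g) (ra w g) ∂(Gr μ) ≤ h u w := by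
  have hqm : ∀ u w, Measurable (fun g : SL2 => q (ra u g) (ra w g)) := fun u w =>
    hq.comp ((by fun_prop : Measurable fun g : SL2 => ra u g).prodMk (by fun_prop : Measurable fun g : SL2 => ra w g))
  have key : ∀ n : ℕ, ∀ u w, u ≠ 0 → ∑ k ∈ Finset.range n, ∫⁻ g, q (ra u g) (ra w g) ∂(mun μ k) ≤ h u w := by
    intro n
    induction n with
    | zero => intro u w hu; simp
    | succ n ih =>
      intro u w hu
      refine le_trans ?_ (H u w hu)
      rw [Finset.sum_range_succ', lintegral_mun_zero _ (hqm u w), ra_one, ra_one, add_comm]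
      gcongr
      have e : ∀ k, ∫⁻ g, q (ra u g) (ra w g) ∂(mun μ (k + 1)) = ∫⁻ g, ∫⁻ h, q (ra (ra u g) h) (ra (ra w g) h) ∂(mun μ k) ∂μ := by
        intro k
        rw [lintegral_mun_succ _ _ (hqm u w)]; simp only [ra_mul]
      simp only [e]
      rw [← lintegral_finset_sum]
      · apply lintegral_mono
        intro g
        exact ih _ _ (ra_ne_zero hu g)
      · intro k _
        have := measurable_shift0 (ρ := mun μ k) (hqm u w)
        simpa only [ra_mul] using this
  intro u w hu
  rw [lintegral_Gr, ENNReal.tsum_eq_iSup_nat]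
  exact iSup_le fun n => key n u w hu

theorem rpow_add_le_k {x y κ : ℝ} (hx : 0 ≤ x) (hy : 0 ≤ y) (hκ : 0 ≤ κ) (hκ1 : κ ≤ 1) :
    (x + y) ^ κ ≤ x ^ κ + y ^ κ := Real.rpow_add_le_add_rpow hx hy hκ hκ1

/-- slope -/
def alp (u w : ℂ) : ℝ := |pr u w| / ‖u‖ ^ 2

theorem alp_nonneg (u w : ℂ) : 0 ≤ alp u w := by unfold alp; positivity

theorem alp_le {u w : ℂ} (hu : u ≠ 0) : alp u w ≤ ‖w‖ / ‖u‖ := by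
  have hun : 0 < ‖u‖ := norm_pos_iff.2 hu
  unfold alp
  rw [div_le_div_iff₀ (by positivity) hun]
  have := abs_pr_le u w
  calc |pr u w| * ‖u‖ ≤ ‖u‖ * ‖w‖ * ‖u‖ := by gcongr
    _ = _ := by ring

theorem norm_le_alp {u w : ℂ} (hu : u ≠ 0) : ‖w‖ ≤ alp u w * ‖u‖ + |dt u w| / ‖u‖ := by
  have hun : 0 < ‖u‖ := norm_pos_iff.2 hu
  have e : alp u w * ‖u‖ + |dt u w| / ‖u‖ = (|pr u w| + |dt u w|) / ‖u‖ := by unfold alp; field_simp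
  rw [e, le_div_iff₀ hun]
  apply le_of_sq_le_sq _ (by positivity)
  have := pr_dt u w
  have h1 := sq_abs (pr u w)
  have h2 := sq_abs (dt u w)
  nlinarith [mul_nonneg (abs_nonneg (pr u w)) (abs_nonneg (dt u w))]

theorem alp_step {u : ℂ} (hu : u ≠ 0) (w : ℂ) (h : SL2) : alp (ra u h) (ra w h) ≤ alp u w + |dt u w| / ‖u‖ ^ 2 * NN h ^ 2 := by
  have hun : 0 < ‖u‖ := norm_pos_iff.2 hu
  set b : ℂ := Complex.I * u with hb
  have hw : ((‖u‖ ^ 2 : ℝ) : ℂ) * w = (pr u w : ℝ) * u + (dt u w : ℝ) * b := by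
    rw [normsq]
    apply Complex.ext <;> simp only [hb, pr, dt, Complex.re_ofReal_mul, Complex.im_ofReal_mul, Complex.add_re, Complex.add_im, Complex.mul_re, Complex.mul_im, Complex.I_re, Complex.I_im, Complex.ofReal_re, Complex.ofReal_im] <;> ring
  have hw2 : ((‖u‖ ^ 2 : ℝ) : ℂ) * ra w h = (pr u w : ℝ) * ra u h + (dt u w : ℝ) * ra b h := by
    rw [← ra_smul, hw, ra_add, ra_smul, ra_smul]
  have hbn : ‖b‖ = ‖u‖ := by simp [hb]
  have hp : ‖u‖ ^ 2 * pr (ra u h) (ra w h) = pr u w * ‖ra u h‖ ^ 2 + dt u w * pr (ra u h) (ra b h) := by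
    rw [← pr_smul', hw2, ← pr_self, ← pr_smul', ← pr_smul']
    simp only [pr, Complex.add_re, Complex.add_im]; ring
  have hh0 : 0 < ‖ra u h‖ := norm_pos_iff.2 (ra_ne_zero hu h)
  have h1 : |pr (ra u h) (ra b h)| ≤ ‖ra u h‖ ^ 2 * NN h ^ 2 := by
    have k1 := abs_pr_le (ra u h) (ra b h)
    have k2 := norm_ra_le b h
    have k3 := norm_le_ra u h
    rw [hbn] at k2
    have hN := NN_pos h
    calc _ ≤ ‖ra u h‖ * ‖ra b h‖ := k1
      _ ≤ ‖ra u h‖ * (NN h * (NN h * ‖ra u h‖)) := by gcongr; exact k2.trans (by gcongr)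
      _ = _ := by ring
  have h2 : ‖u‖ ^ 2 * |pr (ra u h) (ra w h)| ≤ |pr u w| * ‖ra u h‖ ^ 2 + |dt u w| * (‖ra u h‖ ^ 2 * NN h ^ 2) := by
    rw [← abs_of_nonneg (show 0 ≤ ‖u‖ ^ 2 by positivity), ← abs_mul, hp]
    refine (abs_add_le _ _).trans ?_
    rw [abs_mul, abs_mul, abs_of_nonneg (show 0 ≤ ‖ra u h‖ ^ 2 by positivity)]
    gcongr
  unfold alp
  rw [div_le_iff₀ (by positivity)]
  calc |pr (ra u h) (ra w h)| = (‖u‖ ^ 2 * |pr (ra u h) (ra w h)|) / ‖u‖ ^ 2 := by field_simp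
    _ ≤ (|pr u w| * ‖ra u h‖ ^ 2 + |dt u w| * (‖ra u h‖ ^ 2 * NN h ^ 2)) / ‖u‖ ^ 2 := by gcongr
    _ = _ := by field_simp

variable {ε C M : ℝ}

theorem alp_rpow_step {u : ℂ} (hu : u ≠ 0) (w : ℂ) (g : SL2) {ε κ : ℝ} (hκ : κ = ε / 2) (hκ0 : 0 < κ) (hκ1 : κ ≤ 1) :
    alp (ra u g) (ra w g) ^ κ ≤ alp u w ^ κ + (|dt u w| / ‖u‖ ^ 2) ^ κ * NN g ^ ε := by
  have hNN := NN_pos g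
  calc _ ≤ (alp u w + |dt u w| / ‖u‖ ^ 2 * NN g ^ 2) ^ κ := Real.rpow_le_rpow (alp_nonneg _ _) (alp_step hu w g) hκ0.le
    _ ≤ _ := rpow_add_le_k (alp_nonneg _ _) (by positivity) hκ0.le hκ1
    _ = _ := by
      rw [Real.mul_rpow (by positivity) (by positivity), ← Real.rpow_natCast (NN g), ← Real.rpow_mul hNN.le]
      congr 3; rw [hκ]; push_cast; ring

theorem measurable_alp : Measurable (fun p : ℂ × ℂ => alp p.1 p.2) := by
  unfold alp; fun_prop

@[fun_prop]
theorem Measurable.alp {α : Type*} [MeasurableSpace α] {f g : α → ℂ} (hf : Measurable f) (hg : Measurable g) :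
    Measurable (fun a => alp (f a) (g a)) := by
  unfold _root_.alp; fun_prop

theorem ec_slope (hC : Contr μ ε C M) {r B : ℝ} (hr : 0 < r) (hB : 0 < B) :
    ∀ u w : ℂ, u ≠ 0 → ∫⁻ g, ENNReal.ofReal (alp (ra u g) (ra w g) ^ (ε / 2)) * (bandS r B).indicator 1 (ra u g) ∂(Gr μ)
      ≤ ENNReal.ofReal (alp u w ^ (ε / 2)) * ENNReal.ofReal (C * B ^ ε) +
        ENNReal.ofReal (M * (C * B ^ ε) * |dt u w| ^ (ε / 2)) * ENNReal.ofReal (C * ‖u‖ ^ (-ε)) := by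
  have hε := hC.pos
  have hε1 := hC.le1
  have hC0 : 0 < C := lt_of_lt_of_le one_pos hC.C1
  have hM0 : 0 < M := lt_of_lt_of_le one_pos hC.M1
  generalize hκ : ε / 2 = κ
  have hκ0 : 0 < κ := by rw [← hκ]; positivity
  have hκ1 : κ ≤ 1 := by rw [← hκ]; linarith
  generalize hCb : C * B ^ ε = Cb
  have hCb0 : 0 < Cb := by rw [← hCb]; positivity
  have hNb : ∀ u, u ≠ 0 → ∫⁻ g, (bandS r B).indicator 1 (ra u g) ∂(Gr μ) ≤ ENNReal.ofReal Cb := fun u hu => hCb ▸ green_band hC hr hB hu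
  have hbm : Measurable ((bandS r B).indicator (1 : ℂ → ℝ≥0∞)) := measurable_band_ind r B
  generalize hb : (bandS r B).indicator (1 : ℂ → ℝ≥0∞) = b at hbm hNb ⊢
  obtain ⟨N, hN⟩ : ∃ N : ℂ → ℝ≥0∞, N = fun u => ∫⁻ g, b (ra u g) ∂(Gr μ) := ⟨_, rfl⟩
  obtain ⟨V, hV⟩ : ∃ V : ℂ → ℝ≥0∞, V = fun u => ∫⁻ g, ENNReal.ofReal (‖ra u g‖ ^ (-ε)) ∂(Gr μ) := ⟨_, rfl⟩
  have hNm : Measurable N := by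
    have : Measurable (fun p : ℂ × SL2 => b (ra p.1 p.2)) := by fun_prop
    rw [hN]; exact this.lintegral_prod_right'
  have hVm : Measurable V := by
    have : Measurable (fun p : ℂ × SL2 => ENNReal.ofReal (‖ra p.1 p.2‖ ^ (-ε))) := by fun_prop
    rw [hV]; exact this.lintegral_prod_right'
  have hNs : ∀ u, N u = b u + ∫⁻ g, N (ra u g) ∂μ := by
    intro u
    have := lintegral_Gr_step (μ := μ) (fun g => b (ra u g)) (by fun_prop)
    simp only [ra_one, ra_mul] at this
    simp only [hN]
    exact this
  have hVs : ∀ u, V u = ENNReal.ofReal (‖u‖ ^ (-ε)) + ∫⁻ g, V (ra u g) ∂μ := by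
    intro u
    have := lintegral_Gr_step (μ := μ) (fun g => ENNReal.ofReal (‖ra u g‖ ^ (-ε))) (by fun_prop)
    simp only [ra_one, ra_mul] at this
    simp only [hV]
    exact this
  have hNb' : ∀ u, u ≠ 0 → N u ≤ ENNReal.ofReal Cb := fun u hu => by simp only [hN]; exact hNb u hu
  have hVb : ∀ u, u ≠ 0 → V u ≤ ENNReal.ofReal (C * ‖u‖ ^ (-ε)) := fun u hu => by simp only [hV]; exact hC.green u hu
  generalize hK : M * Cb = K
  have hK0 : 0 < K := by rw [← hK]; positivity
  have hprm := measurable_alp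
  have S := super_sol (μ := μ) (q := fun u w => ENNReal.ofReal (alp u w ^ κ) * b u)
    (h := fun u w => ENNReal.ofReal (alp u w ^ κ) * N u + ENNReal.ofReal (K * |dt u w| ^ κ) * V u)
    (by fun_prop) (by
      intro u w hu
      have hun : 0 < ‖u‖ := norm_pos_iff.2 hu
      have m1 : Measurable (fun g : SL2 => N (ra u g)) := by fun_prop
      have m2 : Measurable (fun g : SL2 => V (ra u g)) := by fun_prop
      have hal0 : 0 ≤ alp u w ^ κ := Real.rpow_nonneg (alp_nonneg _ _) _
      have hd0 : 0 ≤ (|dt u w| / ‖u‖ ^ 2) ^ κ := by positivity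
      have e1 : ENNReal.ofReal ((|dt u w| / ‖u‖ ^ 2) ^ κ * Cb) * ENNReal.ofReal M = ENNReal.ofReal (K * |dt u w| ^ κ) * ENNReal.ofReal (‖u‖ ^ (-ε)) := by
        rw [← ENNReal.ofReal_mul (by positivity), ← ENNReal.ofReal_mul (by positivity)]
        congr 1
        have e2 : (‖u‖ ^ 2) ^ κ = ‖u‖ ^ ε := by
          rw [← Real.rpow_natCast, ← Real.rpow_mul hun.le]; congr 1; rw [← hκ]; push_cast; ring
        rw [Real.div_rpow (abs_nonneg _) (by positivity), e2, Real.rpow_neg hun.le, ← hK]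
        field_simp
      have hpt : ∀ g : SL2, ENNReal.ofReal (alp (ra u g) (ra w g) ^ κ) * N (ra u g) ≤
          ENNReal.ofReal (alp u w ^ κ) * N (ra u g) + ENNReal.ofReal ((|dt u w| / ‖u‖ ^ 2) ^ κ * Cb) * ENNReal.ofReal (NN g ^ ε) := by
        intro g
        have h1 := alp_rpow_step hu w g hκ.symm hκ0 hκ1
        have hNg : 0 ≤ NN g ^ ε := Real.rpow_nonneg (NN_nonneg g) _
        calc _ ≤ ENNReal.ofReal (alp u w ^ κ + (|dt u w| / ‖u‖ ^ 2) ^ κ * NN g ^ ε) * N (ra u g) :=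
              mul_le_mul_left (ENNReal.ofReal_le_ofReal h1) _
          _ = ENNReal.ofReal (alp u w ^ κ) * N (ra u g) + ENNReal.ofReal ((|dt u w| / ‖u‖ ^ 2) ^ κ * NN g ^ ε) * N (ra u g) := by
              rw [ENNReal.ofReal_add hal0 (by positivity), add_mul]
          _ ≤ ENNReal.ofReal (alp u w ^ κ) * N (ra u g) + ENNReal.ofReal ((|dt u w| / ‖u‖ ^ 2) ^ κ * NN g ^ ε) * ENNReal.ofReal Cb :=
              add_le_add le_rfl (mul_le_mul_right (hNb' _ (ra_ne_zero hu g)) _)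
          _ = _ := by
              rw [← ENNReal.ofReal_mul (by positivity), ← ENNReal.ofReal_mul (by positivity)]
              congr 2; ring
      calc _ ≤ ENNReal.ofReal (alp u w ^ κ) * b u + ∫⁻ g, ((ENNReal.ofReal (alp u w ^ κ) * N (ra u g) +
              ENNReal.ofReal ((|dt u w| / ‖u‖ ^ 2) ^ κ * Cb) * ENNReal.ofReal (NN g ^ ε)) + ENNReal.ofReal (K * |dt u w| ^ κ) * V (ra u g)) ∂μ := by
            refine add_le_add le_rfl (lintegral_mono fun g => ?_)
            simp only [dt_ra]
            exact add_le_add (hpt g) le_rfl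
        _ = ENNReal.ofReal (alp u w ^ κ) * b u + ((ENNReal.ofReal (alp u w ^ κ) * ∫⁻ g, N (ra u g) ∂μ +
              ENNReal.ofReal ((|dt u w| / ‖u‖ ^ 2) ^ κ * Cb) * ∫⁻ g, ENNReal.ofReal (NN g ^ ε) ∂μ) + ENNReal.ofReal (K * |dt u w| ^ κ) * ∫⁻ g, V (ra u g) ∂μ) := by
            rw [lintegral_add_right _ (m2.const_mul _), lintegral_add_left (m1.const_mul _), lintegral_const_mul _ m1, lintegral_const_mul _ m2,
              lintegral_const_mul _ (by fun_prop)]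
        _ ≤ ENNReal.ofReal (alp u w ^ κ) * b u + ((ENNReal.ofReal (alp u w ^ κ) * ∫⁻ g, N (ra u g) ∂μ +
              ENNReal.ofReal ((|dt u w| / ‖u‖ ^ 2) ^ κ * Cb) * ENNReal.ofReal M) + ENNReal.ofReal (K * |dt u w| ^ κ) * ∫⁻ g, V (ra u g) ∂μ) :=
            add_le_add le_rfl (add_le_add (add_le_add le_rfl (mul_le_mul_right hC.mom _)) le_rfl)
        _ = _ := by
            rw [e1, hNs u, hVs u]; ring)
  intro u w hu
  exact (S u w hu).trans (add_le_add (mul_le_mul_right (hNb' u hu) _) (mul_le_mul_right (hVb u hu) _))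

theorem ec_pt {u w : ℂ} {r B κ D : ℝ} (hu : u ≠ 0) (hε : κ = ε / 2) (hκ0 : 0 < κ) (hκ1 : κ ≤ 1) (hBr : 0 < B * r) (hD : |dt u w| ≤ D) (hD0 : 0 ≤ D)
    (h : ‖u‖ ≤ B * r) : ‖w‖ ^ κ ≤ (B * r) ^ κ * alp u w ^ κ + (D ^ κ * (B * r) ^ κ) * ‖u‖ ^ (-ε) := by
  have hun : 0 < ‖u‖ := norm_pos_iff.2 hu
  have h1 := norm_le_alp (w := w) hu
  have hal := alp_nonneg u w
  have e3 : ‖u‖ ^ (-ε) = ((‖u‖ ^ 2)⁻¹) ^ κ := by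
    rw [Real.inv_rpow (by positivity), ← Real.rpow_natCast, ← Real.rpow_mul hun.le, ← Real.rpow_neg hun.le]
    congr 1; rw [hε]; push_cast; ring
  calc ‖w‖ ^ κ ≤ (alp u w * ‖u‖ + |dt u w| / ‖u‖) ^ κ := Real.rpow_le_rpow (norm_nonneg _) h1 hκ0.le
    _ ≤ (alp u w * ‖u‖) ^ κ + (|dt u w| / ‖u‖) ^ κ :=
        rpow_add_le_k (by positivity) (by positivity) hκ0.le hκ1
    _ ≤ ((B * r) * alp u w) ^ κ + (D * (B * r) * (‖u‖ ^ 2)⁻¹) ^ κ := by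
        refine add_le_add (Real.rpow_le_rpow (by positivity) ?_ hκ0.le) (Real.rpow_le_rpow (by positivity) ?_ hκ0.le)
        · rw [mul_comm]; gcongr
        · calc |dt u w| / ‖u‖ = |dt u w| * ‖u‖ * (‖u‖ ^ 2)⁻¹ := by field_simp
            _ ≤ _ := by gcongr
    _ = _ := by
        rw [e3, Real.mul_rpow (x := B * r) (y := alp u w) hBr.le hal, Real.mul_rpow (x := D * (B * r)) (y := (‖u‖ ^ 2)⁻¹) (by positivity) (by positivity), Real.mul_rpow (x := D) (y := B * r) hD0 hBr.le]

set_option maxHeartbeats 800000 in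
theorem ec_lint (hC : Contr μ ε C M) {r B : ℝ} (hr : 0 < r) (hB : 0 < B) : ∃ C' : ℝ, 0 < C' ∧
    ∀ u w : ℂ, u ≠ 0 → ∫⁻ g, ENNReal.ofReal (‖ra w g‖ ^ (ε / 2)) * (bandS r B).indicator 1 (ra u g) ∂(Gr μ)
      ≤ ENNReal.ofReal (C' * (‖w‖ / ‖u‖) ^ (ε / 2)) := by
  have hε := hC.pos
  have hε1 := hC.le1
  have hC0 : 0 < C := lt_of_lt_of_le one_pos hC.C1
  have hM0 : 0 < M := lt_of_lt_of_le one_pos hC.M1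
  have S := ec_slope hC hr hB
  generalize hκ : ε / 2 = κ at S ⊢
  have hκ0 : 0 < κ := by rw [← hκ]; positivity
  have hκ1 : κ ≤ 1 := by rw [← hκ]; linarith
  have hbm : Measurable ((bandS r B).indicator (1 : ℂ → ℝ≥0∞)) := measurable_band_ind r B
  have hBr : 0 < B * r := by positivity
  generalize hCb : C * B ^ ε = Cb at S
  have hCb0 : 0 < Cb := by rw [← hCb]; positivity
  refine ⟨(B * r) ^ κ * (Cb + M * Cb * C) + (B * r) ^ κ * C, by positivity, fun u w hu => ?_⟩
  have hun : 0 < ‖u‖ := norm_pos_iff.2 hu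
  have hdag : Measurable (fun g : SL2 => alp (ra u g) (ra w g) ^ κ) := by fun_prop
  have hdt : (|dt u w| ^ κ) * ‖u‖ ^ (-ε) ≤ (‖w‖ / ‖u‖) ^ κ := by
    have e3 : ‖u‖ ^ (-ε) = ((‖u‖ ^ 2)⁻¹) ^ κ := by
      rw [Real.inv_rpow (by positivity), ← Real.rpow_natCast, ← Real.rpow_mul hun.le, ← Real.rpow_neg hun.le]
      congr 1; rw [← hκ]; push_cast; ring
    rw [e3, ← Real.mul_rpow (by positivity) (by positivity)]
    apply Real.rpow_le_rpow (by positivity) _ hκ0.le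
    have := abs_dt_le u w
    calc |dt u w| * (‖u‖ ^ 2)⁻¹ ≤ ‖u‖ * ‖w‖ * (‖u‖ ^ 2)⁻¹ := by gcongr
      _ = _ := by field_simp
  have hal : alp u w ^ κ ≤ (‖w‖ / ‖u‖) ^ κ := Real.rpow_le_rpow (alp_nonneg _ _) (alp_le hu) hκ0.le
  have hal0 : 0 ≤ alp u w ^ κ := Real.rpow_nonneg (alp_nonneg _ _) _
  generalize hX : (‖w‖ / ‖u‖) ^ κ = X at hdt hal
  have hX0 : 0 ≤ X := by rw [← hX]; positivity
  have hBk : 0 ≤ (B * r) ^ κ := by positivity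
  have hdk : 0 ≤ |dt u w| ^ κ := by positivity
  have huk : 0 ≤ ‖u‖ ^ (-ε) := by positivity
  calc _ ≤ ∫⁻ g, (ENNReal.ofReal ((B * r) ^ κ) * (ENNReal.ofReal (alp (ra u g) (ra w g) ^ κ) * (bandS r B).indicator 1 (ra u g)) +
          ENNReal.ofReal (|dt u w| ^ κ * (B * r) ^ κ) * ENNReal.ofReal (‖ra u g‖ ^ (-ε))) ∂(Gr μ) := by
        apply lintegral_mono
        intro g
        by_cases hg : ra u g ∈ bandS r B
        · simp only [Set.indicator_of_mem hg, Pi.one_apply, mul_one]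
          have hal1 : 0 ≤ alp (ra u g) (ra w g) ^ κ := Real.rpow_nonneg (alp_nonneg _ _) _
          have hug : 0 ≤ ‖ra u g‖ ^ (-ε) := by positivity
          rw [← ENNReal.ofReal_mul hBk, ← ENNReal.ofReal_mul (by positivity), ← ENNReal.ofReal_add (by positivity) (by positivity)]
          apply ENNReal.ofReal_le_ofReal
          exact ec_pt (ra_ne_zero hu g) hκ.symm hκ0 hκ1 hBr (by rw [dt_ra]) (abs_nonneg _) hg.2
        · simp [Set.indicator_of_notMem hg]
    _ = ENNReal.ofReal ((B * r) ^ κ) * ∫⁻ g, ENNReal.ofReal (alp (ra u g) (ra w g) ^ κ) * (bandS r B).indicator 1 (ra u g) ∂(Gr μ) +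
          ENNReal.ofReal (|dt u w| ^ κ * (B * r) ^ κ) * ∫⁻ g, ENNReal.ofReal (‖ra u g‖ ^ (-ε)) ∂(Gr μ) := by
        have m1 : Measurable (fun g : SL2 => ENNReal.ofReal (alp (ra u g) (ra w g) ^ κ) * (bandS r B).indicator 1 (ra u g)) :=
          hdag.ennreal_ofReal.mul (by fun_prop)
        have m2 : Measurable (fun g : SL2 => ENNReal.ofReal (‖ra u g‖ ^ (-ε))) := by fun_prop
        rw [lintegral_add_right _ (m2.const_mul _), lintegral_const_mul _ m1, lintegral_const_mul _ m2]
    _ ≤ ENNReal.ofReal ((B * r) ^ κ) * (ENNReal.ofReal (alp u w ^ κ) * ENNReal.ofReal Cb +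
          ENNReal.ofReal (M * Cb * |dt u w| ^ κ) * ENNReal.ofReal (C * ‖u‖ ^ (-ε))) +
          ENNReal.ofReal (|dt u w| ^ κ * (B * r) ^ κ) * ENNReal.ofReal (C * ‖u‖ ^ (-ε)) :=
        add_le_add (mul_le_mul_right (S u w hu) _) (mul_le_mul_right (hC.green u hu) _)
    _ = ENNReal.ofReal ((B * r) ^ κ * (alp u w ^ κ * Cb + M * Cb * C * (|dt u w| ^ κ * ‖u‖ ^ (-ε))) + (B * r) ^ κ * C * (|dt u w| ^ κ * ‖u‖ ^ (-ε))) := by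
        rw [← ENNReal.ofReal_mul hal0, ← ENNReal.ofReal_mul (by positivity), ← ENNReal.ofReal_add (by positivity) (by positivity),
          ← ENNReal.ofReal_mul hBk, ← ENNReal.ofReal_mul (by positivity), ← ENNReal.ofReal_add (by positivity) (by positivity)]
        congr 1; ring
    _ ≤ _ := by
        apply ENNReal.ofReal_le_ofReal
        calc _ ≤ (B * r) ^ κ * (X * Cb + M * Cb * C * X) + (B * r) ^ κ * C * X := by
              refine add_le_add (mul_le_mul_of_nonneg_left (add_le_add (mul_le_mul_of_nonneg_right hal hCb0.le) (mul_le_mul_of_nonneg_left hdt (by positivity))) hBk)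
                (mul_le_mul_of_nonneg_left hdt (by positivity))
          _ = _ := by ring

end

end

section

open scoped ENNReal NNReal Topology

/-! ### Renewal: periods of bounded harmonic functions near zero -/

structure NH (μ : Measure SL2) (H : ℂ → ℝ) : Prop where
  meas : Measurable H
  bdd : ∃ K : ℝ, 0 < K ∧ ∀ u, |H u| ≤ K
  ec : ∀ η : ℝ, 0 < η → ∃ δ : ℝ, 0 < δ ∧ ∀ u v : ℂ, u ≠ 0 → v ≠ 0 → ‖u - v‖ ≤ δ * ‖u‖ → |H u - H v| ≤ η
  harm : ∃ ρ : ℝ, 0 < ρ ∧ ∀ u : ℂ, u ≠ 0 → ‖u‖ < ρ → H u = ∫ g, H (ra u g) ∂μ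

def DD (H : ℂ → ℝ) (t : ℝ) (u : ℂ) : ℝ := H u - H (t * u)

section
variable {μ : Measure SL2} [IsProbabilityMeasure μ] {H : ℂ → ℝ}

theorem bdd_integrable {α : Type*} [MeasurableSpace α] {ρ : Measure α} [IsFiniteMeasure ρ] {f : α → ℝ} (hf : Measurable f) {K : ℝ}
    (hK : ∀ a, |f a| ≤ K) : Integrable f ρ :=
  Integrable.of_bound hf.aestronglyMeasurable K (ae_of_all _ fun a => by rw [Real.norm_eq_abs]; exact hK a)

theorem smul_ne {t : ℝ} (ht : 0 < t) {u : ℂ} (hu : u ≠ 0) : (t : ℂ) * u ≠ 0 :=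
  mul_ne_zero (by exact_mod_cast ht.ne') hu

theorem norm_smul_r {t : ℝ} (ht : 0 < t) (u : ℂ) : ‖(t : ℂ) * u‖ = t * ‖u‖ := by
  rw [norm_mul, Complex.norm_real, Real.norm_of_nonneg ht.le]

theorem NH.neg (h : NH μ H) : NH μ (fun u => - H u) := by
  refine ⟨h.meas.neg, ?_, ?_, ?_⟩
  · obtain ⟨K, hK, hb⟩ := h.bdd
    exact ⟨K, hK, fun u => by rw [abs_neg]; exact hb u⟩
  · intro η hη
    obtain ⟨δ, hδ, hh⟩ := h.ec η hη
    refine ⟨δ, hδ, fun u v hu hv huv => ?_⟩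
    rw [neg_sub_neg, abs_sub_comm]; exact hh u v hu hv huv
  · obtain ⟨ρ, hρ, hh⟩ := h.harm
    refine ⟨ρ, hρ, fun u hu hun => ?_⟩
    rw [integral_neg, hh u hu hun]

theorem NH.diff (h : NH μ H) {t : ℝ} (ht : 0 < t) : NH μ (DD H t) := by
  have hm := h.meas
  obtain ⟨K, hK, hb⟩ := h.bdd
  refine ⟨by unfold DD; fun_prop, ⟨K + K, by positivity, fun u => ?_⟩, ?_, ?_⟩
  · unfold DD
    exact (abs_sub _ _).trans (add_le_add (hb _) (hb _))
  · intro η hη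
    obtain ⟨δ, hδ, hh⟩ := h.ec (η / 2) (by positivity)
    refine ⟨δ, hδ, fun u v hu hv huv => ?_⟩
    have h1 := hh u v hu hv huv
    have h2 := hh (t * u) (t * v) (smul_ne ht hu) (smul_ne ht hv) (by
      rw [← mul_sub, norm_smul_r ht, norm_smul_r ht]
      calc _ ≤ t * (δ * ‖u‖) := by gcongr
        _ = _ := by ring)
    unfold DD
    rw [abs_le] at *
    constructor <;> linarith [h1.1, h1.2, h2.1, h2.2]
  · obtain ⟨ρ, hρ, hh⟩ := h.harm
    refine ⟨min ρ (ρ / t), by positivity, fun u hu hun => ?_⟩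
    have h1 := hh u hu (lt_of_lt_of_le hun (min_le_left _ _))
    have h2 := hh (t * u) (smul_ne ht hu) (by
      rw [norm_smul_r ht]
      have := lt_of_lt_of_le hun (min_le_right _ _)
      rw [lt_div_iff₀ ht] at this; linarith)
    unfold DD
    rw [h1, h2, integral_sub (bdd_integrable (by fun_prop) fun g => hb _)]
    · simp only [ra_smul]
    · simp only [← ra_smul]
      exact bdd_integrable (by fun_prop) fun g => hb _

/-- distance of entries -/
def ed (g h : SL2) : ℝ := |h.1 0 0 - g.1 0 0| + |h.1 0 1 - g.1 0 1| + |h.1 1 0 - g.1 1 0| + |h.1 1 1 - g.1 1 1|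

theorem continuous_ed (g : SL2) : Continuous (ed g) := by
  unfold ed
  have h1 := continuous_entry 0 0
  have h2 := continuous_entry 0 1
  have h3 := continuous_entry 1 0
  have h4 := continuous_entry 1 1
  fun_prop

theorem ra_ed (g h : SL2) (u : ℂ) : ‖ra u g - ra u h‖ ≤ ed g h * ‖u‖ := by
  refine (Complex.norm_le_abs_re_add_abs_im _).trans ?_
  have h1 := Complex.abs_re_le_norm u
  have h2 := Complex.abs_im_le_norm u
  have e1 : (ra u g - ra u h).re = -(u.re * (h.1 0 0 - g.1 0 0) + u.im * (h.1 1 0 - g.1 1 0)) := by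
    simp [ra]; ring
  have e2 : (ra u g - ra u h).im = -(u.re * (h.1 0 1 - g.1 0 1) + u.im * (h.1 1 1 - g.1 1 1)) := by
    simp [ra]; ring
  rw [e1, e2, abs_neg, abs_neg]
  have k : ∀ a b : ℝ, |u.re * a + u.im * b| ≤ ‖u‖ * |a| + ‖u‖ * |b| := by
    intro a b
    refine (abs_add_le _ _).trans ?_
    rw [abs_mul, abs_mul]
    gcongr
  have := k (h.1 0 0 - g.1 0 0) (h.1 1 0 - g.1 1 0)
  have := k (h.1 0 1 - g.1 0 1) (h.1 1 1 - g.1 1 1)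
  unfold ed
  nlinarith

theorem NH.nbhd (h : NH μ H) (g : SL2) {η : ℝ} (hη : 0 < η) :
    ∃ U : Set SL2, IsOpen U ∧ g ∈ U ∧ ∀ k ∈ U, ∀ u : ℂ, u ≠ 0 → |H (ra u g) - H (ra u k)| ≤ η := by
  obtain ⟨δ, hδ, hh⟩ := h.ec η hη
  have hN := NN_pos g
  refine ⟨{k | ed g k < δ / NN g}, isOpen_lt (continuous_ed g) continuous_const, ?_, ?_⟩
  · simp only [Set.mem_ofPred_eq, ed, sub_self, abs_zero, add_zero]; positivity
  · intro k hk u hu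
    refine hh _ _ (ra_ne_zero hu g) (ra_ne_zero hu k) ((ra_ed g k u).trans ?_)
    have h1 := norm_le_ra u g
    have hk' : ed g k ≤ δ / NN g := le_of_lt hk
    calc ed g k * ‖u‖ ≤ (δ / NN g) * (NN g * ‖ra u g‖) := by gcongr
      _ = _ := by field_simp

theorem NH.prop_supp (h : NH μ H) {M : ℝ} (hM : ∀ η : ℝ, 0 < η → ∀ᶠ u in 𝓝[≠] (0 : ℂ), H u ≤ M + η)
    {g : SL2} (hg : g ∈ measSupp μ) {U : ℕ → ℂ} (hU : Tendsto U atTop (𝓝[≠] 0)) (hUM : Tendsto (fun j => H (U j)) atTop (𝓝 M)) :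
    Tendsto (fun j => H (ra (U j) g)) atTop (𝓝 M) := by
  have hm := h.meas
  obtain ⟨K, hK, hb⟩ := h.bdd
  obtain ⟨ρ, hρ, hh⟩ := h.harm
  have hU0 : ∀ᶠ j in atTop, U j ≠ 0 := hU.eventually eventually_mem_nhdsWithin
  have hUt : Tendsto U atTop (𝓝 0) := hU.mono_right nhdsWithin_le_nhds
  have hUρ : ∀ᶠ j in atTop, ‖U j‖ < ρ := by
    have := hUt.norm; rw [norm_zero] at this
    exact this.eventually (gt_mem_nhds hρ)
  have hintg : ∀ j, Integrable (fun k => H (ra (U j) k)) μ := fun j => bdd_integrable (by fun_prop) fun k => hb _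
  have h1 : Tendsto (fun j => ∫ k, H (ra (U j) k) ∂μ) atTop (𝓝 M) := by
    refine hUM.congr' ?_
    filter_upwards [hU0, hUρ] with j a b
    exact hh _ a b
  have hbm : ∀ j k, |max (H (ra (U j) k) - M) 0| ≤ K + |M| := by
    intro j k
    have := hb (ra (U j) k)
    rw [abs_of_nonneg (le_max_right _ _)]
    refine max_le ?_ (by positivity)
    have := (abs_le.1 this).2
    have := neg_abs_le M
    linarith
  have h2 : Tendsto (fun j => ∫ k, max (H (ra (U j) k) - M) 0 ∂μ) atTop (𝓝 0) := by
    have := tendsto_integral_of_dominated_convergence (μ := μ) (F := fun j k => max (H (ra (U j) k) - M) 0) (f := fun _ => 0) (fun _ => K + |M|)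
      (fun j => by
        have : Measurable (fun k => max (H (ra (U j) k) - M) 0) := by fun_prop
        exact this.aestronglyMeasurable) (integrable_const _) (fun j => ae_of_all _ fun k => by rw [Real.norm_eq_abs]; exact hbm j k)
      (ae_of_all _ fun k => by
        have ht : Tendsto (fun j => ra (U j) k) atTop (𝓝[≠] 0) := by
          refine tendsto_nhdsWithin_iff.2 ⟨?_, ?_⟩
          · have hc : Tendsto (fun j => NN k * ‖U j‖) atTop (𝓝 0) := by
              have := hUt.norm.const_mul (NN k); simpa using this
            exact squeeze_zero_norm (fun j => norm_ra_le _ _) hc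
          · filter_upwards [hU0] with j hj
            exact ra_ne_zero hj k
        rw [Metric.tendsto_nhds]
        intro η hη
        filter_upwards [ht.eventually (hM (η / 2) (by positivity))] with j hj
        rw [Real.dist_eq, sub_zero, abs_of_nonneg (le_max_right _ _)]
        refine max_lt (by linarith) hη)
    simpa using this
  have hintm : ∀ j, Integrable (fun k => max (H (ra (U j) k) - M) 0) μ := fun j => bdd_integrable (by fun_prop) (hbm j)
  have h3 : Tendsto (fun j => ∫ k, |H (ra (U j) k) - M| ∂μ) atTop (𝓝 0) := by
    have e : ∀ j, ∫ k, |H (ra (U j) k) - M| ∂μ = 2 * ∫ k, max (H (ra (U j) k) - M) 0 ∂μ - (∫ k, H (ra (U j) k) ∂μ - M) := by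
      intro j
      have : ∀ k, |H (ra (U j) k) - M| = 2 * max (H (ra (U j) k) - M) 0 - (H (ra (U j) k) - M) := by
        intro k
        rcases le_total 0 (H (ra (U j) k) - M) with hx | hx
        · rw [abs_of_nonneg hx, max_eq_left hx]; ring
        · rw [abs_of_nonpos hx, max_eq_right hx]; ring
      simp only [this]
      have hs : Integrable (fun k => H (ra (U j) k) - M) μ := (hintg j).sub (integrable_const _)
      rw [integral_sub ((hintm j).const_mul 2) hs, integral_const_mul, integral_sub (hintg j) (integrable_const _)]
      simp
    simp only [e]
    have := (h2.const_mul 2).sub (h1.sub_const M)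
    simpa using this
  rw [Metric.tendsto_nhds]
  intro η hη
  obtain ⟨V, hVo, hgV, hV⟩ := h.nbhd g (η := η / 2) (by positivity)
  have hp : 0 < μ V := hg V hVo hgV
  set p := (μ V).toReal with hpp
  have hp0 : 0 < p := ENNReal.toReal_pos hp.ne' (measure_ne_top _ _)
  have h4 : ∀ᶠ j in atTop, ∫ k, |H (ra (U j) k) - M| ∂μ < η / 2 * p := h3.eventually (gt_mem_nhds (by positivity))
  filter_upwards [h4, hU0] with j hj hj0
  rw [Real.dist_eq]
  have hi : Integrable (fun k => |H (ra (U j) k) - M|) μ := ((hintg j).sub (integrable_const _)).abs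
  have h5 : (|H (ra (U j) g) - M| - η / 2) * p ≤ ∫ k in V, |H (ra (U j) k) - M| ∂μ := by
    have : ∫ k in V, (|H (ra (U j) g) - M| - η / 2) ∂μ = (|H (ra (U j) g) - M| - η / 2) * p := by
      rw [setIntegral_const, smul_eq_mul, mul_comm]; rfl
    rw [← this]
    refine setIntegral_mono_on (integrable_const _).integrableOn hi.integrableOn hVo.measurableSet fun k hk => ?_
    have h6 := hV k hk _ hj0
    have := abs_sub_le (H (ra (U j) g)) (H (ra (U j) k)) M
    linarith
  have h7 : ∫ k in V, |H (ra (U j) k) - M| ∂μ ≤ ∫ k, |H (ra (U j) k) - M| ∂μ :=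
    setIntegral_le_integral hi (ae_of_all _ fun k => abs_nonneg _)
  have h8 : (|H (ra (U j) g) - M| - η / 2) * p < η / 2 * p := by linarith
  have := lt_of_mul_lt_mul_right h8 hp0.le
  linarith

theorem ra_tendsto0 {U : ℕ → ℂ} (hU : Tendsto U atTop (𝓝[≠] 0)) (k : SL2) : Tendsto (fun j => ra (U j) k) atTop (𝓝[≠] 0) := by
  have hU0 : ∀ᶠ j in atTop, U j ≠ 0 := hU.eventually eventually_mem_nhdsWithin
  have hUt : Tendsto U atTop (𝓝 0) := hU.mono_right nhdsWithin_le_nhds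
  refine tendsto_nhdsWithin_iff.2 ⟨?_, ?_⟩
  · have hc : Tendsto (fun j => NN k * ‖U j‖) atTop (𝓝 0) := by
      have := hUt.norm.const_mul (NN k); simpa using this
    exact squeeze_zero_norm (fun j => norm_ra_le _ _) hc
  · filter_upwards [hU0] with j hj
    exact ra_ne_zero hj k

theorem NH.prop_mon (h : NH μ H) {M : ℝ} (hM : ∀ η : ℝ, 0 < η → ∀ᶠ u in 𝓝[≠] (0 : ℂ), H u ≤ M + η)
    {g : SL2} (hg : g ∈ Submonoid.closure (measSupp μ)) : ∀ {U : ℕ → ℂ}, Tendsto U atTop (𝓝[≠] 0) → Tendsto (fun j => H (U j)) atTop (𝓝 M) →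
    Tendsto (fun j => H (ra (U j) g)) atTop (𝓝 M) := by
  induction hg using Submonoid.closure_induction with
  | mem x hx => intro U h1 h2; exact h.prop_supp hM hx h1 h2
  | one => intro U h1 h2; simpa only [ra_one] using h2
  | mul x y hx hy ihx ihy =>
    intro U h1 h2
    simp only [ra_mul]
    exact ihy (ra_tendsto0 h1 x) (ihx h1 h2)

end

end

section

open scoped ENNReal NNReal Topology

section
variable {μ : Measure SL2} [IsProbabilityMeasure μ] {H : ℂ → ℝ}

theorem exists_limsup_seq {D : ℂ → ℝ} {K : ℝ} (hb : ∀ u, |D u| ≤ K) : ∃ (M : ℝ) (U : ℕ → ℂ),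
    (∀ η : ℝ, 0 < η → ∀ᶠ u in 𝓝[≠] (0 : ℂ), D u ≤ M + η) ∧ Tendsto U atTop (𝓝[≠] 0) ∧ Tendsto (fun j => D (U j)) atTop (𝓝 M) := by
  set M := limsup D (𝓝[≠] (0 : ℂ)) with hM
  have b1 : IsBoundedUnder (· ≤ ·) (𝓝[≠] (0 : ℂ)) D := isBoundedUnder_of ⟨K, fun u => (abs_le.1 (hb u)).2⟩
  have b2 : IsBoundedUnder (· ≥ ·) (𝓝[≠] (0 : ℂ)) D := isBoundedUnder_of ⟨-K, fun u => (abs_le.1 (hb u)).1⟩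
  have h1 : ∀ η : ℝ, 0 < η → ∀ᶠ u in 𝓝[≠] (0 : ℂ), D u ≤ M + η := by
    intro η hη
    have : limsup D (𝓝[≠] (0 : ℂ)) < M + η := by rw [← hM]; linarith
    exact (eventually_lt_of_limsup_lt this b1).mono fun u hu => hu.le
  have h2 : ∀ n : ℕ, ∃ u : ℂ, u ≠ 0 ∧ ‖u‖ < 1 / ((n : ℝ) + 1) ∧ M - 1 / ((n : ℝ) + 1) < D u := by
    intro n
    have hn : (0 : ℝ) < 1 / ((n : ℝ) + 1) := by positivity
    have : M - 1 / ((n : ℝ) + 1) < limsup D (𝓝[≠] (0 : ℂ)) := by rw [← hM]; linarith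
    have hf := frequently_lt_of_lt_limsup b2.isCoboundedUnder_le this
    have he : ∀ᶠ u in 𝓝[≠] (0 : ℂ), u ≠ 0 ∧ ‖u‖ < 1 / ((n : ℝ) + 1) := by
      refine (eventually_mem_nhdsWithin).and ?_
      apply nhdsWithin_le_nhds
      filter_upwards [Metric.ball_mem_nhds (0 : ℂ) hn] with u hu
      simpa using hu
    obtain ⟨u, h1, h2, h3⟩ := (hf.and_eventually he).exists
    exact ⟨u, h2, h3, h1⟩
  choose U hU0 hUn hUD using h2
  have hU : Tendsto U atTop (𝓝[≠] 0) := by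
    refine tendsto_nhdsWithin_iff.2 ⟨?_, Eventually.of_forall hU0⟩
    exact squeeze_zero_norm (fun n => (hUn n).le) tendsto_one_div_add_atTop_nhds_zero_nat
  refine ⟨M, U, h1, hU, ?_⟩
  rw [Metric.tendsto_nhds]
  intro η hη
  have ht := (tendsto_one_div_add_atTop_nhds_zero_nat (𝕜 := ℝ)).eventually (gt_mem_nhds hη)
  filter_upwards [hU.eventually (h1 (η / 2) (by positivity)), ht] with n hn hn2
  have := hUD n
  rw [Real.dist_eq, abs_lt]
  constructor <;> linarith

theorem two_forms {q : ℂ} {h0 : SL2} (hq : q ≠ 0) (he : dt q (ra q h0) ≠ 0) : ∃ c : ℝ, 0 < c ∧ ∀ u : ℂ,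
    c * ‖u‖ ≤ |dt u q| ∨ c * ‖ra u h0‖ ≤ |dt (ra u h0) q| := by
  have hqn : 0 < ‖q‖ := norm_pos_iff.2 hq
  have hqn2 : 0 < ‖ra q h0‖ := norm_pos_iff.2 (ra_ne_zero hq h0)
  have hN := NN_pos h0
  set e := |dt q (ra q h0)| with hee
  have he0 : 0 < e := abs_pos.2 he
  refine ⟨min (e / (2 * ‖ra q h0‖)) (e / (2 * NN h0 * ‖q‖)), by positivity, fun u => ?_⟩
  set c := min (e / (2 * ‖ra q h0‖)) (e / (2 * NN h0 * ‖q‖)) with hc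
  have hc0 : 0 < c := by positivity
  by_contra! hcon
  obtain ⟨h1, h2⟩ := hcon
  have id : ((dt (ra q h0) q : ℝ) : ℂ) * ra u h0 = (dt (ra u h0) q : ℝ) * ra q h0 + (dt q u : ℝ) * q := by
    rw [← dt_ra q u h0]
    apply Complex.ext <;> simp [dt] <;> ring
  have h3 : e * ‖ra u h0‖ ≤ |dt (ra u h0) q| * ‖ra q h0‖ + |dt u q| * ‖q‖ := by
    have := congrArg norm id
    rw [norm_mul, Complex.norm_real, Real.norm_eq_abs, dt_comm, abs_neg, ← hee] at this
    rw [this]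
    refine (norm_add_le _ _).trans ?_
    rw [norm_mul, norm_mul, Complex.norm_real, Complex.norm_real, Real.norm_eq_abs, Real.norm_eq_abs, dt_comm q u, abs_neg]
  have h4 : c * ‖ra q h0‖ ≤ e / 2 := by
    calc _ ≤ e / (2 * ‖ra q h0‖) * ‖ra q h0‖ := by gcongr; exact min_le_left _ _
      _ = _ := by field_simp
  have h5 : c * NN h0 * ‖q‖ ≤ e / 2 := by
    calc _ ≤ e / (2 * NN h0 * ‖q‖) * NN h0 * ‖q‖ := by gcongr; exact min_le_right _ _
      _ = _ := by field_simp
  have h6 := norm_le_ra u h0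
  have h7 : |dt (ra u h0) q| * ‖ra q h0‖ < c * ‖ra u h0‖ * ‖ra q h0‖ := by gcongr
  have h8 : |dt u q| * ‖q‖ < c * ‖u‖ * ‖q‖ := by gcongr
  have h9 : c * ‖u‖ * ‖q‖ ≤ c * (NN h0 * ‖ra u h0‖) * ‖q‖ := by gcongr
  have h10 : c * ‖ra q h0‖ * ‖ra u h0‖ ≤ e / 2 * ‖ra u h0‖ := by gcongr
  have h11 : c * NN h0 * ‖q‖ * ‖ra u h0‖ ≤ e / 2 * ‖ra u h0‖ := by gcongr
  nlinarith

theorem dt_comb {p q : ℂ} (hpq : dt p q = 1) (a b : ℝ) : dt ((a : ℂ) * p + (b : ℂ) * q) q = a ∧ dt p ((a : ℂ) * p + (b : ℂ) * q) = b := by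
  simp only [dt, Complex.add_re, Complex.add_im, Complex.re_ofReal_mul, Complex.im_ofReal_mul] at *
  constructor
  · linear_combination a * hpq
  · linear_combination b * hpq

theorem NH.period_le (h : NH μ H) (hzd : ¬ IsSolvable (Subgroup.closure (measSupp μ))) {g : SL2} (hg : g ∈ Submonoid.closure (measSupp μ))
    {l : ℝ} {p q : ℂ} (hl : 1 < l) (hpq : dt p q = 1) (hp : ra p g = l * p) (hq : ra q g = (l⁻¹ : ℝ) * q) :
    ∀ η : ℝ, 0 < η → ∀ᶠ u in 𝓝[≠] (0 : ℂ), DD H l u ≤ η := by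
  have hl0 : 0 < l := by linarith
  have hD := h.diff hl0
  obtain ⟨K', hK', hb'⟩ := hD.bdd
  obtain ⟨K, hK, hb⟩ := h.bdd
  obtain ⟨M, U, hM, hU, hUM⟩ := exists_limsup_seq hb'
  suffices hM0 : M ≤ 0 by
    intro η hη
    exact (hM η hη).mono fun u hu => by linarith
  by_contra! hMp
  have hp0 : p ≠ 0 := by rintro rfl; simp [dt] at hpq
  have hq0 : q ≠ 0 := by rintro rfl; simp [dt] at hpq
  have hpn : 0 < ‖p‖ := norm_pos_iff.2 hp0
  have hqn : 0 < ‖q‖ := norm_pos_iff.2 hq0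
  obtain ⟨h0, hh0, hdt0⟩ := N1 hzd hq0
  have hh0' : h0 ∈ Submonoid.closure (measSupp μ) := Submonoid.subset_closure hh0
  obtain ⟨c, hc, hcu⟩ := two_forms hq0 hdt0
  set η := M / 6 with hη
  have hη0 : 0 < η := by positivity
  obtain ⟨δ, hδ, hec⟩ := h.ec η hη0
  obtain ⟨N, hN⟩ := exists_nat_gt (4 * K / M)
  have hNM : 4 * K < N * M := by rwa [div_lt_iff₀ hMp] at hN
  obtain ⟨m, hm⟩ := pow_unbounded_of_one_lt (‖p‖ * ‖q‖ ^ 2 / (δ * c)) hl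
  rw [div_lt_iff₀ (by positivity)] at hm
  have ev1 : ∀ᶠ j in atTop, ∀ k ∈ Finset.range N, M - η < DD H l (ra (U j) (g ^ (m + k))) := by
    rw [eventually_all_finset]
    intro k _
    have := hD.prop_mon hM (Submonoid.pow_mem _ hg (m + k)) hU hUM
    exact this.eventually (lt_mem_nhds (by linarith))
  have ev2 : ∀ᶠ j in atTop, ∀ k ∈ Finset.range N, M - η < DD H l (ra (ra (U j) h0) (g ^ (m + k))) := by
    rw [eventually_all_finset]
    intro k _
    have := hD.prop_mon hM (Submonoid.pow_mem _ hg (m + k)) (ra_tendsto0 hU h0) (hD.prop_mon hM hh0' hU hUM)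
    exact this.eventually (lt_mem_nhds (by linarith))
  have hU0 : ∀ᶠ j in atTop, U j ≠ 0 := hU.eventually eventually_mem_nhdsWithin
  obtain ⟨j, hj1, hj2, hj0⟩ := (ev1.and (ev2.and hU0)).exists
  obtain ⟨v, hv0, hvc, hvk⟩ : ∃ v : ℂ, v ≠ 0 ∧ c * ‖v‖ ≤ |dt v q| ∧ ∀ k ∈ Finset.range N, M - η < DD H l (ra v (g ^ (m + k))) := by
    rcases hcu (U j) with h1 | h1
    · exact ⟨U j, hj0, h1, hj1⟩
    · exact ⟨ra (U j) h0, ra_ne_zero hj0 h0, h1, hj2⟩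
  set w := ra v (g ^ m) with hw
  have hw0 : w ≠ 0 := ra_ne_zero hv0 _
  have hvn : 0 < ‖v‖ := norm_pos_iff.2 hv0
  have hwe : w = (dt v q * l ^ m : ℝ) * p + (dt p v * (l⁻¹) ^ m : ℝ) * q := ra_pow_hyp hpq hp hq v m
  have hli : l⁻¹ ≤ 1 := inv_le_one_of_one_le₀ hl.le
  have hli0 : 0 < l⁻¹ := by positivity
  have hwq : dt w q = dt v q * l ^ m := by rw [hwe]; exact (dt_comb hpq _ _).1
  have hpw : dt p w = dt p v * (l⁻¹) ^ m := by rw [hwe]; exact (dt_comb hpq _ _).2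
  have hcond : |dt p w| * ‖q‖ ≤ δ * ‖w‖ := by
    have a1 : |dt p w| ≤ ‖p‖ * ‖v‖ := by
      rw [hpw, abs_mul, abs_of_pos (by positivity : 0 < (l⁻¹) ^ m)]
      calc _ ≤ ‖p‖ * ‖v‖ * 1 := by gcongr; exact abs_dt_le _ _; exact pow_le_one₀ hli0.le hli
        _ = _ := mul_one _
    have a2 : c * ‖v‖ * l ^ m ≤ ‖w‖ * ‖q‖ := by
      refine le_trans ?_ (abs_dt_le w q)
      rw [hwq, abs_mul, abs_of_pos (by positivity : 0 < l ^ m)]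
      gcongr
    have a3 : ‖p‖ * ‖q‖ ^ 2 * ‖v‖ ≤ δ * (‖w‖ * ‖q‖) := by
      calc _ ≤ (l ^ m * (δ * c)) * ‖v‖ := by gcongr
        _ = δ * (c * ‖v‖ * l ^ m) := by ring
        _ ≤ _ := by gcongr
    have a4 : |dt p w| * ‖q‖ * ‖q‖ ≤ δ * ‖w‖ * ‖q‖ := by
      calc _ ≤ ‖p‖ * ‖v‖ * ‖q‖ * ‖q‖ := by gcongr
        _ = ‖p‖ * ‖q‖ ^ 2 * ‖v‖ := by ring
        _ ≤ _ := by linarith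
    exact le_of_mul_le_mul_right a4 hqn
  have hclose : ∀ k : ℕ, ‖((l ^ k : ℝ) : ℂ) * w - ra w (g ^ k)‖ ≤ δ * ‖((l ^ k : ℝ) : ℂ) * w‖ := by
    intro k
    have e1 : ((l ^ k : ℝ) : ℂ) * w - ra w (g ^ k) = (((l ^ k - (l⁻¹) ^ k) * dt p w : ℝ) : ℂ) * q := by
      rw [ra_pow_hyp hpq hp hq w k]
      conv_lhs => enter [1]; rw [decomp hpq w]
      push_cast; ring
    rw [e1, norm_smul_r (t := l ^ k) (by positivity) w, norm_mul, Complex.norm_real, Real.norm_eq_abs, abs_mul]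
    have k1 : 1 ≤ l ^ k := one_le_pow₀ hl.le
    have k2 : (l⁻¹) ^ k ≤ 1 := pow_le_one₀ hli0.le hli
    have k3 : 0 < (l⁻¹) ^ k := by positivity
    have k4 : |l ^ k - (l⁻¹) ^ k| ≤ l ^ k := by rw [abs_of_nonneg (by linarith)]; linarith
    calc _ ≤ l ^ k * |dt p w| * ‖q‖ := by gcongr
      _ = l ^ k * (|dt p w| * ‖q‖) := by ring
      _ ≤ l ^ k * (δ * ‖w‖) := by gcongr
      _ = _ := by ring
  have hstep : ∀ k ∈ Finset.range N, M - 3 * η ≤ H ((l ^ k : ℝ) * w) - H ((l ^ (k + 1) : ℝ) * w) := by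
    intro k hk
    have h1 := hvk k hk
    rw [pow_add, ra_mul, ← hw] at h1
    have hk0 : ((l ^ k : ℝ) : ℂ) * w ≠ 0 := smul_ne (by positivity) hw0
    have h2 := hec _ _ hk0 (ra_ne_zero hw0 (g ^ k)) (hclose k)
    have h3 := hec (l * (((l ^ k : ℝ) : ℂ) * w)) (l * ra w (g ^ k)) (smul_ne hl0 hk0) (smul_ne hl0 (ra_ne_zero hw0 (g ^ k))) (by
      rw [← mul_sub, norm_smul_r hl0, norm_smul_r hl0]
      have := hclose k
      calc _ ≤ l * (δ * ‖((l ^ k : ℝ) : ℂ) * w‖) := by gcongr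
        _ = _ := by ring)
    have e2 : (l : ℂ) * (((l ^ k : ℝ) : ℂ) * w) = ((l ^ (k + 1) : ℝ) : ℂ) * w := by rw [pow_succ]; push_cast; ring
    rw [e2] at h3
    unfold DD at h1
    rw [abs_le] at h2 h3
    linarith [h2.1, h3.2]
  have hsum := Finset.sum_le_sum hstep
  rw [Finset.sum_range_sub' (fun k : ℕ => H ((l ^ k : ℝ) * w)), Finset.sum_const, Finset.card_range, nsmul_eq_mul] at hsum
  have b1 := (abs_le.1 (hb ((l ^ 0 : ℝ) * w))).2
  have b2 := (abs_le.1 (hb ((l ^ N : ℝ) * w))).1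
  have : (N : ℝ) * (M - 3 * η) = N * M / 2 := by rw [hη]; ring
  linarith

theorem NH.period (h : NH μ H) (hzd : ¬ IsSolvable (Subgroup.closure (measSupp μ))) {g : SL2} (hg : g ∈ Submonoid.closure (measSupp μ))
    {l : ℝ} {p q : ℂ} (hl : 1 < l) (hpq : dt p q = 1) (hp : ra p g = l * p) (hq : ra q g = (l⁻¹ : ℝ) * q) :
    Tendsto (DD H l) (𝓝[≠] (0 : ℂ)) (𝓝 0) := by
  rw [Metric.tendsto_nhds]
  intro η hη
  filter_upwards [h.period_le hzd hg hl hpq hp hq (η / 2) (by positivity), h.neg.period_le hzd hg hl hpq hp hq (η / 2) (by positivity)] with u h1 h2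
  unfold DD at *
  rw [Real.dist_eq, abs_lt]
  constructor <;> linarith

end

end

section

open scoped ENNReal NNReal Topology

theorem tr_basis {p q : ℂ} (hpq : dt p q = 1) (k : SL2) : tr k = dt (ra p k) q + dt p (ra q k) := by
  simp only [dt, ra, tr] at *
  linear_combination (-(k.1 0 0) - k.1 1 1) * hpq

theorem det_basis {p q : ℂ} (hpq : dt p q = 1) (k : SL2) : dt (ra p k) q * dt p (ra q k) - dt p (ra p k) * dt (ra q k) q = 1 := by
  have h := k.det_eq
  simp only [dt, ra] at *
  linear_combination (k.1 0 0 * k.1 1 1 - k.1 0 1 * k.1 1 0) * (p.re * q.im - p.im * q.re + 1) * hpq + h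

theorem dt_mul_basis {p q : ℂ} (hpq : dt p q = 1) (u : ℂ) (h k : SL2) :
    dt (ra u (h * k)) q = dt (ra u h) q * dt (ra p k) q + dt p (ra u h) * dt (ra q k) q ∧
    dt p (ra u (h * k)) = dt (ra u h) q * dt p (ra p k) + dt p (ra u h) * dt p (ra q k) := by
  have e : ra u (h * k) = (dt (ra u h) q : ℝ) * ra p k + (dt p (ra u h) : ℝ) * ra q k := by
    rw [ra_mul, ← ra_smul, ← ra_smul, ← ra_add, ← decomp hpq]
  rw [e]
  constructor <;> simp [dt] <;> ring

theorem sq_eig {g : SL2} {l : ℝ} {p : ℂ} (hp : ra p g = l * p) : ra p (g ^ 2) = ((l ^ 2 : ℝ) : ℂ) * p := ra_pow_eig hp 2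

theorem nonarith {A : Set SL2} (hA : ¬ IsSolvable (Subgroup.closure A)) (P : AddSubgroup ℝ)
    (hP : ∀ g ∈ Submonoid.closure A, ∀ (l : ℝ) (p q : ℂ), 1 < l → dt p q = 1 → ra p g = l * p → ra q g = (l⁻¹ : ℝ) * q → Real.log l ∈ P) :
    Dense (P : Set ℝ) := by
  rcases AddSubgroup.dense_or_cyclic P with hd | ⟨c, hc⟩
  · exact hd
  exfalso
  have hP2 : ∀ g ∈ Submonoid.closure A, ∀ (l : ℝ) (p q : ℂ), 1 < |l| → dt p q = 1 → ra p g = l * p → ra q g = (l⁻¹ : ℝ) * q → Real.log (l ^ 2) ∈ P := by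
    intro g hg l p q hl hpq hp hq
    refine hP (g ^ 2) (Submonoid.pow_mem _ hg 2) (l ^ 2) p q ?_ hpq (sq_eig hp) ?_
    · rw [← sq_abs]; nlinarith
    · rw [sq_eig hq, inv_pow]
  have hPc : ∀ x ∈ P, |x| < |c| → x = 0 := by
    intro x hx hxc
    rw [hc, AddSubgroup.mem_closure_singleton] at hx
    obtain ⟨k, rfl⟩ := hx
    rw [zsmul_eq_mul, abs_mul] at hxc
    by_cases hk : k = 0
    · simp [hk]
    · exfalso
      have : (1 : ℝ) ≤ |(k : ℝ)| := by
        rw [← Int.cast_abs]; exact_mod_cast Int.one_le_abs hk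
      nlinarith [abs_nonneg c]
  obtain ⟨g, hg, hgt⟩ := N3 hA
  obtain ⟨l, p, q, hl, hpq, hp, hq⟩ := hyper_eig hgt
  have hl0 : l ≠ 0 := by rintro rfl; simp at hl; linarith
  have hlog : 0 < Real.log (l ^ 2) := Real.log_pos (by rw [← sq_abs]; nlinarith)
  have hc0 : 0 < |c| := by
    apply abs_pos.2
    rintro rfl
    have := hP2 g hg l p q hl hpq hp hq
    rw [hc, AddSubgroup.mem_closure_singleton] at this
    obtain ⟨k, hk⟩ := this
    simp at hk
    rw [Real.log_pow] at hlog
    rcases hk with h1 | h1 | h1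
    · exact hl0 h1
    · rw [h1] at hl; simp at hl
    · rw [h1] at hl; simp at hl
  have hq0 : q ≠ 0 := by rintro rfl; simp [dt] at hpq
  have hli : |l|⁻¹ < 1 := inv_lt_one_of_one_lt₀ hl
  have star : ∀ h ∈ Submonoid.closure A, dt (ra p h) q ≠ 0 → dt p (ra p h) * dt (ra q h) q = 0 := by
    intro h hh ha
    set a := dt (ra p h) q with haa
    set d := dt p (ra q h) with hdd
    have htr : ∀ n : ℕ, tr (g ^ n * h) = l ^ n * a + (l⁻¹) ^ n * d := by
      intro n
      rw [tr_basis hpq, ra_mul, ra_mul, ra_pow_eig hp, ra_pow_eig hq, ra_smul, ra_smul, dt_smul, dt_smul']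
    have hpow : Tendsto (fun n : ℕ => (l⁻¹) ^ n) atTop (𝓝 0) := by
      apply tendsto_pow_atTop_nhds_zero_of_abs_lt_one
      rw [abs_inv]; exact hli
    have hTn : Tendsto (fun n : ℕ => a + (l⁻¹) ^ n * ((l⁻¹) ^ n * d)) atTop (𝓝 a) := by
      have := (hpow.mul (hpow.mul_const d)).const_add a
      simpa using this
    have hTn2 : Tendsto (fun n : ℕ => |tr (g ^ n * h)|) atTop atTop := by
      have e : ∀ n : ℕ, |tr (g ^ n * h)| = |l| ^ n * |a + (l⁻¹) ^ n * ((l⁻¹) ^ n * d)| := by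
        intro n
        rw [htr, ← abs_pow, ← abs_mul]
        congr 1
        have : l ^ n * (l⁻¹) ^ n = 1 := by rw [← mul_pow, mul_inv_cancel₀ hl0, one_pow]
        linear_combination (-(l⁻¹) ^ n * d) * this
      simp only [e]
      exact (tendsto_pow_atTop_atTop_of_one_lt hl).atTop_mul_pos (abs_pos.2 ha) hTn.abs
    have hev : ∀ᶠ n in atTop, 2 < |tr (g ^ n * h)| := hTn2.eventually_gt_atTop 2
    have hL : ∀ n : ℕ, ∃ L : ℝ, 2 < |tr (g ^ n * h)| → (1 < |L| ∧ L + L⁻¹ = tr (g ^ n * h) ∧ Real.log (L ^ 2) ∈ P) := by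
      intro n
      by_cases h2 : 2 < |tr (g ^ n * h)|
      · obtain ⟨L, p', q', hL1, hpq', hp', hq'⟩ := hyper_eig h2
        refine ⟨L, fun _ => ⟨hL1, ?_, ?_⟩⟩
        · rw [tr_basis hpq', hp', hq', dt_smul, dt_smul', hpq']; ring
        · exact hP2 _ (Submonoid.mul_mem _ (Submonoid.pow_mem _ hg n) hh) L p' q' hL1 hpq' hp' hq'
      · exact ⟨0, fun h => absurd h h2⟩
    choose L hL using hL
    have hY : Tendsto (fun n => L n * (l⁻¹) ^ n) atTop (𝓝 a) := by
      have h1 : Tendsto (fun n => a + (l⁻¹) ^ n * ((l⁻¹) ^ n * d) - (L n)⁻¹ * (l⁻¹) ^ n) atTop (𝓝 (a - 0)) := by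
        refine hTn.sub ?_
        have : Tendsto (fun n : ℕ => |(l⁻¹) ^ n|) atTop (𝓝 0) := by simpa using hpow.abs
        apply squeeze_zero_norm' _ this
        filter_upwards [hev] with n hn
        rw [norm_mul, Real.norm_eq_abs, Real.norm_eq_abs, abs_inv]
        have : |L n|⁻¹ ≤ 1 := inv_le_one_of_one_le₀ (hL n hn).1.le
        exact mul_le_of_le_one_left (abs_nonneg _) this
      rw [sub_zero] at h1
      refine h1.congr' ?_
      filter_upwards [hev] with n hn
      have := (hL n hn).2.1
      rw [htr] at this
      have e2 : l ^ n * (l⁻¹) ^ n = 1 := by rw [← mul_pow, mul_inv_cancel₀ hl0, one_pow]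
      linear_combination (-(l⁻¹) ^ n) * this - a * e2
    have hx : Tendsto (fun n => Real.log ((L n * (l⁻¹) ^ n) ^ 2)) atTop (𝓝 (Real.log (a ^ 2))) :=
      (hY.pow 2).log (pow_ne_zero 2 ha)
    have hxP : ∀ᶠ n in atTop, Real.log ((L n * (l⁻¹) ^ n) ^ 2) ∈ P := by
      filter_upwards [hev] with n hn
      have hLn : L n ≠ 0 := by intro h0; have := (hL n hn).1; rw [h0] at this; simp at this; linarith
      have e3 : Real.log ((L n * (l⁻¹) ^ n) ^ 2) = Real.log (L n ^ 2) - n • Real.log (l ^ 2) := by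
        rw [mul_pow, Real.log_mul (by positivity) (by positivity), ← pow_mul, mul_comm n 2, pow_mul, Real.log_pow (l⁻¹ ^ 2) n, inv_pow, Real.log_inv, nsmul_eq_mul]
        ring
      rw [e3]
      exact P.sub_mem (hL n hn).2.2 (P.nsmul_mem (hP2 g hg l p q hl hpq hp hq) n)
    have hnear : ∀ᶠ n in atTop, |Real.log ((L n * (l⁻¹) ^ n) ^ 2) - Real.log (a ^ 2)| < |c| / 2 := by
      have := Metric.tendsto_nhds.1 hx (|c| / 2) (by positivity)
      simpa only [Real.dist_eq] using this
    have hconst : ∀ᶠ n in atTop, Real.log ((L n * (l⁻¹) ^ n) ^ 2) = Real.log (a ^ 2) := by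
      obtain ⟨N, hN⟩ := eventually_atTop.1 (hnear.and hxP)
      have hcc : ∀ n ≥ N, Real.log ((L n * (l⁻¹) ^ n) ^ 2) = Real.log ((L N * (l⁻¹) ^ N) ^ 2) := by
        intro n hn
        have h1 := hN n hn
        have h2 := hN N le_rfl
        apply sub_eq_zero.1
        apply hPc _ (P.sub_mem h1.2 h2.2)
        have h3 := abs_lt.1 h1.1
        have h4 := abs_lt.1 h2.1
        rw [abs_lt]; constructor <;> linarith [h3.1, h3.2, h4.1, h4.2]
      have hlim : Real.log (a ^ 2) = Real.log ((L N * (l⁻¹) ^ N) ^ 2) := by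
        refine tendsto_nhds_unique hx (tendsto_const_nhds.congr' ?_)
        filter_upwards [eventually_ge_atTop N] with n hn
        exact (hcc n hn).symm
      filter_upwards [eventually_ge_atTop N] with n hn
      rw [hcc n hn, hlim]
    have hYa : ∀ᶠ n in atTop, |L n * (l⁻¹) ^ n - a| < |a| := by
      have := Metric.tendsto_nhds.1 hY |a| (abs_pos.2 ha)
      simpa only [Real.dist_eq] using this
    obtain ⟨n, hn1, hn2, hn3⟩ := (hconst.and (hYa.and hev)).exists
    have hLn := hL n hn3
    have hLn0 : L n ≠ 0 := by intro h0; have := hLn.1; rw [h0] at this; simp at this; linarith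
    have e4 : (L n * (l⁻¹) ^ n) ^ 2 = a ^ 2 := Real.log_injOn_pos (by simp; positivity) (by simp; positivity) hn1
    have e5 : L n * (l⁻¹) ^ n = a := by
      rcases sq_eq_sq_iff_eq_or_eq_neg.1 e4 with h1 | h1
      · exact h1
      · exfalso
        rw [h1] at hn2
        have : |-a - a| = 2 * |a| := by rw [show -a - a = (-2) * a by ring, abs_mul]; norm_num
        rw [this] at hn2
        linarith [abs_nonneg a]
    have e2 : l ^ n * (l⁻¹) ^ n = 1 := by rw [← mul_pow, mul_inv_cancel₀ hl0, one_pow]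
    have e6 : a * d = 1 := by
      have h1 := hLn.2.1
      rw [htr] at h1
      have h2 : L n = l ^ n * a := by linear_combination (l ^ n) * e5 - (L n) * e2
      have h3 : (L n)⁻¹ = (l⁻¹) ^ n * d := by linear_combination h1 - h2
      have h4 : L n * (L n)⁻¹ = 1 := mul_inv_cancel₀ hLn0
      rw [h3] at h4
      linear_combination h4 - d * e5
    have := det_basis hpq h
    linear_combination e6 - this
  obtain ⟨γ, hγ, hb, ha⟩ := move_pair hA (p := p) (q := q) (by rw [hpq]; exact one_ne_zero)
  obtain ⟨h, hh, hc'⟩ := N1 hA hq0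
  have hh' : h ∈ Submonoid.closure A := Submonoid.subset_closure hh
  have m1 := dt_mul_basis hpq p γ h
  have m2 := dt_mul_basis hpq q γ h
  have m3 := dt_mul_basis hpq p h γ
  have m4 := dt_mul_basis hpq q h γ
  have m5 := dt_mul_basis hpq p γ (γ * h)
  have m6 := dt_mul_basis hpq q γ (γ * h)
  have s1 := star γ hγ
  have s2 := star h hh'
  have s3 := star (γ * h) (Submonoid.mul_mem _ hγ hh')
  have s4 := star (h * γ) (Submonoid.mul_mem _ hh' hγ)
  have s5 := star (γ * (γ * h)) (Submonoid.mul_mem _ hγ (Submonoid.mul_mem _ hγ hh'))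
  have d1 := det_basis hpq γ
  have d2 := det_basis hpq h
  rw [m5.1, m5.2, m6.1, m1.1, m1.2, m2.1, m2.2] at s5
  rw [m1.1, m1.2, m2.1] at s3
  rw [m3.1, m3.2, m4.1] at s4
  rw [dt_comm] at ha hc'
  rw [neg_ne_zero] at ha hc'
  generalize dt (ra p γ) q = a at *
  generalize dt p (ra p γ) = b at *
  generalize dt (ra q γ) q = c1 at *
  generalize dt p (ra q γ) = d at *
  generalize dt (ra p h) q = a' at *
  generalize dt p (ra p h) = b' at *
  generalize dt (ra q h) q = c' at *
  generalize dt p (ra q h) = d' at *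
  clear m1 m2 m3 m4 m5 m6
  have hc1 : c1 = 0 := by
    rcases mul_eq_zero.1 (s1 ha) with h1 | h1
    · exact absurd h1 hb
    · exact h1
  subst hc1
  have had : a * d = 1 := by linear_combination d1
  have hd : d ≠ 0 := by rintro rfl; simp at had
  simp only [zero_mul, mul_zero, zero_add, add_zero] at s3 s4 s5
  by_cases ha' : a' = 0
  · subst ha'
    have hbc : b' * c' = -1 := by linear_combination -d2
    have hb' : b' ≠ 0 := by rintro rfl; simp at hbc
    simp only [mul_zero, zero_add] at s3 s5
    have t1 := s3 (mul_ne_zero hb hc')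
    have t2 : a * b' + b * d' = 0 := by
      rcases mul_eq_zero.1 t1 with h1 | h1
      · exact h1
      · exact absurd h1 (mul_ne_zero hd hc')
    have t3 : a + d ≠ 0 := by
      intro h0
      have : d = -a := by linarith
      rw [this] at had; nlinarith [sq_nonneg a]
    have t4 := s5 (by
      have : a * (b * c') + b * (d * c') = b * (a + d) * c' := by ring
      rw [this]; exact mul_ne_zero (mul_ne_zero hb t3) hc')
    rcases mul_eq_zero.1 t4 with h1 | h1
    · have : b' = 0 := by
        have : b' * (a * d) = 0 := by linear_combination (-1 : ℝ) * h1 + (a + d) * t2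
        rwa [had, mul_one] at this
      exact hb' this
    · exact mul_ne_zero hd (mul_ne_zero hd hc') h1
  · have hb' : b' = 0 := by
      rcases mul_eq_zero.1 (s2 ha') with h1 | h1
      · exact h1
      · exact absurd h1 hc'
    subst hb'
    simp only [zero_mul, add_zero] at s4
    have t1 := s4 (mul_ne_zero ha' ha)
    rcases mul_eq_zero.1 t1 with h1 | h1
    · exact mul_ne_zero ha' hb h1
    · exact mul_ne_zero hc' ha h1

section
variable {μ : Measure SL2} [IsProbabilityMeasure μ] {H : ℂ → ℝ}

theorem tendsto_smul0 {t : ℝ} (ht : 0 < t) : Tendsto (fun u : ℂ => (t : ℂ) * u) (𝓝[≠] 0) (𝓝[≠] 0) := by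
  refine tendsto_nhdsWithin_iff.2 ⟨?_, ?_⟩
  · have : Continuous (fun u : ℂ => (t : ℂ) * u) := by fun_prop
    have := this.tendsto 0
    simp only [mul_zero] at this
    exact this.mono_left nhdsWithin_le_nhds
  · filter_upwards [eventually_mem_nhdsWithin] with u hu
    exact smul_ne ht hu

def Per (H : ℂ → ℝ) : AddSubgroup ℝ where
  carrier := {a | Tendsto (DD H (Real.exp a)) (𝓝[≠] (0 : ℂ)) (𝓝 0)}
  zero_mem' := by
    have : DD H (Real.exp 0) = fun _ => 0 := by funext u; simp [DD]
    rw [Set.mem_ofPred_eq, this]; exact tendsto_const_nhds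
  add_mem' := by
    intro a b ha hb
    rw [Set.mem_ofPred_eq] at *
    have h1 := ha.add (hb.comp (tendsto_smul0 (Real.exp_pos a)))
    rw [add_zero] at h1
    refine h1.congr fun u => ?_
    simp only [DD, Function.comp]
    rw [Real.exp_add, mul_comm (Real.exp a), ← mul_assoc]; push_cast; ring
  neg_mem' := by
    intro a ha
    rw [Set.mem_ofPred_eq] at *
    have h1 := (ha.comp (tendsto_smul0 (Real.exp_pos (-a)))).neg
    rw [neg_zero] at h1
    refine h1.congr fun u => ?_
    have : (Real.exp a : ℂ) * ((Real.exp (-a) : ℂ) * u) = u := by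
      rw [← mul_assoc]
      have : Real.exp a * Real.exp (-a) = 1 := by rw [← Real.exp_add]; simp
      rw [← Complex.ofReal_mul, this]; simp
    simp only [DD, Function.comp, this]; ring

theorem NH.renewal (h : NH μ H) (hzd : ¬ IsSolvable (Subgroup.closure (measSupp μ))) {t : ℝ} (ht : 0 < t) :
    Tendsto (DD H t) (𝓝[≠] (0 : ℂ)) (𝓝 0) := by
  have hd : Dense (Per H : Set ℝ) := nonarith hzd (Per H) (by
    intro g hg l p q hl hpq hp hq
    have := h.period hzd hg hl hpq hp hq
    show Tendsto (DD H (Real.exp (Real.log l))) (𝓝[≠] (0 : ℂ)) (𝓝 0)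
    rwa [Real.exp_log (by linarith)])
  rw [Metric.tendsto_nhds]
  intro η hη
  obtain ⟨δ, hδ, hec⟩ := h.ec (η / 2) (by positivity)
  have hc : Continuous (fun a : ℝ => |t - Real.exp a|) := by fun_prop
  have hopen : IsOpen {a : ℝ | |t - Real.exp a| < δ * t} := isOpen_lt hc continuous_const
  obtain ⟨a, ha1, ha2⟩ := hd.exists_mem_open hopen ⟨Real.log t, by
    simp only [Set.mem_ofPred_eq, Real.exp_log ht, sub_self, abs_zero]; positivity⟩
  have ha1' : Tendsto (DD H (Real.exp a)) (𝓝[≠] (0 : ℂ)) (𝓝 0) := by first | exact ha1 | exact ha2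
  have ha2' : |t - Real.exp a| < δ * t := by first | exact ha2 | exact ha1
  filter_upwards [Metric.tendsto_nhds.1 ha1' (η / 2) (by positivity), eventually_mem_nhdsWithin] with u hu hu0
  have hu0' : u ≠ 0 := hu0
  have h1 := hec (t * u) (Real.exp a * u) (smul_ne ht hu0') (smul_ne (Real.exp_pos a) hu0') (by
    rw [← sub_mul, ← Complex.ofReal_sub, norm_mul, Complex.norm_real, Real.norm_eq_abs, norm_smul_r ht]
    have := norm_nonneg u
    calc _ ≤ δ * t * ‖u‖ := by gcongr
      _ = _ := by ring)
  rw [Real.dist_eq, sub_zero] at *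
  unfold DD at *
  have := abs_lt.1 hu
  have := abs_le.1 h1
  rw [abs_lt]
  constructor <;> linarith

end

end

section

open scoped ENNReal NNReal Topology

section
variable {μ : Measure SL2} [IsProbabilityMeasure μ] {ε C M : ℝ}

theorem Gr_eq : Gr μ = Measure.dirac 1 + (μ.prod (Gr μ)).map (fun p => p.1 * p.2) := by
  ext s hs
  have hm : Measurable (fun p : SL2 × SL2 => p.1 * p.2) := by fun_prop
  have h := lintegral_Gr_step (μ := μ) (s.indicator 1) (measurable_one.indicator hs)
  rw [lintegral_indicator_one hs] at h
  rw [h, Measure.add_apply, Measure.dirac_apply' _ hs]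
  congr 1
  rw [← lintegral_indicator_one hs, lintegral_map (measurable_one.indicator hs) hm, lintegral_prod]
  exact ((measurable_one.indicator hs).comp hm).aemeasurable

structure TF (F : ℂ → ℝ) (r B K : ℝ) : Prop where
  cont : Continuous F
  r0 : 0 < r
  B0 : 0 < B
  K0 : 0 < K
  bdd : ∀ u, |F u| ≤ K
  supp : ∀ u, F u ≠ 0 → u ∈ bandS r B

def GF (μ : Measure SL2) (F : ℂ → ℝ) (u : ℂ) : ℝ := ∫ g, F (ra u g) ∂(Gr μ)

variable {F : ℂ → ℝ} {r B K : ℝ}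

theorem TF.zero (hF : TF F r B K) : F 0 = 0 := by
  by_contra h
  have := (hF.supp 0 h).1
  rw [norm_zero] at this
  linarith [hF.r0]

theorem TF.le_ind (hF : TF F r B K) (u : ℂ) : ENNReal.ofReal |F u| ≤ ENNReal.ofReal K * (bandS r B).indicator 1 u := by
  by_cases hu : u ∈ bandS r B
  · rw [Set.indicator_of_mem hu, Pi.one_apply, mul_one]; exact ENNReal.ofReal_le_ofReal (hF.bdd u)
  · have : F u = 0 := by by_contra h; exact hu (hF.supp u h)
    simp [this]

theorem ra_zero (g : SL2) : ra 0 g = 0 := by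
  have := ra_smul 0 0 g; simpa using this

theorem TF.lint (hF : TF F r B K) (hC : Contr μ ε C M) {u : ℂ} (hu : u ≠ 0) :
    ∫⁻ g, ENNReal.ofReal |F (ra u g)| ∂(Gr μ) ≤ ENNReal.ofReal (K * (C * B ^ ε)) := by
  have hm := measurable_band_ind r B
  calc _ ≤ ∫⁻ g, ENNReal.ofReal K * (bandS r B).indicator 1 (ra u g) ∂(Gr μ) := lintegral_mono fun g => hF.le_ind _
    _ = ENNReal.ofReal K * ∫⁻ g, (bandS r B).indicator 1 (ra u g) ∂(Gr μ) := lintegral_const_mul _ (by fun_prop)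
    _ ≤ ENNReal.ofReal K * ENNReal.ofReal (C * B ^ ε) := mul_le_mul_right (green_band hC hF.r0 hF.B0 hu) _
    _ = _ := by rw [ENNReal.ofReal_mul hF.K0.le]

theorem TF.meas (hF : TF F r B K) (u : ℂ) : Measurable (fun g : SL2 => F (ra u g)) := by
  have := hF.cont.measurable
  fun_prop

theorem TF.int (hF : TF F r B K) (hC : Contr μ ε C M) (u : ℂ) : Integrable (fun g => F (ra u g)) (Gr μ) := by
  by_cases hu : u = 0
  · subst hu
    simp only [ra_zero, hF.zero]
    exact integrable_zero _ _ _
  · refine ⟨(hF.meas u).aestronglyMeasurable, ?_⟩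
    rw [hasFiniteIntegral_iff_norm]
    refine lt_of_le_of_lt ?_ (ENNReal.ofReal_lt_top (r := K * (C * B ^ ε)))
    simpa only [Real.norm_eq_abs] using hF.lint hC hu

theorem TF.GF_bdd (hF : TF F r B K) (hC : Contr μ ε C M) (u : ℂ) : |GF μ F u| ≤ K * (C * B ^ ε) := by
  have hC0 : 0 < C := lt_of_lt_of_le one_pos hC.C1
  have hB := hF.B0
  have hK := hF.K0
  by_cases hu : u = 0
  · subst hu
    simp only [GF, ra_zero, hF.zero, integral_zero, abs_zero]
    positivity
  · have h1 := norm_integral_le_lintegral_norm (μ := Gr μ) (fun g => F (ra u g))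
    simp only [Real.norm_eq_abs] at h1
    refine h1.trans ?_
    refine ENNReal.toReal_le_of_le_ofReal (by positivity) (hF.lint hC hu)

theorem TF.GF_meas (hF : TF F r B K) : Measurable (GF μ F) := by
  have hm := hF.cont.measurable
  have : Measurable (fun p : ℂ × SL2 => F (ra p.1 p.2)) := by fun_prop
  exact (this.stronglyMeasurable.integral_prod_right').measurable

theorem TF.GF_harm (hF : TF F r B K) (hC : Contr μ ε C M) {u : ℂ} (hu : u ≠ 0) :
    GF μ F u = F u + ∫ g, GF μ F (ra u g) ∂μ := by
  have hm : Measurable (fun p : SL2 × SL2 => p.1 * p.2) := by fun_prop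
  have hi := hF.int hC u
  have hi2 := hi
  rw [Gr_eq] at hi2
  have hia := hi2.left_of_add_measure
  have hib := hi2.right_of_add_measure
  have hib' := (integrable_map_measure (hF.meas u).aestronglyMeasurable hm.aemeasurable).1 hib
  have hib2 : Integrable (fun p : SL2 × SL2 => F (ra u (p.1 * p.2))) (μ.prod (Gr μ)) := hib'
  rw [GF, Gr_eq, integral_add_measure hia hib, integral_dirac, ra_one, integral_map hm.aemeasurable (hF.meas u).aestronglyMeasurable,
    integral_prod _ hib2]
  congr 1
  simp only [ra_mul, GF]

theorem TF.unif (hF : TF F r B K) {η : ℝ} (hη : 0 < η) : ∃ δ : ℝ, 0 < δ ∧ ∀ x y : ℂ, ‖x - y‖ < δ → |F x - F y| < η := by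
  have hcs : HasCompactSupport F := by
    refine HasCompactSupport.intro (isCompact_closedBall (0 : ℂ) (B * r)) fun x hx => ?_
    by_contra h
    apply hx
    simpa using (hF.supp x h).2
  have := hcs.uniformContinuous_of_continuous hF.cont
  obtain ⟨δ, hδ, h⟩ := Metric.uniformContinuous_iff.1 this η hη
  refine ⟨δ, hδ, fun x y hxy => ?_⟩
  rw [← Real.dist_eq]
  exact h (by rwa [dist_eq_norm])

theorem TF.pt (hF : TF F r B K) {κ η δ : ℝ} (hκ : 0 < κ) (hη : 0 < η) (hδ : 0 < δ) (hu : ∀ x y : ℂ, ‖x - y‖ < δ → |F x - F y| < η) (x y : ℂ) :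
    ENNReal.ofReal |F x - F y| ≤ ENNReal.ofReal η * (bandS r B).indicator 1 x + ENNReal.ofReal η * (bandS r B).indicator 1 y +
     (ENNReal.ofReal (2 * K / δ ^ κ) * (ENNReal.ofReal (‖x - y‖ ^ κ) * (bandS r B).indicator 1 x) +
      ENNReal.ofReal (2 * K / δ ^ κ) * (ENNReal.ofReal (‖x - y‖ ^ κ) * (bandS r B).indicator 1 y)) := by
  have hK := hF.K0
  have key : ENNReal.ofReal |F x - F y| ≤ ENNReal.ofReal η + ENNReal.ofReal (2 * K / δ ^ κ) * ENNReal.ofReal (‖x - y‖ ^ κ) := by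
    by_cases h : ‖x - y‖ < δ
    · exact (ENNReal.ofReal_le_ofReal (hu x y h).le).trans le_self_add
    · refine le_trans ?_ le_add_self
      rw [← ENNReal.ofReal_mul (by positivity)]
      apply ENNReal.ofReal_le_ofReal
      have h1 : δ ^ κ ≤ ‖x - y‖ ^ κ := Real.rpow_le_rpow hδ.le (not_lt.1 h) hκ.le
      have h2 : |F x - F y| ≤ 2 * K := by
        have := abs_sub (F x) (F y)
        linarith [hF.bdd x, hF.bdd y]
      refine h2.trans ?_
      rw [div_mul_eq_mul_div, le_div_iff₀ (by positivity)]
      gcongr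
  by_cases hx : x ∈ bandS r B
  · rw [Set.indicator_of_mem hx, Pi.one_apply, mul_one, mul_one]
    refine key.trans (add_le_add le_self_add le_self_add)
  · by_cases hy : y ∈ bandS r B
    · rw [Set.indicator_of_mem hy, Pi.one_apply, mul_one, mul_one]
      refine key.trans (add_le_add le_add_self le_add_self)
    · have h1 : F x = 0 := by by_contra h; exact hx (hF.supp x h)
      have h2 : F y = 0 := by by_contra h; exact hy (hF.supp y h)
      simp [h1, h2]

theorem TF.GF_ec (hF : TF F r B K) (hC : Contr μ ε C M) (η : ℝ) (hη : 0 < η) :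
    ∃ δ : ℝ, 0 < δ ∧ ∀ u v : ℂ, u ≠ 0 → v ≠ 0 → ‖u - v‖ ≤ δ * ‖u‖ → |GF μ F u - GF μ F v| ≤ η := by
  have hC0 : 0 < C := lt_of_lt_of_le one_pos hC.C1
  have hB := hF.B0
  have hK := hF.K0
  obtain ⟨C', hC', hec⟩ := ec_lint hC hF.r0 hF.B0
  generalize hκ : ε / 2 = κ at hec
  have hκ0 : 0 < κ := by rw [← hκ]; have := hC.pos; positivity
  have hgb : ∀ u : ℂ, u ≠ 0 → ∫⁻ g, (bandS r B).indicator 1 (ra u g) ∂(Gr μ) ≤ ENNReal.ofReal (C * B ^ ε) := fun u hu => green_band hC hF.r0 hF.B0 hu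
  generalize hCb : C * B ^ ε = Cb at hgb
  have hCb0 : 0 < Cb := by rw [← hCb]; positivity
  set η' := η / (4 * Cb) with hη'
  have hη'0 : 0 < η' := by positivity
  obtain ⟨δ', hδ', hun⟩ := hF.unif hη'0
  set c2 := 2 * K / δ' ^ κ with hc2
  have hc20 : 0 < c2 := by positivity
  set θ := η / (4 * c2 * C') with hθ
  have hθ0 : 0 < θ := by positivity
  set δ := min (1 / 2) (θ ^ (1 / κ) / 2) with hδ
  have hδ0 : 0 < δ := by positivity
  refine ⟨δ, hδ0, fun u v hu hv huv => ?_⟩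
  have hbm := measurable_band_ind r B
  have hun0 : 0 < ‖u‖ := norm_pos_iff.2 hu
  have hvn0 : 0 < ‖v‖ := norm_pos_iff.2 hv
  have h2δ : (2 * δ) ^ κ ≤ θ := by
    calc (2 * δ) ^ κ ≤ (θ ^ (1 / κ)) ^ κ := by
          apply Real.rpow_le_rpow (by positivity) _ hκ0.le
          have := min_le_right (1 / 2 : ℝ) (θ ^ (1 / κ) / 2)
          rw [← hδ] at this; linarith
      _ = θ := by rw [← Real.rpow_mul hθ0.le]; simp [hκ0.ne']
  have hvu : ‖u‖ / 2 ≤ ‖v‖ := by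
    have h1 := norm_sub_norm_le u v
    have h2 : δ ≤ 1 / 2 := min_le_left _ _
    nlinarith
  have hwu : (‖u - v‖ / ‖u‖) ^ κ ≤ θ := by
    refine le_trans (Real.rpow_le_rpow (by positivity) ?_ hκ0.le) h2δ
    rw [div_le_iff₀ hun0]; nlinarith
  have hwv : (‖u - v‖ / ‖v‖) ^ κ ≤ θ := by
    refine le_trans (Real.rpow_le_rpow (by positivity) ?_ hκ0.le) h2δ
    rw [div_le_iff₀ hvn0]; nlinarith
  have e1 : GF μ F u - GF μ F v = ∫ g, (F (ra u g) - F (ra v g)) ∂(Gr μ) :=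
    (integral_sub (hF.int hC u) (hF.int hC v)).symm
  have h1 := norm_integral_le_lintegral_norm (μ := Gr μ) (fun g => F (ra u g) - F (ra v g))
  simp only [Real.norm_eq_abs] at h1
  rw [e1]
  refine h1.trans (ENNReal.toReal_le_of_le_ofReal hη.le ?_)
  have m1 : Measurable (fun g : SL2 => (bandS r B).indicator (1 : ℂ → ℝ≥0∞) (ra u g)) := by fun_prop
  have m2 : Measurable (fun g : SL2 => (bandS r B).indicator (1 : ℂ → ℝ≥0∞) (ra v g)) := by fun_prop
  have m3 : Measurable (fun g : SL2 => ENNReal.ofReal (‖ra (u - v) g‖ ^ κ)) := by fun_prop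
  have m12 : Measurable (fun g : SL2 => ENNReal.ofReal η' * (bandS r B).indicator (1 : ℂ → ℝ≥0∞) (ra u g) + ENNReal.ofReal η' * (bandS r B).indicator (1 : ℂ → ℝ≥0∞) (ra v g)) := by fun_prop
  have m31 : Measurable (fun g : SL2 => ENNReal.ofReal (‖ra (u - v) g‖ ^ κ) * (bandS r B).indicator (1 : ℂ → ℝ≥0∞) (ra u g)) := by fun_prop
  have m32 : Measurable (fun g : SL2 => ENNReal.ofReal (‖ra (u - v) g‖ ^ κ) * (bandS r B).indicator (1 : ℂ → ℝ≥0∞) (ra v g)) := by fun_prop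
  calc _ ≤ ∫⁻ g, (ENNReal.ofReal η' * (bandS r B).indicator 1 (ra u g) + ENNReal.ofReal η' * (bandS r B).indicator 1 (ra v g) +
     (ENNReal.ofReal c2 * (ENNReal.ofReal (‖ra (u - v) g‖ ^ κ) * (bandS r B).indicator 1 (ra u g)) +
      ENNReal.ofReal c2 * (ENNReal.ofReal (‖ra (u - v) g‖ ^ κ) * (bandS r B).indicator 1 (ra v g)))) ∂(Gr μ) := by
        refine lintegral_mono fun g => ?_
        simp only [ra_sub]
        exact hF.pt hκ0 hη'0 hδ' hun _ _
    _ = ENNReal.ofReal η' * ∫⁻ g, (bandS r B).indicator 1 (ra u g) ∂(Gr μ) + ENNReal.ofReal η' * ∫⁻ g, (bandS r B).indicator 1 (ra v g) ∂(Gr μ) +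
     (ENNReal.ofReal c2 * ∫⁻ g, ENNReal.ofReal (‖ra (u - v) g‖ ^ κ) * (bandS r B).indicator 1 (ra u g) ∂(Gr μ) +
      ENNReal.ofReal c2 * ∫⁻ g, ENNReal.ofReal (‖ra (u - v) g‖ ^ κ) * (bandS r B).indicator 1 (ra v g) ∂(Gr μ)) := by
        rw [lintegral_add_left m12, lintegral_add_left (m1.const_mul _), lintegral_add_left (m31.const_mul _),
          lintegral_const_mul _ m1, lintegral_const_mul _ m2, lintegral_const_mul _ m31, lintegral_const_mul _ m32]
    _ ≤ ENNReal.ofReal η' * ENNReal.ofReal Cb + ENNReal.ofReal η' * ENNReal.ofReal Cb +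
      (ENNReal.ofReal c2 * ENNReal.ofReal (C' * θ) + ENNReal.ofReal c2 * ENNReal.ofReal (C' * θ)) := by
        refine add_le_add (add_le_add (mul_le_mul_right (hgb u hu) _) (mul_le_mul_right (hgb v hv) _))
          (add_le_add (mul_le_mul_right ((hec u _ hu).trans ?_) _) (mul_le_mul_right ((hec v _ hv).trans ?_) _))
        · exact ENNReal.ofReal_le_ofReal (mul_le_mul_of_nonneg_left hwu hC'.le)
        · exact ENNReal.ofReal_le_ofReal (mul_le_mul_of_nonneg_left hwv hC'.le)
    _ = ENNReal.ofReal η := by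
        rw [← ENNReal.ofReal_mul (by positivity), ← ENNReal.ofReal_mul (by positivity), ← ENNReal.ofReal_add (by positivity) (by positivity),
          ← ENNReal.ofReal_add (by positivity) (by positivity), ← ENNReal.ofReal_add (by positivity) (by positivity)]
        congr 1
        rw [hη', hθ]; field_simp; ring

theorem TF.GF_NH (hF : TF F r B K) (hC : Contr μ ε C M) : NH μ (GF μ F) := by
  have hC0 : 0 < C := lt_of_lt_of_le one_pos hC.C1
  have hB := hF.B0
  have hK := hF.K0
  refine ⟨hF.GF_meas, ⟨K * (C * B ^ ε), by positivity, hF.GF_bdd hC⟩, hF.GF_ec hC, ⟨r, hF.r0, fun u hu hur => ?_⟩⟩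
  rw [hF.GF_harm hC hu]
  have : F u = 0 := by
    by_contra h
    have := (hF.supp u h).1
    linarith
  rw [this, zero_add]

end

end

section

open scoped ENNReal NNReal Topology

section
variable {μ : Measure SL2} {ν : Measure ℂ} [IsProbabilityMeasure μ] [IsProbabilityMeasure ν] {ε C M : ℝ}

theorem Setup.stat_int (hS : Setup μ ν) (φ : ℂ → ℂ) (hφ : Measurable φ) (hb : ∀ x, ‖φ x‖ ≤ 1)
    (hh : ∀ (c : ℝ) (x : ℂ), c ≠ 0 → φ (c * x) = φ x) :
    ∫ x, φ x ∂ν = ∫ g, ∫ x, φ (ca g x) ∂ν ∂μ := by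
  have hm : Measurable (fun p : SL2 × ℂ => φ (ca p.1 p.2)) := by fun_prop
  have e : ν.map φ = (μ.prod ν).map (fun p => φ (ca p.1 p.2)) := by
    ext s hs
    rw [← lintegral_indicator_one hs, ← lintegral_indicator_one hs, lintegral_map (measurable_one.indicator hs) hφ,
      lintegral_map (measurable_one.indicator hs) hm, lintegral_prod (fun p : SL2 × ℂ => s.indicator 1 (φ (ca p.1 p.2))) ((measurable_one.indicator hs).comp hm).aemeasurable]
    refine hS.stat (fun x => s.indicator 1 (φ x)) ((measurable_one.indicator hs).comp hφ) ?_
    intro c x hc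
    simp only [hh c x hc]
  have h1 : ∫ x, φ x ∂ν = ∫ z, z ∂(ν.map φ) := (integral_map (f := fun z : ℂ => z) hφ.aemeasurable measurable_id.aestronglyMeasurable).symm
  have h2 : ∫ z, z ∂((μ.prod ν).map (fun p => φ (ca p.1 p.2))) = ∫ p, φ (ca p.1 p.2) ∂(μ.prod ν) :=
    integral_map (f := fun z : ℂ => z) hm.aemeasurable measurable_id.aestronglyMeasurable
  have hi : Integrable (fun p : SL2 × ℂ => φ (ca p.1 p.2)) (μ.prod ν) :=
    Integrable.of_bound hm.aestronglyMeasurable 1 (Eventually.of_forall fun p => hb _)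
  rw [h1, e, h2, integral_prod _ hi]

def Wf (ν : Measure ℂ) (φ : ℂ → ℂ) (g : SL2) : ℝ≥0∞ := ‖∫ x, φ (ca g x) ∂ν‖ₑ

theorem Wf_meas {φ : ℂ → ℂ} (hφ : Measurable φ) : Measurable (Wf ν φ) := by
  have hm : Measurable (fun p : SL2 × ℂ => φ (ca p.1 p.2)) := by fun_prop
  exact (hm.stronglyMeasurable.integral_prod_right').measurable.enorm

theorem Wf_le {φ : ℂ → ℂ} (hb : ∀ x, ‖φ x‖ ≤ 1) (g : SL2) : Wf ν φ g ≤ 1 := by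
  refine (enorm_integral_le_lintegral_enorm _).trans ?_
  calc _ ≤ ∫⁻ x, 1 ∂ν := lintegral_mono fun x => by
        rw [← ofReal_norm_eq_enorm]
        exact (ENNReal.ofReal_le_ofReal (hb _)).trans (by simp)
    _ = 1 := by simp

theorem Wf_sub (hS : Setup μ ν) (φ : ℂ → ℂ) (hφ : Measurable φ) (hb : ∀ x, ‖φ x‖ ≤ 1)
    (hh : ∀ (c : ℝ) (x : ℂ), c ≠ 0 → φ (c * x) = φ x) (g : SL2) :
    Wf ν φ g ≤ ∫⁻ h, Wf ν φ (g * h) ∂μ := by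
  have := hS.stat_int (fun x => φ (ca g x)) (by fun_prop) (fun x => hb _) (fun c x hc => by rw [ca_smul, hh c _ hc])
  unfold Wf
  rw [this]
  refine (enorm_integral_le_lintegral_enorm _).trans (le_of_eq ?_)
  simp only [ca_mul]

/-- phase -/
def Ph (u x : ℂ) : ℝ := dt u x / (‖u‖ ^ 2 * pr u x)

theorem Ph_sub {u x y : ℂ} (hu : u ≠ 0) (hx : pr u x ≠ 0) (hy : pr u y ≠ 0) :
    Ph u x - Ph u y = - (dt x y / (pr u x * pr u y)) := by
  have hn : ‖u‖ ^ 2 ≠ 0 := by positivity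
  have key : dt u x * pr u y - dt u y * pr u x = - (‖u‖ ^ 2 * dt x y) := by
    rw [normsq]; simp only [dt, pr]; ring
  unfold Ph
  field_simp
  linear_combination key

theorem Ph_ca {u : ℂ} (hu : u ≠ 0) (g : SL2) : ∃ c : ℝ, ∀ x, pr (ra u g) x ≠ 0 → Ph u (ca g x) = Ph (ra u g) x + c := by
  have hu' := ra_ne_zero hu g
  by_cases h : ∃ y, pr (ra u g) y ≠ 0
  · obtain ⟨y, hy⟩ := h
    refine ⟨Ph u (ca g y) - Ph (ra u g) y, fun x hx => ?_⟩
    have h1 := Ph_sub hu' hx hy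
    have h2 := Ph_sub hu (x := ca g x) (y := ca g y) (by rwa [← pr_ra]) (by rwa [← pr_ra])
    rw [dt_ca, ← pr_ra, ← pr_ra] at h2
    linarith
  · push Not at h
    exact ⟨0, fun x hx => absurd (h x) hx⟩

def eP (u x : ℂ) : ℂ := Complex.exp ((Ph u x : ℝ) * Complex.I)

theorem norm_eP (u x : ℂ) : ‖eP u x‖ = 1 := Complex.norm_exp_ofReal_mul_I _

@[fun_prop] theorem Measurable.eP {α : Type*} [MeasurableSpace α] {u : α → ℂ} {g : α → ℂ}
    (hu : Measurable u) (hg : Measurable g) : Measurable (fun a => _root_.eP (u a) (g a)) := by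
  unfold _root_.eP Ph; fun_prop

def psi (ν : Measure ℂ) (u : ℂ) : ℝ := ‖∫ x, eP u x ∂ν‖

theorem psi_nonneg (u : ℂ) : 0 ≤ psi ν u := norm_nonneg _

theorem psi_le_one (u : ℂ) : psi ν u ≤ 1 := by
  refine (norm_integral_le_integral_norm _).trans ?_
  simp [norm_eP]

theorem Setup.pr_ne (hS : Setup μ ν) {u : ℂ} (hu : u ≠ 0) : ∀ᵐ x ∂ν, pr u x ≠ 0 := by
  have := nonatomic hS hu
  rw [lm] at this
  have h2 : ∀ᵐ x ∂ν, ¬ (|pr u x| ≤ 0 * (‖u‖ * ‖x‖)) := by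
    rw [ae_iff]; simpa only [not_not] using this
  filter_upwards [h2] with x hx h0
  apply hx; simp [h0]

theorem Wf_eP (hS : Setup μ ν) {u : ℂ} (hu : u ≠ 0) (g : SL2) : Wf ν (eP u) g = ENNReal.ofReal (psi ν (ra u g)) := by
  obtain ⟨c, hc⟩ := Ph_ca hu g
  have : ∫ x, eP u (ca g x) ∂ν = ∫ x, eP (ra u g) x * Complex.exp (c * Complex.I) ∂ν := by
    apply integral_congr_ae
    filter_upwards [hS.pr_ne (ra_ne_zero hu g)] with x hx
    simp only [eP]
    rw [hc x hx, ← Complex.exp_add]; push_cast; ring_nf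
  rw [Wf, this, integral_mul_const, ← ofReal_norm_eq_enorm, norm_mul, Complex.norm_exp_ofReal_mul_I, mul_one, psi]

theorem eP_hom (u : ℂ) (c : ℝ) (x : ℂ) (hc : c ≠ 0) : eP u (c * x) = eP u x := by
  unfold eP Ph
  rw [dt_smul', pr_smul', show ‖u‖ ^ 2 * (c * pr u x) = c * (‖u‖ ^ 2 * pr u x) by ring, mul_div_mul_left _ _ hc]

theorem psi_cont (hS : Setup μ ν) {u : ℂ} (hu : u ≠ 0) : ContinuousAt (psi ν) u := by
  refine ContinuousAt.norm ?_
  refine continuousAt_of_dominated (bound := fun _ => 1) ?_ ?_ (integrable_const _) ?_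
  · exact Eventually.of_forall fun v => (by fun_prop : Measurable (fun x => eP v x)).aestronglyMeasurable
  · exact Eventually.of_forall fun v => Eventually.of_forall fun x => (norm_eP v x).le
  · filter_upwards [hS.pr_ne hu] with x hx
    unfold eP Ph
    have h1 : ContinuousAt (fun v => dt v x) u := (by fun_prop : Continuous (fun v => dt v x)).continuousAt
    have h2 : ContinuousAt (fun v => ‖v‖ ^ 2 * pr v x) u := (by fun_prop : Continuous (fun v => ‖v‖ ^ 2 * pr v x)).continuousAt
    have h3 : ContinuousAt (fun v => dt v x / (‖v‖ ^ 2 * pr v x)) u := h1.div h2 (mul_ne_zero (by positivity) hx)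
    have h4 : Continuous (fun r : ℝ => Complex.exp (r * Complex.I)) := by fun_prop
    exact ContinuousAt.comp (f := fun v => dt v x / (‖v‖ ^ 2 * pr v x)) h4.continuousAt h3

theorem psi_sq_eq (u : ℂ) : ((psi ν u ^ 2 : ℝ) : ℂ) = ∫ p : ℂ × ℂ, eP u p.1 * (starRingEnd ℂ) (eP u p.2) ∂(ν.prod ν) := by
  rw [integral_prod_mul (fun x => eP u x) (fun y => (starRingEnd ℂ) (eP u y)), integral_conj, Complex.mul_conj, Complex.normSq_eq_norm_sq, psi]

theorem eP_mul_conj {u x y : ℂ} (hu : u ≠ 0) (hx : pr u x ≠ 0) (hy : pr u y ≠ 0) :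
    eP u x * (starRingEnd ℂ) (eP u y) = Complex.exp (((- (dt x y / (pr u x * pr u y)) : ℝ) : ℂ) * Complex.I) := by
  rw [← Ph_sub hu hx hy, eP, eP, ← Complex.exp_conj, ← Complex.exp_add]
  simp; ring_nf

theorem osc (a : ℝ) : ‖∫ s in (1:ℝ)..2, Complex.exp (((s * a : ℝ) : ℂ) * Complex.I)‖ ≤ min 1 (2 / |a|) ∨ a = 0 := by
  by_cases ha : a = 0
  · exact Or.inr ha
  left
  refine le_min ?_ ?_
  · refine (intervalIntegral.norm_integral_le_of_norm_le_const (C := 1) fun s _ => (Complex.norm_exp_ofReal_mul_I _).le).trans ?_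
    norm_num
  · have hc : (a : ℂ) * Complex.I ≠ 0 := by simp [ha]
    have h := integral_exp_mul_complex (a := 1) (b := 2) hc
    have e : ∀ s : ℝ, ((s * a : ℝ) : ℂ) * Complex.I = (a : ℂ) * Complex.I * s := by intro s; push_cast; ring
    simp only [e]
    rw [h, norm_div]
    have hn : ‖(a : ℂ) * Complex.I‖ = |a| := by simp
    rw [hn]
    gcongr
    refine (norm_sub_le _ _).trans ?_
    rw [← e, ← e, Complex.norm_exp_ofReal_mul_I, Complex.norm_exp_ofReal_mul_I]; norm_num

theorem lm_dt (hS : Setup μ ν) {η : ℝ≥0∞} (hη : 0 < η) : ∃ δ : ℝ, 0 < δ ∧ ∀ y : ℂ, ‖y‖ = 1 → ν {x | |dt x y| ≤ δ} ≤ η := by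
  obtain ⟨δ, hδ, _, h⟩ := lm_unif hS hη
  refine ⟨δ, hδ, fun y hy => ?_⟩
  have hy0 : y ≠ 0 := by intro h; rw [h] at hy; norm_num at hy
  have h1 := h (-Complex.I * y) (by simp [hy0])
  refine le_trans ?_ h1
  unfold lm
  refine measure_mono_ae ?_
  filter_upwards [hS.unit] with x hx
  intro hxd
  have hxd : |dt x y| ≤ δ := hxd
  have e : pr (-Complex.I * y) x = dt x y := by simp [pr, dt]; ring
  change |pr (-Complex.I * y) x| ≤ _
  rw [e, hx, norm_mul, hy]
  simpa using hxd

theorem psi_avg (hS : Setup μ ν) {η : ℝ} (hη : 0 < η) : ∃ ρ : ℝ, 0 < ρ ∧ ∀ u : ℂ, u ≠ 0 → ‖u‖ ≤ ρ →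
    ∫⁻ s in Set.Ioc (1:ℝ) 2, ENNReal.ofReal (psi ν (((s ^ (-(1/2) : ℝ) : ℝ) : ℂ) * u) ^ 2) ≤ ENNReal.ofReal η := by
  obtain ⟨δ, hδ, hl⟩ := lm_dt hS (η := ENNReal.ofReal (η / 2)) (by simpa using hη)
  refine ⟨Real.sqrt (δ * (η / 4)), by positivity, fun u hu hur => ?_⟩
  have hu2 : ‖u‖ ^ 2 ≤ δ * (η / 4) := by
    have := pow_le_pow_left₀ (norm_nonneg u) hur 2
    rwa [Real.sq_sqrt (by positivity)] at this
  set f : ℝ → ℂ × ℂ → ℂ := fun s p => Complex.exp (((s * - (dt p.1 p.2 / (pr u p.1 * pr u p.2)) : ℝ) : ℂ) * Complex.I) with hf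
  have hfm : Measurable (fun q : ℝ × (ℂ × ℂ) => f q.1 q.2) := by
    simp only [hf]
    fun_prop
  have hfi : Integrable (fun q : ℝ × (ℂ × ℂ) => f q.1 q.2) ((volume.restrict (Set.Ioc (1:ℝ) 2)).prod (ν.prod ν)) :=
    Integrable.of_bound hfm.aestronglyMeasurable 1 (Eventually.of_forall fun q => (Complex.norm_exp_ofReal_mul_I _).le)
  have hae : ∀ᵐ p ∂(ν.prod ν), pr u p.1 ≠ 0 ∧ pr u p.2 ≠ 0 := by
    have h1 := hS.pr_ne hu
    exact (Measure.quasiMeasurePreserving_fst.ae h1).and (Measure.quasiMeasurePreserving_snd.ae h1)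
  have hpsi : ∀ s ∈ Set.Ioc (1:ℝ) 2, ((psi ν (((s ^ (-(1/2) : ℝ) : ℝ) : ℂ) * u) ^ 2 : ℝ) : ℂ) = ∫ p, f s p ∂(ν.prod ν) := by
    intro s hs
    have hs0 : 0 < s := lt_trans one_pos hs.1
    set τ := s ^ (-(1/2) : ℝ) with hτ
    have hτ0 : 0 < τ := by positivity
    have hτ2 : τ ^ 2 = s⁻¹ := by
      rw [hτ, ← Real.rpow_natCast, ← Real.rpow_mul hs0.le]; norm_num [Real.rpow_neg_one]
    rw [psi_sq_eq]
    apply integral_congr_ae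
    filter_upwards [hae] with p hp
    have hτu : (τ : ℂ) * u ≠ 0 := mul_ne_zero (by exact_mod_cast hτ0.ne') hu
    rw [eP_mul_conj hτu (by rw [pr_smul]; exact mul_ne_zero hτ0.ne' hp.1) (by rw [pr_smul]; exact mul_ne_zero hτ0.ne' hp.2)]
    simp only [hf]
    congr 3
    rw [pr_smul, pr_smul]
    have h1 := hp.1
    have h2 := hp.2
    have : s = (τ ^ 2)⁻¹ := by rw [hτ2, inv_inv]
    rw [this]
    field_simp
  have hm : Measurable (fun s : ℝ => psi ν (((s ^ (-(1/2) : ℝ) : ℝ) : ℂ) * u) ^ 2) := by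
    have : Measurable (psi ν) := by
      have : Measurable (fun p : ℂ × ℂ => eP p.1 p.2) := by fun_prop
      exact (this.stronglyMeasurable.integral_prod_right').measurable.norm
    fun_prop
  have hintg : Integrable (fun s : ℝ => psi ν (((s ^ (-(1/2) : ℝ) : ℝ) : ℂ) * u) ^ 2) (volume.restrict (Set.Ioc (1:ℝ) 2)) := by
    refine Integrable.of_bound hm.aestronglyMeasurable 1 (Eventually.of_forall fun s => ?_)
    rw [Real.norm_eq_abs, abs_of_nonneg (sq_nonneg _)]
    exact pow_le_one₀ (psi_nonneg _) (psi_le_one _)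
  rw [← ofReal_integral_eq_lintegral_ofReal hintg (Eventually.of_forall fun s => sq_nonneg _)]
  apply ENNReal.ofReal_le_ofReal
  have e1 : ((∫ s in Set.Ioc (1:ℝ) 2, psi ν (((s ^ (-(1/2) : ℝ) : ℝ) : ℂ) * u) ^ 2 : ℝ) : ℂ) = ∫ p, (∫ s in Set.Ioc (1:ℝ) 2, f s p) ∂(ν.prod ν) := by
    rw [← integral_complex_ofReal, ← integral_integral_swap hfi]
    exact setIntegral_congr_fun measurableSet_Ioc hpsi
  have e2 : ∫ s in Set.Ioc (1:ℝ) 2, psi ν (((s ^ (-(1/2) : ℝ) : ℝ) : ℂ) * u) ^ 2 ≤ ‖∫ p, (∫ s in Set.Ioc (1:ℝ) 2, f s p) ∂(ν.prod ν)‖ := by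
    rw [← e1, Complex.norm_real]; exact le_abs_self _
  refine e2.trans ?_
  rw [← ENNReal.ofReal_le_ofReal_iff hη.le, ofReal_norm_eq_enorm]
  refine (enorm_integral_le_lintegral_enorm _).trans ?_
  have hbad : MeasurableSet {p : ℂ × ℂ | |dt p.1 p.2| ≤ δ} := measurableSet_le (by fun_prop) measurable_const
  have hun : ∀ᵐ p ∂(ν.prod ν), ‖p.1‖ = 1 ∧ ‖p.2‖ = 1 :=
    (Measure.quasiMeasurePreserving_fst.ae hS.unit).and (Measure.quasiMeasurePreserving_snd.ae hS.unit)
  have hpt : ∀ᵐ p ∂(ν.prod ν), ‖∫ s in Set.Ioc (1:ℝ) 2, f s p‖ₑ ≤ ENNReal.ofReal (η / 2) + {p : ℂ × ℂ | |dt p.1 p.2| ≤ δ}.indicator 1 p := by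
    filter_upwards [hae, hun] with p hp hp1
    rw [← ofReal_norm_eq_enorm, ← intervalIntegral.integral_of_le (by norm_num)]
    by_cases hpb : |dt p.1 p.2| ≤ δ
    · rw [Set.indicator_of_mem (by exact hpb), Pi.one_apply]
      refine le_trans ?_ le_add_self
      rw [← ENNReal.ofReal_one]
      apply ENNReal.ofReal_le_ofReal
      refine (intervalIntegral.norm_integral_le_of_norm_le_const (C := 1) fun s _ => (Complex.norm_exp_ofReal_mul_I _).le).trans ?_
      norm_num
    · refine le_trans ?_ le_self_add
      apply ENNReal.ofReal_le_ofReal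
      have hd : δ < |dt p.1 p.2| := not_le.1 hpb
      have hpos : 0 < |pr u p.1 * pr u p.2| := abs_pos.2 (mul_ne_zero hp.1 hp.2)
      have hle : |pr u p.1 * pr u p.2| ≤ δ * (η / 4) := by
        rw [abs_mul]
        have h1 := abs_pr_le u p.1
        have h2 := abs_pr_le u p.2
        rw [hp1.1, mul_one] at h1
        rw [hp1.2, mul_one] at h2
        calc _ ≤ ‖u‖ * ‖u‖ := by gcongr
          _ = ‖u‖ ^ 2 := by ring
          _ ≤ _ := hu2
      rcases osc (- (dt p.1 p.2 / (pr u p.1 * pr u p.2))) with h | h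
      · refine (h.trans (min_le_right _ _)).trans ?_
        rw [abs_neg, abs_div, div_div_eq_mul_div, div_le_iff₀ (hδ.trans hd)]
        nlinarith
      · exfalso
        have : dt p.1 p.2 ≠ 0 := by intro h0; rw [h0, abs_zero] at hd; linarith
        exact (neg_ne_zero.2 (div_ne_zero this (mul_ne_zero hp.1 hp.2))) h
  refine (lintegral_mono_ae hpt).trans ?_
  rw [lintegral_add_left measurable_const, lintegral_const, measure_univ, mul_one, lintegral_indicator_one hbad,
    Measure.prod_apply_symm hbad]
  have : ∫⁻ y, ν ((fun x => (x, y)) ⁻¹' {p : ℂ × ℂ | |dt p.1 p.2| ≤ δ}) ∂ν ≤ ∫⁻ y, ENNReal.ofReal (η / 2) ∂ν := by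
    apply lintegral_mono_ae
    filter_upwards [hS.unit] with y hy
    exact hl y hy
  rw [lintegral_const, measure_univ, mul_one] at this
  refine (add_le_add_right this _).trans ?_
  rw [← ENNReal.ofReal_add (by positivity) (by positivity)]
  apply ENNReal.ofReal_le_ofReal; linarith

end

end

section

open scoped ENNReal NNReal Topology

section
variable {μ : Measure SL2} {ν : Measure ℂ} [IsProbabilityMeasure μ] [IsProbabilityMeasure ν] {ε C M : ℝ}

theorem NH.avg {H : ℂ → ℝ} (h : NH μ H) (hzd : ¬ IsSolvable (Subgroup.closure (measSupp μ))) {η : ℝ} (hη : 0 < η) :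
    ∀ᶠ u in 𝓝[≠] (0 : ℂ), H u ≤ (∫ s in Set.Ioc (1:ℝ) 2, H (((s ^ (-(1/2) : ℝ) : ℝ) : ℂ) * u)) + η := by
  obtain ⟨K, hK, hb⟩ := h.bdd
  have hm := h.meas
  have hb2 : ∀ u, ‖H u‖ ≤ K := fun u => by rw [Real.norm_eq_abs]; exact hb u
  have hi : ∀ u : ℂ, Integrable (fun s : ℝ => H (((s ^ (-(1/2) : ℝ) : ℝ) : ℂ) * u)) (volume.restrict (Set.Ioc (1:ℝ) 2)) := fun u =>
    Integrable.of_bound (by fun_prop : Measurable (fun s : ℝ => H (((s ^ (-(1/2) : ℝ) : ℝ) : ℂ) * u))).aestronglyMeasurable K (Eventually.of_forall fun s => hb2 _)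
  have key : Tendsto (fun u => ∫ s in Set.Ioc (1:ℝ) 2, DD H (s ^ (-(1/2) : ℝ)) u) (𝓝[≠] (0 : ℂ)) (𝓝 (∫ s in Set.Ioc (1:ℝ) 2, (0:ℝ))) := by
    refine tendsto_integral_filter_of_dominated_convergence (fun _ => 2 * K) ?_ ?_ (integrable_const _) ?_
    · refine Eventually.of_forall fun u => ?_
      unfold DD
      exact (by fun_prop : Measurable (fun s : ℝ => H u - H (((s ^ (-(1/2) : ℝ) : ℝ) : ℂ) * u))).aestronglyMeasurable
    · refine Eventually.of_forall fun u => Eventually.of_forall fun s => ?_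
      unfold DD
      refine (norm_sub_le _ _).trans ?_
      linarith [hb2 u, hb2 (((s ^ (-(1/2) : ℝ) : ℝ) : ℂ) * u)]
    · filter_upwards [ae_restrict_mem measurableSet_Ioc] with s hs
      have hs0 : 0 < s := lt_trans one_pos hs.1
      exact h.renewal hzd (by positivity)
  rw [integral_zero] at key
  have h1 := key.eventually (gt_mem_nhds hη)
  filter_upwards [h1] with u hu
  unfold DD at hu
  rw [integral_sub (integrable_const _) (hi u)] at hu
  simp only [integral_const, smul_eq_mul] at hu
  have : (volume.restrict (Set.Ioc (1:ℝ) 2)).real Set.univ = 1 := by simp [Measure.real]; norm_num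
  rw [this, one_mul] at hu
  linarith

def chi (r B : ℝ) (u : ℂ) : ℝ := max 0 (min 1 (min (2 * ‖u‖ / r - 1) (2 - ‖u‖ / (B * r))))

theorem chi_nonneg (r B : ℝ) (u : ℂ) : 0 ≤ chi r B u := le_max_left _ _
theorem chi_le (r B : ℝ) (u : ℂ) : chi r B u ≤ 1 := max_le zero_le_one (min_le_left _ _)
theorem chi_cont (r B : ℝ) : Continuous (chi r B) := by unfold chi; fun_prop
theorem chi_one {r B : ℝ} (hr : 0 < r) (hB : 0 < B) {u : ℂ} (hu : u ∈ bandS r B) : chi r B u = 1 := by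
  obtain ⟨h1, h2⟩ := hu
  have e1 : 1 ≤ 2 * ‖u‖ / r - 1 := by
    have : 2 ≤ 2 * ‖u‖ / r := by rw [le_div_iff₀ hr]; linarith
    linarith
  have e2 : 1 ≤ 2 - ‖u‖ / (B * r) := by
    have : ‖u‖ / (B * r) ≤ 1 := by rw [div_le_iff₀ (by positivity)]; linarith
    linarith
  unfold chi
  rw [min_eq_left (le_min e1 e2)]; simp
theorem chi_supp {r B : ℝ} (hr : 0 < r) (hB : 0 < B) {u : ℂ} (hu : chi r B u ≠ 0) : u ∈ bandS (r / 2) (4 * B) := by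
  have hpos : 0 < chi r B u := lt_of_le_of_ne (chi_nonneg _ _ _) hu.symm
  unfold chi at hpos
  have h1 : 0 < min 1 (min (2 * ‖u‖ / r - 1) (2 - ‖u‖ / (B * r))) := by
    rcases lt_max_iff.1 hpos with h | h
    · exact absurd h (lt_irrefl _)
    · exact h
  have h2 := (lt_min_iff.1 (lt_min_iff.1 h1).2)
  have h3 : 1 < 2 * ‖u‖ / r := by linarith [h2.1]
  have h4 : ‖u‖ / (B * r) < 2 := by linarith [h2.2]
  rw [lt_div_iff₀ hr] at h3
  rw [div_lt_iff₀ (by positivity)] at h4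
  exact ⟨by linarith, by linarith⟩

theorem psi_TF (hS : Setup μ ν) {r B : ℝ} (hr : 0 < r) (hB : 0 < B) :
    TF (fun u => chi r B u * psi ν u ^ 2) (r / 2) (4 * B) 1 := by
  refine ⟨?_, by positivity, by positivity, one_pos, fun u => ?_, fun u hu => chi_supp hr hB (left_ne_zero_of_mul hu)⟩
  · rw [continuous_iff_continuousAt]
    intro u
    by_cases hu : u = 0
    · subst hu
      have : (fun u => chi r B u * psi ν u ^ 2) =ᶠ[𝓝 0] fun _ => 0 := by
        filter_upwards [Metric.ball_mem_nhds (0 : ℂ) (by positivity : 0 < r / 2)] with u hu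
        have : chi r B u = 0 := by
          by_contra h
          have := (chi_supp hr hB h).1
          rw [mem_ball_zero_iff] at hu
          linarith
        simp [this]
      exact continuousAt_const.congr this.symm
    · exact ((chi_cont r B).continuousAt).mul ((psi_cont hS hu).pow 2)
  · rw [abs_of_nonneg (mul_nonneg (chi_nonneg _ _ _) (sq_nonneg _))]
    exact mul_le_one₀ (chi_le _ _ _) (sq_nonneg _) (pow_le_one₀ (psi_nonneg _) (psi_le_one _))

theorem psi_GF_avg (hS : Setup μ ν) (hC : Contr μ ε C M) {B η : ℝ} (hB : 0 < B) (hη : 0 < η) :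
    ∃ r : ℝ, 0 < r ∧ ∀ u : ℂ, u ≠ 0 → ∫ s in Set.Ioc (1:ℝ) 2, GF μ (fun u => chi r B u * psi ν u ^ 2) (((s ^ (-(1/2) : ℝ) : ℝ) : ℂ) * u) ≤ η := by
  have hC0 : 0 < C := lt_of_lt_of_le one_pos hC.C1
  generalize hCb : C * (8 * B) ^ ε = Cb
  have hCb0 : 0 < Cb := by rw [← hCb]; positivity
  obtain ⟨ρ, hρ, hav⟩ := psi_avg hS (η := η / Cb) (by positivity)
  refine ⟨ρ / (4 * B), by positivity, fun u hu => ?_⟩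
  set r := ρ / (4 * B) with hr
  have hr0 : 0 < r := by positivity
  have hrρ : 4 * B * r = ρ := by rw [hr]; field_simp
  have hT := psi_TF hS hr0 hB
  set F := fun u => chi r B u * psi ν u ^ 2 with hF
  have hF0 : ∀ u, 0 ≤ F u := fun u => mul_nonneg (chi_nonneg _ _ _) (sq_nonneg _)
  have hFm := hT.cont.measurable
  have hGm := hT.GF_meas (μ := μ)
  have hG0 : ∀ u, 0 ≤ GF μ F u := fun u => integral_nonneg fun g => hF0 _
  have hGi : Integrable (fun s : ℝ => GF μ F (((s ^ (-(1/2) : ℝ) : ℝ) : ℂ) * u)) (volume.restrict (Set.Ioc (1:ℝ) 2)) :=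
    Integrable.of_bound (by fun_prop : Measurable (fun s : ℝ => GF μ F (((s ^ (-(1/2) : ℝ) : ℝ) : ℂ) * u))).aestronglyMeasurable _
      (Eventually.of_forall fun s => by rw [Real.norm_eq_abs]; exact hT.GF_bdd hC _)
  rw [← ENNReal.ofReal_le_ofReal_iff hη.le, ofReal_integral_eq_lintegral_ofReal hGi (Eventually.of_forall fun s => hG0 _)]
  have e1 : ∀ u, ENNReal.ofReal (GF μ F u) = ∫⁻ g, ENNReal.ofReal (F (ra u g)) ∂(Gr μ) := fun u =>
    ofReal_integral_eq_lintegral_ofReal (hT.int hC u) (Eventually.of_forall fun g => hF0 _)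
  simp only [e1, ra_smul]
  rw [lintegral_lintegral_swap (by
    have : Measurable (fun p : ℝ × SL2 => ENNReal.ofReal (F (((p.1 ^ (-(1/2) : ℝ) : ℝ) : ℂ) * ra u p.2))) := by fun_prop
    exact this.aemeasurable)]
  have hin : ∀ w : ℂ, ∫⁻ s in Set.Ioc (1:ℝ) 2, ENNReal.ofReal (F (((s ^ (-(1/2) : ℝ) : ℝ) : ℂ) * w)) ≤
      ENNReal.ofReal (η / Cb) * (bandS (r / 2) (8 * B)).indicator 1 w := by
    intro w
    by_cases hw : w ∈ bandS (r / 2) (8 * B)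
    · rw [Set.indicator_of_mem hw, Pi.one_apply, mul_one]
      have hw0 : w ≠ 0 := by
        intro h; rw [h] at hw; have := hw.1; rw [norm_zero] at this; linarith
      refine le_trans (lintegral_mono fun s => ?_) (hav w hw0 (by have := hw.2; linarith))
      apply ENNReal.ofReal_le_ofReal
      exact mul_le_of_le_one_left (sq_nonneg _) (chi_le _ _ _)
    · rw [Set.indicator_of_notMem hw, mul_zero]
      apply le_of_eq
      rw [setLIntegral_congr_fun (g := fun _ => 0) measurableSet_Ioc, lintegral_zero]
      intro s hs
      have hs0 : 0 < s := lt_trans one_pos hs.1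
      have hτ0 : 0 < s ^ (-(1/2) : ℝ) := by positivity
      have hτ1 : s ^ (-(1/2) : ℝ) ≤ 1 := Real.rpow_le_one_of_one_le_of_nonpos hs.1.le (by norm_num)
      have hτ2 : 1 / 2 ≤ s ^ (-(1/2) : ℝ) := by
        calc (1 / 2 : ℝ) = (2:ℝ) ^ (-1 : ℝ) := by rw [Real.rpow_neg_one]; norm_num
          _ ≤ s ^ (-1 : ℝ) := Real.rpow_le_rpow_of_nonpos hs0 hs.2 (by norm_num)
          _ ≤ s ^ (-(1/2) : ℝ) := Real.rpow_le_rpow_of_exponent_le hs.1.le (by norm_num)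
      have : F (((s ^ (-(1/2) : ℝ) : ℝ) : ℂ) * w) = 0 := by
        by_contra h
        apply hw
        obtain ⟨h1, h2⟩ := hT.supp _ h
        rw [norm_mul, Complex.norm_real, Real.norm_eq_abs, abs_of_pos hτ0] at h1 h2
        have hn := norm_nonneg w
        exact ⟨by nlinarith, by nlinarith⟩
      simp only [this, ENNReal.ofReal_zero]
  refine (lintegral_mono fun g => hin (ra u g)).trans ?_
  have hbm := measurable_band_ind (r / 2) (8 * B)
  rw [lintegral_const_mul _ (by fun_prop)]
  have := green_band hC (r := r / 2) (B := 8 * B) (by positivity) (by positivity) hu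
  rw [hCb] at this
  refine (mul_le_mul_right this _).trans ?_
  rw [← ENNReal.ofReal_mul (by positivity)]
  apply ENNReal.ofReal_le_ofReal
  rw [div_mul_cancel₀ _ hCb0.ne']

theorem psi_tendsto (hS : Setup μ ν) : Tendsto (psi ν) (𝓝[≠] (0 : ℂ)) (𝓝 0) := by
  obtain ⟨ε, C, M, hC⟩ := exists_Contr hS
  have hC0 : 0 < C := lt_of_lt_of_le one_pos hC.C1
  have hε := hC.pos
  obtain ⟨C', hC', hhit⟩ := hit hC
  rw [Metric.tendsto_nhds]
  intro η hη
  obtain ⟨B, hB1, hB⟩ : ∃ B : ℝ, 1 ≤ B ∧ C' * B ^ (-ε) ≤ η / 8 := by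
    have h1 : Tendsto (fun B : ℝ => C' * B ^ (-ε)) atTop (𝓝 (C' * 0)) := (tendsto_rpow_neg_atTop hε).const_mul _
    rw [mul_zero] at h1
    have h2 := (h1.eventually (gt_mem_nhds (by positivity : 0 < η / 8))).and (eventually_ge_atTop 1)
    obtain ⟨B, h3, h4⟩ := h2.exists
    exact ⟨B, h4, h3.le⟩
  have hB0 : 0 < B := lt_of_lt_of_le one_pos hB1
  generalize hCb : C * B ^ ε = Cb
  have hCb0 : 0 < Cb := by rw [← hCb]; positivity
  set η1 := η / (8 * Cb) with hη1
  have hη10 : 0 < η1 := by positivity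
  obtain ⟨r, hr, hav⟩ := psi_GF_avg hS hC hB0 (η := η1 * η / 8) (by positivity)
  have hT := psi_TF hS hr hB0
  have hev := (hT.GF_NH hC).avg hS.zd (η := η1 * η / 8) (by positivity)
  set F := fun u => chi r B u * psi ν u ^ 2 with hF
  have hF0 : ∀ u, 0 ≤ F u := fun u => mul_nonneg (chi_nonneg _ _ _) (sq_nonneg _)
  have hFm := hT.cont.measurable
  have hsm : ∀ᶠ u in 𝓝[≠] (0 : ℂ), ‖u‖ ≤ B * r := by
    apply nhdsWithin_le_nhds
    filter_upwards [Metric.closedBall_mem_nhds (0 : ℂ) (by positivity : 0 < B * r)] with u hu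
    simpa using hu
  filter_upwards [hev, hsm, self_mem_nhdsWithin] with u h1 h2 h3
  have hu : u ≠ 0 := h3
  have h4 : GF μ F u ≤ η1 * η / 4 := by linarith [hav u hu]
  have h5 := hhit (Wf ν (eP u)) (Wf_meas (by fun_prop)) (Wf_le fun x => (norm_eP u x).le)
    (Wf_sub hS _ (by fun_prop) (fun x => (norm_eP u x).le) (eP_hom u)) u r B hu hr hB1 h2
  have hbm := measurable_band_ind r B
  have h6 : ∀ g, {g | ra u g ∈ bandS r B}.indicator (Wf ν (eP u)) g ≤
      ENNReal.ofReal η1 * (bandS r B).indicator 1 (ra u g) + ENNReal.ofReal (1 / η1) * ENNReal.ofReal (F (ra u g)) := by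
    intro g
    by_cases hg : ra u g ∈ bandS r B
    · rw [Set.indicator_of_mem (by exact hg), Set.indicator_of_mem hg, Pi.one_apply, mul_one, Wf_eP hS hu, ← ENNReal.ofReal_mul (by positivity),
        ← ENNReal.ofReal_add hη10.le (mul_nonneg (by positivity) (hF0 _))]
      apply ENNReal.ofReal_le_ofReal
      simp only [hF]
      rw [chi_one hr hB0 hg, one_mul, one_div, inv_mul_eq_div, ← sub_le_iff_le_add', le_div_iff₀ hη10]
      nlinarith [sq_nonneg (psi ν (ra u g) - η1), psi_nonneg (ν := ν) (ra u g)]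
    · rw [Set.indicator_of_notMem (by exact hg)]; exact zero_le
  have h7 : ∫⁻ g, {g | ra u g ∈ bandS r B}.indicator (Wf ν (eP u)) g ∂(Gr μ) ≤ ENNReal.ofReal (η / 8) + ENNReal.ofReal (η / 4) := by
    refine (lintegral_mono h6).trans ?_
    rw [lintegral_add_left (by fun_prop), lintegral_const_mul _ (by fun_prop), lintegral_const_mul _ (by fun_prop)]
    rw [← ofReal_integral_eq_lintegral_ofReal (hT.int hC u) (Eventually.of_forall fun g => hF0 _)]
    have hgb := green_band hC hr hB0 hu
    rw [hCb] at hgb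
    refine add_le_add ((mul_le_mul_right hgb _).trans ?_) ?_
    · rw [← ENNReal.ofReal_mul (by positivity)]
      apply ENNReal.ofReal_le_ofReal
      rw [hη1]; apply le_of_eq; field_simp
    · rw [← ENNReal.ofReal_mul (by positivity)]
      apply ENNReal.ofReal_le_ofReal
      change 1 / η1 * GF μ F u ≤ _
      calc _ ≤ 1 / η1 * (η1 * η / 4) := by gcongr
        _ = _ := by field_simp
  have h8 := h5.trans (add_le_add h7 (ENNReal.ofReal_le_ofReal hB))
  rw [Wf_eP hS hu, ra_one, ← ENNReal.ofReal_add (by positivity) (by positivity), ← ENNReal.ofReal_add (by positivity) (by positivity),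
    ENNReal.ofReal_le_ofReal_iff (by positivity)] at h8
  rw [Real.dist_eq, sub_zero, abs_of_nonneg (psi_nonneg _)]
  linarith

end

end

section

open scoped ENNReal NNReal Topology

section
variable {μ : Measure SL2} {ν : Measure ℂ} [IsProbabilityMeasure μ] [IsProbabilityMeasure ν] {ε C M : ℝ}

theorem taylor2 {Ψ : ℝ → ℝ} (hΨ : ContDiff ℝ 2 Ψ) (hΨ0 : ∀ t, deriv Ψ t ≠ 0) (R : ℝ) (hR : 0 < R) :
    ∃ L a : ℝ, 0 < L ∧ 0 < a ∧ ∀ m : ℝ, |m| ≤ R → a ≤ |deriv Ψ m| ∧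
      ∀ t : ℝ, |t - m| ≤ 1 → |Ψ t - (Ψ m + deriv Ψ m * (t - m))| ≤ L * |t - m| ^ 2 := by
  have hd1 : Differentiable ℝ Ψ := hΨ.differentiable (by norm_num)
  have hc1 : ContDiff ℝ 1 (deriv Ψ) := ((contDiff_succ_iff_deriv (n := 1)).1 hΨ).2.2
  have hd2 : Differentiable ℝ (deriv Ψ) := hc1.differentiable (by norm_num)
  have hc2 : Continuous (deriv (deriv Ψ)) := hc1.continuous_deriv (by norm_num)
  obtain ⟨L, hL⟩ := (isCompact_Icc (a := -(R + 1)) (b := R + 1)).exists_bound_of_continuousOn hc2.continuousOn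
  have hne : (Set.Icc (-R) R).Nonempty := ⟨0, by constructor <;> linarith⟩
  obtain ⟨m1, hm1, hmin⟩ := (isCompact_Icc (a := -R) (b := R)).exists_isMinOn hne (hc1.continuous.abs).continuousOn
  refine ⟨max L 1, |deriv Ψ m1|, by positivity, abs_pos.2 (hΨ0 _), fun m hm => ⟨hmin (abs_le.1 hm), fun t ht => ?_⟩⟩
  have hL1 : 0 ≤ max L 1 := by positivity
  have hm' := abs_le.1 hm
  have hmem : ∀ s, |s - m| ≤ 1 → s ∈ Set.Icc (-(R + 1)) (R + 1) := by
    intro s hs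
    have := abs_le.1 hs
    constructor <;> linarith
  have hcv : Convex ℝ (Set.uIcc m t) := convex_uIcc _ _
  have hseg : ∀ s ∈ Set.uIcc m t, |s - m| ≤ |t - m| := by
    intro s hs
    exact Set.abs_sub_left_of_mem_uIcc hs
  have h1 : ∀ s ∈ Set.uIcc m t, |deriv Ψ s - deriv Ψ m| ≤ max L 1 * |t - m| := by
    intro s hs
    have := hcv.norm_image_sub_le_of_norm_deriv_le (f := deriv Ψ) (C := max L 1) (fun x _ => hd2 x)
      (fun x hx => (hL x (hmem x ((hseg x hx).trans ht))).trans (le_max_left _ _)) Set.left_mem_uIcc hs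
    rw [Real.norm_eq_abs, Real.norm_eq_abs] at this
    exact this.trans (mul_le_mul_of_nonneg_left (hseg s hs) hL1)
  have h2 := hcv.norm_image_sub_le_of_norm_hasDerivWithin_le (f := fun s => Ψ s - deriv Ψ m * s) (f' := fun s => deriv Ψ s - deriv Ψ m) (C := max L 1 * |t - m|)
    (fun x _ => by
      have := ((hd1 x).hasDerivAt.sub ((hasDerivAt_id x).const_mul (deriv Ψ m)))
      rw [mul_one] at this
      exact this.hasDerivWithinAt) (fun x hx => by rw [Real.norm_eq_abs]; exact h1 x hx) Set.left_mem_uIcc Set.right_mem_uIcc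
  rw [Real.norm_eq_abs, Real.norm_eq_abs] at h2
  calc _ = |Ψ t - deriv Ψ m * t - (Ψ m - deriv Ψ m * m)| := by congr 1; ring
    _ ≤ _ := h2
    _ = _ := by ring

theorem psi_scale (u : ℂ) {b : ℝ} (hb : b ≠ 0) :
    ‖∫ x, Complex.exp (((b * Ph u x : ℝ) : ℂ) * Complex.I) ∂ν‖ = psi ν (((|b| ^ (-(1/2) : ℝ) : ℝ) : ℂ) * u) := by
  have hb0 : 0 < |b| := abs_pos.2 hb
  have hτ : (|b| ^ (-(1/2) : ℝ)) ^ 2 = |b|⁻¹ := by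
    rw [← Real.rpow_natCast, ← Real.rpow_mul hb0.le]; norm_num [Real.rpow_neg_one]
  have hτ0 : 0 < |b| ^ (-(1/2) : ℝ) := by positivity
  have hP : ∀ x, Ph (((|b| ^ (-(1/2) : ℝ) : ℝ) : ℂ) * u) x = |b| * Ph u x := by
    intro x
    generalize |b| ^ (-(1/2) : ℝ) = τ at hτ hτ0
    have : |b| = (τ ^ 2)⁻¹ := by rw [hτ, inv_inv]
    rw [this]
    unfold Ph
    rw [dt_smul, pr_smul, norm_mul, Complex.norm_real, Real.norm_eq_abs, abs_of_pos hτ0]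
    by_cases h : ‖u‖ ^ 2 * pr u x = 0
    · rw [h, div_zero, mul_zero]
      have : (τ * ‖u‖) ^ 2 * (τ * pr u x) = τ ^ 3 * (‖u‖ ^ 2 * pr u x) := by ring
      rw [this, h, mul_zero, div_zero]
    · have h1 : ‖u‖ ≠ 0 := by intro h0; simp [h0] at h
      have h2 : pr u x ≠ 0 := by intro h0; simp [h0] at h
      field_simp
  unfold psi eP
  simp only [hP]
  rcases abs_choice b with h | h
  · rw [h]
  · rw [h, ← RCLike.norm_conj (K := ℂ) (∫ x, Complex.exp (((b * Ph u x : ℝ) : ℂ) * Complex.I) ∂ν), ← integral_conj]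
    congr 2
    ext x
    rw [← Complex.exp_conj]
    simp

theorem exp_lip (a b : ℝ) : ‖Complex.exp ((a : ℂ) * Complex.I) - Complex.exp ((b : ℂ) * Complex.I)‖ ≤ |a - b| := by
  have h : Complex.exp ((a : ℂ) * Complex.I) - Complex.exp ((b : ℂ) * Complex.I) =
      Complex.exp ((b : ℂ) * Complex.I) * (Complex.exp (Complex.I * ((a - b : ℝ) : ℂ)) - 1) := by
    rw [mul_sub, ← Complex.exp_add, mul_one]; push_cast; ring_nf
  rw [h, norm_mul, Complex.norm_exp_ofReal_mul_I, one_mul]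
  exact Real.norm_exp_I_mul_ofReal_sub_one_le

/-- pointwise comparison -/
theorem pt_est {f : ℝ → ℂ} (hf1 : ∀ t, ‖f t‖ ≤ 1) {Ψ : ℝ → ℝ} {k m t ω1 ω2 : ℝ} (h1 : ‖f t - f m‖ ≤ ω1)
    (h2 : |k| * |Ψ t - (Ψ m + deriv Ψ m * (t - m))| ≤ ω2) :
    ‖f t * Complex.exp (((k * Ψ t : ℝ) : ℂ) * Complex.I) - f m * Complex.exp (((k * (Ψ m + deriv Ψ m * (t - m)) : ℝ) : ℂ) * Complex.I)‖ ≤ ω1 + ω2 := by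
  have e : f t * Complex.exp (((k * Ψ t : ℝ) : ℂ) * Complex.I) - f m * Complex.exp (((k * (Ψ m + deriv Ψ m * (t - m)) : ℝ) : ℂ) * Complex.I) =
    (f t - f m) * Complex.exp (((k * Ψ t : ℝ) : ℂ) * Complex.I) +
    f m * (Complex.exp (((k * Ψ t : ℝ) : ℂ) * Complex.I) - Complex.exp (((k * (Ψ m + deriv Ψ m * (t - m)) : ℝ) : ℂ) * Complex.I)) := by ring
  rw [e]
  refine (norm_add_le _ _).trans (add_le_add ?_ ?_)
  · rw [norm_mul, Complex.norm_exp_ofReal_mul_I, mul_one]; exact h1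
  · rw [norm_mul]
    refine (mul_le_of_le_one_left (norm_nonneg _) (hf1 m)).trans ?_
    refine (exp_lip _ _).trans ?_
    rw [← mul_sub, abs_mul]; exact h2

theorem band_fix (hS : Setup μ ν) {f : ℝ → ℂ} (hfc : Continuous f) (hf1 : ∀ t, ‖f t‖ ≤ 1) {R : ℝ}
    (hfs : ∀ t, R < |t| → f t = 0) {Ψ : ℝ → ℝ} (hΨc : Continuous Ψ) {L a : ℝ} (hL : 0 < L) (ha : 0 < a)
    (hT : ∀ m : ℝ, |m| ≤ R + 1 → a ≤ |deriv Ψ m| ∧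
      ∀ t : ℝ, |t - m| ≤ 1 → |Ψ t - (Ψ m + deriv Ψ m * (t - m))| ≤ L * |t - m| ^ 2) {ω δ δf ρ : ℝ} (hω : 0 < ω) (hω1 : ω < 1)
    (hδ : 0 < δ) (hlm : ∀ u : ℂ, u ≠ 0 → lm ν u δ ≤ ENNReal.ofReal ω)
    (hδf : ∀ s t : ℝ, |s - t| ≤ δf → ‖f s - f t‖ ≤ ω) (hρ : ∀ u : ℂ, u ≠ 0 → ‖u‖ ≤ ρ → psi ν u ≤ ω)
    {k : ℝ} (hk : k ≠ 0) {u : ℂ} (hu : u ≠ 0) (c : ℝ) (hD1 : 1 / (δ ^ 2 * ‖u‖ ^ 2) ≤ 1) (hD2 : 1 / (δ ^ 2 * ‖u‖ ^ 2) ≤ δf)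
    (hD3 : |k| * (L * (1 / (δ ^ 2 * ‖u‖ ^ 2)) ^ 2) ≤ ω) (hD4 : (|k| * a) ^ (-(1/2) : ℝ) * ‖u‖ ≤ ρ) :
    ‖∫ x, f (Ph u x + c) * Complex.exp (((k * Ψ (Ph u x + c) : ℝ) : ℂ) * Complex.I) ∂ν‖ ≤ 5 * ω := by
  set D := 1 / (δ ^ 2 * ‖u‖ ^ 2) with hD
  have hun : 0 < ‖u‖ := norm_pos_iff.2 hu
  set bad : Set ℂ := {x | |pr u x| ≤ δ * (‖u‖ * ‖x‖)} with hbad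
  have hbadm : MeasurableSet bad := measurableSet_lm u δ
  have hbl : ν bad ≤ ENNReal.ofReal ω := hlm u hu
  have hdist : ∀ x y, ‖x‖ = 1 → ‖y‖ = 1 → x ∉ bad → y ∉ bad → |(Ph u x + c) - (Ph u y + c)| ≤ D := by
    intro x y hx hy hxb hyb
    have h1 : δ * ‖u‖ < |pr u x| := by
      have : ¬ (|pr u x| ≤ δ * (‖u‖ * ‖x‖)) := hxb
      rw [hx, mul_one] at this; exact not_le.1 this
    have h2 : δ * ‖u‖ < |pr u y| := by
      have : ¬ (|pr u y| ≤ δ * (‖u‖ * ‖y‖)) := hyb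
      rw [hy, mul_one] at this; exact not_le.1 this
    have h0 : 0 < δ * ‖u‖ := by positivity
    have hx0 : pr u x ≠ 0 := abs_pos.1 (h0.trans h1)
    have hy0 : pr u y ≠ 0 := abs_pos.1 (h0.trans h2)
    rw [add_sub_add_right_eq_sub, Ph_sub hu hx0 hy0, abs_neg, abs_div, abs_mul, hD]
    have h3 := abs_dt_le x y
    rw [hx, hy, mul_one] at h3
    apply div_le_div₀ zero_le_one h3 (by positivity)
    calc δ ^ 2 * ‖u‖ ^ 2 = (δ * ‖u‖) * (δ * ‖u‖) := by ring
      _ ≤ _ := mul_le_mul h1.le h2.le h0.le (abs_nonneg _)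
  obtain ⟨y, hy1, hyb⟩ : ∃ y, ‖y‖ = 1 ∧ y ∉ bad := by
    by_contra! hcon
    have : ν bad = 1 := by
      rw [prob_compl_eq_zero_iff hbadm |>.symm]
      have := hS.unit
      rw [ae_iff] at this
      refine measure_mono_null ?_ this
      intro x hx hx1
      exact hx (hcon x hx1)
    rw [this] at hbl
    have := ENNReal.one_le_ofReal.1 hbl
    linarith
  set m := Ph u y + c with hm
  set I1 : ℂ → ℂ := fun x => f (Ph u x + c) * Complex.exp (((k * Ψ (Ph u x + c) : ℝ) : ℂ) * Complex.I) with hI1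
  have hPm : Measurable (fun x => Ph u x) := by unfold Ph; fun_prop
  have hfm := hfc.measurable
  have hΨm := hΨc.measurable
  have hI1m : Measurable I1 := by simp only [hI1]; fun_prop
  have hI1b : ∀ x, ‖I1 x‖ ≤ 1 := fun x => by simp only [hI1]; rw [norm_mul, Complex.norm_exp_ofReal_mul_I, mul_one]; exact hf1 _
  have hI1i : Integrable I1 ν := Integrable.of_bound hI1m.aestronglyMeasurable 1 (Eventually.of_forall hI1b)
  set I2 : ℂ → ℂ := fun x => f m * Complex.exp (((k * (Ψ m + deriv Ψ m * ((Ph u x + c) - m)) : ℝ) : ℂ) * Complex.I) with hI2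
  have hI2m : Measurable I2 := by simp only [hI2]; fun_prop
  have hI2b : ∀ x, ‖I2 x‖ ≤ 1 := fun x => by simp only [hI2]; rw [norm_mul, Complex.norm_exp_ofReal_mul_I, mul_one]; exact hf1 _
  have hI2i : Integrable I2 ν := Integrable.of_bound hI2m.aestronglyMeasurable 1 (Eventually.of_forall hI2b)
  have hgood : ∀ x, ‖x‖ = 1 → x ∉ bad → ‖I1 x - I2 x‖ ≤ 2 * ω := by
    intro x hx hxb
    have hd := hdist x y hx hy1 hxb hyb
    have hd' : |Ph u x + c - m| ≤ D := hd
    by_cases hmR : |m| ≤ R + 1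
    · have := pt_est hf1 (Ψ := Ψ) (k := k) (m := m) (t := Ph u x + c) (ω1 := ω) (ω2 := ω) (hδf _ _ (hd'.trans hD2)) (by
        refine le_trans ?_ hD3
        apply mul_le_mul_of_nonneg_left _ (abs_nonneg _)
        refine ((hT m hmR).2 _ (hd'.trans hD1)).trans ?_
        gcongr)
      linarith
    · have h1 : f m = 0 := hfs _ (by linarith)
      have h2 : f (Ph u x + c) = 0 := by
        apply hfs
        have := abs_sub_abs_le_abs_sub m (Ph u x + c)
        rw [abs_sub_comm] at this
        linarith
      simp only [hI1, hI2]
      rw [h1, h2]; simp; exact hω.le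
  have hdiff : ‖∫ x, (I1 x - I2 x) ∂ν‖ ≤ 4 * ω := by
    rw [← ENNReal.ofReal_le_ofReal_iff (by positivity), ofReal_norm_eq_enorm]
    refine (enorm_integral_le_lintegral_enorm _).trans ?_
    have hpt : ∀ᵐ x ∂ν, ‖I1 x - I2 x‖ₑ ≤ ENNReal.ofReal (2 * ω) + ENNReal.ofReal 2 * bad.indicator 1 x := by
      filter_upwards [hS.unit] with x hx
      rw [← ofReal_norm_eq_enorm]
      by_cases hxb : x ∈ bad
      · rw [Set.indicator_of_mem hxb, Pi.one_apply, mul_one]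
        refine le_trans (ENNReal.ofReal_le_ofReal ?_) le_add_self
        refine (norm_sub_le _ _).trans ?_
        linarith [hI1b x, hI2b x]
      · exact le_trans (ENNReal.ofReal_le_ofReal (hgood x hx hxb)) le_self_add
    refine (lintegral_mono_ae hpt).trans ?_
    have hbi : Measurable (bad.indicator (1 : ℂ → ℝ≥0∞)) := measurable_one.indicator hbadm
    rw [lintegral_add_left measurable_const, lintegral_const, measure_univ, mul_one, lintegral_const_mul _ hbi, lintegral_indicator_one hbadm]
    refine (add_le_add_right (mul_le_mul_right hbl _) _).trans ?_
    rw [← ENNReal.ofReal_mul (by positivity), ← ENNReal.ofReal_add (by positivity) (by positivity)]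
    apply ENNReal.ofReal_le_ofReal; linarith
  have hI2n : ‖∫ x, I2 x ∂ν‖ ≤ ω := by
    by_cases hmR : |m| ≤ R + 1
    · have ham := (hT m hmR).1
      have hda : 0 < |deriv Ψ m| := ha.trans_le ham
      have hb : k * deriv Ψ m ≠ 0 := mul_ne_zero hk (abs_pos.1 hda)
      have e : ∀ x, I2 x = (f m * Complex.exp (((k * (Ψ m + deriv Ψ m * (c - m)) : ℝ) : ℂ) * Complex.I)) * Complex.exp ((((k * deriv Ψ m) * Ph u x : ℝ) : ℂ) * Complex.I) := by
        intro x
        simp only [hI2]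
        rw [mul_assoc, ← Complex.exp_add]
        push_cast; ring_nf
      simp only [e]
      rw [integral_const_mul, norm_mul, norm_mul, Complex.norm_exp_ofReal_mul_I, mul_one, psi_scale u hb]
      refine (mul_le_of_le_one_left (psi_nonneg _) (hf1 m)).trans ?_
      have hkp : 0 < |k| := abs_pos.2 hk
      have hbp : 0 < |k * deriv Ψ m| := abs_pos.2 hb
      have hτ0 : 0 < |k * deriv Ψ m| ^ (-(1/2) : ℝ) := by positivity
      apply hρ
      · exact mul_ne_zero (by exact_mod_cast hτ0.ne') hu
      · rw [norm_mul, Complex.norm_real, Real.norm_eq_abs, abs_of_pos hτ0]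
        refine le_trans ?_ hD4
        apply mul_le_mul_of_nonneg_right _ hun.le
        apply Real.rpow_le_rpow_of_nonpos (by positivity) _ (by norm_num)
        rw [abs_mul]
        exact mul_le_mul_of_nonneg_left ham hkp.le
    · have h1 : f m = 0 := hfs _ (by linarith)
      simp only [hI2, h1, zero_mul, integral_zero, norm_zero]
      exact hω.le
  have : ∫ x, I1 x ∂ν = ∫ x, (I1 x - I2 x) ∂ν + ∫ x, I2 x ∂ν := by
    rw [integral_sub hI1i hI2i]; ring
  rw [this]
  refine (norm_add_le _ _).trans ?_
  linarith

end

end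

section

open scoped ENNReal NNReal Topology

section
variable {μ : Measure SL2} {ν : Measure ℂ} [IsProbabilityMeasure μ] [IsProbabilityMeasure ν] {ε C M : ℝ}

theorem tend_small (c : ℝ) {e η : ℝ} (he : 0 < e) (hη : 0 < η) : ∀ᶠ κ : ℝ in atTop, c * κ ^ (-e) ≤ η := by
  have h1 : Tendsto (fun B : ℝ => c * B ^ (-e)) atTop (𝓝 (c * 0)) := (tendsto_rpow_neg_atTop he).const_mul _
  rw [mul_zero] at h1
  filter_upwards [h1.eventually (gt_mem_nhds hη)] with x hx using hx.le

theorem raj_cc (hS : Setup μ ν) {f : ℝ → ℂ} (hfc : Continuous f) (hf1 : ∀ t, ‖f t‖ ≤ 1) {R : ℝ} (hR : 0 < R)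
    (hfs : ∀ t, R < |t| → f t = 0) {Ψ : ℝ → ℝ} (hΨ : ContDiff ℝ 2 Ψ) (hΨ0 : ∀ t, deriv Ψ t ≠ 0) {η : ℝ} (hη : 0 < η) :
    ∃ K0 : ℝ, ∀ k : ℝ, K0 ≤ |k| → ‖∫ x, f (Ph 1 x) * Complex.exp (((k * Ψ (Ph 1 x) : ℝ) : ℂ) * Complex.I) ∂ν‖ ≤ η := by
  obtain ⟨ε, C, M, hC⟩ := exists_Contr hS
  have hC0 : 0 < C := lt_of_lt_of_le one_pos hC.C1
  have hε := hC.pos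
  obtain ⟨C', hC', hhit⟩ := hit hC
  obtain ⟨L, a, hL, ha, hT⟩ := taylor2 hΨ hΨ0 (R + 1) (by linarith)
  obtain ⟨B, hB, hB1⟩ := ((tend_small C' hε (by positivity : 0 < η / 2)).and (eventually_ge_atTop 1)).exists
  have hB0 : 0 < B := lt_of_lt_of_le one_pos hB1
  generalize hCb : C * B ^ ε = Cb
  have hCb0 : 0 < Cb := by rw [← hCb]; positivity
  set ω := min (1 / 2) (η / (10 * Cb)) with hω
  have hω0 : 0 < ω := by positivity
  have hω1 : ω < 1 := (min_le_left _ _).trans_lt (by norm_num)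
  have hω2 : 5 * ω * Cb ≤ η / 2 := by
    have := min_le_right (1 / 2) (η / (10 * Cb))
    rw [← hω, le_div_iff₀ (by positivity)] at this
    linarith
  obtain ⟨δ, hδ, _, hlm⟩ := lm_unif hS (ε := ENNReal.ofReal ω) (by simpa using hω0)
  obtain ⟨δf, hδf0, hδf⟩ : ∃ δf : ℝ, 0 < δf ∧ ∀ s t : ℝ, |s - t| ≤ δf → ‖f s - f t‖ ≤ ω := by
    have hcs : HasCompactSupport f := by
      refine HasCompactSupport.intro (isCompact_Icc (a := -R) (b := R)) fun x hx => hfs x ?_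
      by_contra h
      exact hx (abs_le.1 (not_lt.1 h))
    have := hcs.uniformContinuous_of_continuous hfc
    obtain ⟨d, hd, h⟩ := Metric.uniformContinuous_iff.1 this ω hω0
    refine ⟨d / 2, by positivity, fun s t hst => ?_⟩
    have := h (a := s) (b := t) (by rw [Real.dist_eq]; linarith)
    rw [dist_eq_norm] at this
    exact this.le
  obtain ⟨ρ, hρ0, hρ⟩ : ∃ ρ : ℝ, 0 < ρ ∧ ∀ u : ℂ, u ≠ 0 → ‖u‖ ≤ ρ → psi ν u ≤ ω := by
    have h := (psi_tendsto hS).eventually (gt_mem_nhds hω0)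
    rw [eventually_nhdsWithin_iff, Metric.eventually_nhds_iff] at h
    obtain ⟨e, he, h⟩ := h
    refine ⟨e / 2, by positivity, fun u hu hur => ?_⟩
    exact (h (by rw [dist_zero_right]; linarith) hu).le
  have hev := (eventually_ge_atTop (1 : ℝ)).and <| (tend_small (1 / δ ^ 2) (e := 3 / 4) (by norm_num) one_pos).and <|
    (tend_small (1 / δ ^ 2) (e := 3 / 4) (by norm_num) hδf0).and <|
    (tend_small (L / δ ^ 4) (e := 1 / 2) (by norm_num) hω0).and <|
    (tend_small (a ^ (-(1/2) : ℝ) * B) (e := 1 / 8) (by norm_num) hρ0)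
  obtain ⟨K0, hK0⟩ := eventually_atTop.1 hev
  refine ⟨K0, fun k hk => ?_⟩
  obtain ⟨hk1, hk2, hk3, hk4, hk5⟩ := hK0 |k| hk
  have hkp : 0 < |k| := lt_of_lt_of_le one_pos hk1
  have hk0 : k ≠ 0 := abs_pos.1 hkp
  set φ : ℂ → ℂ := fun x => f (Ph 1 x) * Complex.exp (((k * Ψ (Ph 1 x) : ℝ) : ℂ) * Complex.I) with hφ
  have hPm : Measurable (fun x => Ph 1 x) := by unfold Ph; fun_prop
  have hfm := hfc.measurable
  have hΨm := hΨ.continuous.measurable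
  have hφm : Measurable φ := by simp only [hφ]; fun_prop
  have hφ1 : ∀ x, ‖φ x‖ ≤ 1 := fun x => by simp only [hφ]; rw [norm_mul, Complex.norm_exp_ofReal_mul_I, mul_one]; exact hf1 _
  have hPh : ∀ (c : ℝ) (x : ℂ), c ≠ 0 → Ph 1 (c * x) = Ph 1 x := by
    intro c x hc
    unfold Ph
    rw [dt_smul', pr_smul', show ‖(1:ℂ)‖ ^ 2 * (c * pr 1 x) = c * (‖(1:ℂ)‖ ^ 2 * pr 1 x) by ring, mul_div_mul_left _ _ hc]
  have hφh : ∀ (c : ℝ) (x : ℂ), c ≠ 0 → φ (c * x) = φ x := by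
    intro c x hc
    simp only [hφ]
    rw [hPh c x hc]
  set r := |k| ^ (3 / 8 : ℝ) with hr
  have hr0 : 0 < r := by positivity
  have hr1 : 1 ≤ r := Real.one_le_rpow hk1 (by norm_num)
  have h5 := hhit (Wf ν φ) (Wf_meas hφm) (Wf_le hφ1) (Wf_sub hS _ hφm hφ1 hφh) 1 r B one_ne_zero hr0 hB1 (by rw [norm_one]; nlinarith)
  have hr2 : r ^ 2 = |k| ^ (3 / 4 : ℝ) := by
    rw [hr, ← Real.rpow_natCast, ← Real.rpow_mul hkp.le]; norm_num
  have h6 : ∀ g, {g | ra 1 g ∈ bandS r B}.indicator (Wf ν φ) g ≤ ENNReal.ofReal (5 * ω) * (bandS r B).indicator 1 (ra 1 g) := by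
    intro g
    by_cases hg : ra 1 g ∈ bandS r B
    · rw [Set.indicator_of_mem (by exact hg), Set.indicator_of_mem hg, Pi.one_apply, mul_one]
      have hu := ra_ne_zero (one_ne_zero : (1 : ℂ) ≠ 0) g
      obtain ⟨c, hc⟩ := Ph_ca (one_ne_zero : (1 : ℂ) ≠ 0) g
      generalize ra 1 g = u at hg hu hc
      have hun : 0 < ‖u‖ := norm_pos_iff.2 hu
      have e : ∫ x, φ (ca g x) ∂ν = ∫ x, f (Ph u x + c) * Complex.exp (((k * Ψ (Ph u x + c) : ℝ) : ℂ) * Complex.I) ∂ν := by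
        apply integral_congr_ae
        filter_upwards [hS.pr_ne hu] with x hx
        simp only [hφ]
        rw [hc x hx]
      rw [Wf, e, ← ofReal_norm_eq_enorm]
      apply ENNReal.ofReal_le_ofReal
      have hDle : 1 / (δ ^ 2 * ‖u‖ ^ 2) ≤ 1 / δ ^ 2 * |k| ^ (-(3 / 4) : ℝ) := by
        rw [Real.rpow_neg hkp.le, ← hr2, ← one_div, one_div_mul_one_div]
        apply one_div_le_one_div_of_le (by positivity)
        have := hg.1
        gcongr
      refine band_fix hS hfc hf1 hfs hΨ.continuous hL ha hT hω0 hω1 hδ hlm hδf hρ hk0 hu c (hDle.trans hk2) (hDle.trans hk3) ?_ ?_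
      · refine le_trans ?_ hk4
        calc |k| * (L * (1 / (δ ^ 2 * ‖u‖ ^ 2)) ^ 2) ≤ |k| * (L * (1 / δ ^ 2 * |k| ^ (-(3 / 4) : ℝ)) ^ 2) := by gcongr
          _ = L / δ ^ 4 * (|k| * (|k| ^ (-(3 / 4) : ℝ)) ^ 2) := by field_simp
          _ = L / δ ^ 4 * |k| ^ (-(1 / 2) : ℝ) := by
            congr 1
            rw [← Real.rpow_natCast, ← Real.rpow_mul hkp.le]
            nth_rw 1 [← Real.rpow_one |k|]
            rw [← Real.rpow_add hkp]; norm_num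
      · refine le_trans ?_ hk5
        rw [Real.mul_rpow hkp.le ha.le]
        calc _ ≤ |k| ^ (-(1/2) : ℝ) * a ^ (-(1/2) : ℝ) * (B * r) := by
              have := hg.2
              gcongr
          _ = a ^ (-(1/2) : ℝ) * B * (|k| ^ (-(1/2) : ℝ) * r) := by ring
          _ = _ := by
            congr 1
            rw [hr, ← Real.rpow_add hkp]; norm_num
    · rw [Set.indicator_of_notMem (by exact hg)]; exact zero_le
  have hbm := measurable_band_ind r B
  have h7 : ∫⁻ g, {g | ra 1 g ∈ bandS r B}.indicator (Wf ν φ) g ∂(Gr μ) ≤ ENNReal.ofReal (η / 2) := by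
    refine (lintegral_mono h6).trans ?_
    rw [lintegral_const_mul _ (by fun_prop)]
    have hgb := green_band hC hr0 hB0 (one_ne_zero : (1 : ℂ) ≠ 0)
    rw [hCb] at hgb
    refine (mul_le_mul_right hgb _).trans ?_
    rw [← ENNReal.ofReal_mul (by positivity)]
    exact ENNReal.ofReal_le_ofReal hω2
  have h8 := h5.trans (add_le_add h7 (ENNReal.ofReal_le_ofReal hB))
  rw [Wf, ← ENNReal.ofReal_add (by positivity) (by positivity), ← ofReal_norm_eq_enorm,
    ENNReal.ofReal_le_ofReal_iff (by positivity)] at h8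
  simp only [ca_one] at h8
  linarith

theorem raj_L1 (hS : Setup μ ν) {f : ℝ → ℂ} (hf : Integrable f (ν.map (Ph 1))) {Ψ : ℝ → ℝ} (hΨ : ContDiff ℝ 2 Ψ) (hΨ0 : ∀ t, deriv Ψ t ≠ 0) {η : ℝ} (hη : 0 < η) :
    ∃ K0 : ℝ, ∀ k : ℝ, K0 ≤ |k| → ‖∫ t, f t * Complex.exp (((k * Ψ t : ℝ) : ℂ) * Complex.I) ∂(ν.map (Ph 1))‖ ≤ η := by
  have hPm : Measurable (fun x => Ph 1 x) := by unfold Ph; fun_prop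
  have hΨm := hΨ.continuous.measurable
  obtain ⟨F, hFs, hFd, hFc, hFi⟩ := hf.exists_hasCompactSupport_integral_sub_le (half_pos hη)
  obtain ⟨b, hb⟩ := hFc.bounded_above_of_compact_support hFs
  set b' := max b 1 with hb'
  have hb0 : 0 < b' := by positivity
  obtain ⟨R, hR⟩ : ∃ R : ℝ, 0 < R ∧ ∀ t, R < |t| → F t = 0 := by
    obtain ⟨R, hR⟩ := hFs.isBounded.subset_closedBall (0 : ℝ)
    refine ⟨max R 1, by positivity, fun t ht => ?_⟩
    by_contra h
    have := hR (subset_tsupport _ h)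
    rw [mem_closedBall_zero_iff, Real.norm_eq_abs] at this
    have := (le_max_left R 1).trans_lt ht
    linarith
  obtain ⟨K0, hK0⟩ := raj_cc hS (f := fun t => (b' : ℂ)⁻¹ * F t) (by fun_prop) (fun t => by
    rw [norm_mul, norm_inv, Complex.norm_real, Real.norm_eq_abs, abs_of_pos hb0, inv_mul_le_iff₀ hb0, mul_one]
    exact (hb t).trans (le_max_left _ _)) hR.1 (fun t ht => by rw [hR.2 t ht, mul_zero]) hΨ hΨ0 (η := η / (2 * b')) (by positivity)
  refine ⟨K0, fun k hk => ?_⟩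
  have h1 := hK0 k hk
  have hE : Continuous (fun t => Complex.exp (((k * Ψ t : ℝ) : ℂ) * Complex.I)) := by
    have := hΨ.continuous
    fun_prop
  simp only [mul_assoc] at h1
  rw [integral_const_mul, norm_mul, norm_inv, Complex.norm_real, Real.norm_eq_abs, abs_of_pos hb0, inv_mul_le_iff₀ hb0] at h1
  have h2 : ‖∫ t, F t * Complex.exp (((k * Ψ t : ℝ) : ℂ) * Complex.I) ∂(ν.map (Ph 1))‖ ≤ η / 2 := by
    rw [integral_map hPm.aemeasurable (by exact (hFc.mul hE).aestronglyMeasurable)]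
    refine (le_trans ?_ h1).trans (le_of_eq (by field_simp))
    exact le_rfl
  have hEb : ∀ t, ‖Complex.exp (((k * Ψ t : ℝ) : ℂ) * Complex.I)‖ ≤ 1 := fun t => (Complex.norm_exp_ofReal_mul_I _).le
  have i1 : Integrable (fun t => f t * Complex.exp (((k * Ψ t : ℝ) : ℂ) * Complex.I)) (ν.map (Ph 1)) :=
    hf.mul_bdd (c := 1) hE.aestronglyMeasurable (Eventually.of_forall hEb)
  have i2 : Integrable (fun t => F t * Complex.exp (((k * Ψ t : ℝ) : ℂ) * Complex.I)) (ν.map (Ph 1)) :=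
    hFi.mul_bdd (c := 1) hE.aestronglyMeasurable (Eventually.of_forall hEb)
  have e : ∫ t, f t * Complex.exp (((k * Ψ t : ℝ) : ℂ) * Complex.I) ∂(ν.map (Ph 1)) =
      ∫ t, (f t * Complex.exp (((k * Ψ t : ℝ) : ℂ) * Complex.I) - F t * Complex.exp (((k * Ψ t : ℝ) : ℂ) * Complex.I)) ∂(ν.map (Ph 1)) +
      ∫ t, F t * Complex.exp (((k * Ψ t : ℝ) : ℂ) * Complex.I) ∂(ν.map (Ph 1)) := by
    rw [integral_sub i1 i2]; ring
  have h3 : ‖∫ t, (f t * Complex.exp (((k * Ψ t : ℝ) : ℂ) * Complex.I) - F t * Complex.exp (((k * Ψ t : ℝ) : ℂ) * Complex.I)) ∂(ν.map (Ph 1))‖ ≤ η / 2 := by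
    refine (norm_integral_le_integral_norm _).trans (le_trans (le_of_eq ?_) hFd)
    congr 1
    ext t
    rw [← sub_mul, norm_mul, Complex.norm_exp_ofReal_mul_I, mul_one]
  rw [e]
  refine (norm_add_le _ _).trans ?_
  linarith

end

end

section

open scoped ENNReal NNReal Topology

instance : BorelSpace PX := ⟨rfl⟩

/-- complex number attached to a vector -/
def vz (v : Fin 2 → ℝ) : ℂ := ⟨v 0, v 1⟩

theorem vz_smul (c : ℝ) (v : Fin 2 → ℝ) : vz (c • v) = c * vz v := by
  apply Complex.ext <;> simp [vz]

theorem vz_ne {v : Fin 2 → ℝ} (hv : v ≠ 0) : vz v ≠ 0 := by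
  intro h
  apply hv
  have h1 := congrArg Complex.re h
  have h2 := congrArg Complex.im h
  ext i; fin_cases i
  · exact h1
  · exact h2

theorem vz_cont : Continuous vz := by
  have : vz = fun v => (v 0 : ℂ) + (v 1 : ℂ) * Complex.I := by
    ext v; apply Complex.ext <;> simp [vz]
  rw [this]; fun_prop

/-- double angle map -/
def dang (x : PX) : ℂ :=
  Projectivization.lift (K := ℝ) (V := Fin 2 → ℝ) (fun v => vz v.1 ^ 2 / (‖vz v.1‖ : ℂ) ^ 2) (by
    rintro ⟨a, ha⟩ ⟨b, hb⟩ t h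
    have h' : a = t • b := h
    subst h'
    have ht : t ≠ 0 := by rintro rfl; simp at ha
    simp only [vz_smul, norm_mul, Complex.norm_real, Real.norm_eq_abs]
    have hn := norm_ne_zero_iff.2 (vz_ne hb)
    have h1 : ((|t| : ℝ) : ℂ) ^ 2 = (t : ℂ) ^ 2 := by exact_mod_cast sq_abs t
    push_cast
    rw [mul_pow, mul_pow, h1, mul_div_mul_left _ _ (pow_ne_zero 2 (by exact_mod_cast ht))]) x

theorem dang_cont : Continuous dang := by
  refine continuous_quot_lift _ ?_
  have h1 : Continuous (fun v : {v : Fin 2 → ℝ // v ≠ 0} => vz v.1) := vz_cont.comp continuous_subtype_val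
  refine (h1.pow 2).div ?_ ?_
  · fun_prop
  · intro v
    exact pow_ne_zero 2 (by exact_mod_cast norm_ne_zero_iff.2 (vz_ne v.2))

/-- measurable unit representative -/
def sig (x : PX) : ℂ := Complex.exp ((Complex.arg (dang x) / 2 : ℝ) * Complex.I)

theorem sig_meas : Measurable sig := by
  have := dang_cont.measurable
  unfold sig
  fun_prop

theorem sig_norm (x : PX) : ‖sig x‖ = 1 := Complex.norm_exp_ofReal_mul_I _

theorem sig_mk (v : Fin 2 → ℝ) (hv : v ≠ 0) : ∃ c : ℝ, c ≠ 0 ∧ sig (Projectivization.mk ℝ v hv) = c * vz v := by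
  have hz := vz_ne hv
  have hn := norm_ne_zero_iff.2 hz
  set z := vz v with hzd
  have hd : dang (Projectivization.mk ℝ v hv) = z ^ 2 / (‖z‖ : ℂ) ^ 2 := rfl
  have hd1 : ‖dang (Projectivization.mk ℝ v hv)‖ = 1 := by
    rw [hd, norm_div, norm_pow, norm_pow, Complex.norm_real, norm_norm, div_self (pow_ne_zero 2 hn)]
  have hs : sig (Projectivization.mk ℝ v hv) ^ 2 = (z / (‖z‖ : ℂ)) ^ 2 := by
    rw [div_pow, ← hd, sig, ← Complex.exp_nat_mul]
    conv_rhs => rw [← Complex.norm_mul_exp_arg_mul_I (dang (Projectivization.mk ℝ v hv)), hd1]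
    push_cast; rw [one_mul]; congr 1; ring
  rcases sq_eq_sq_iff_eq_or_eq_neg.1 hs with h | h
  · refine ⟨‖z‖⁻¹, inv_ne_zero hn, ?_⟩
    rw [h]; push_cast; rw [div_eq_inv_mul]
  · refine ⟨-‖z‖⁻¹, neg_ne_zero.2 (inv_ne_zero hn), ?_⟩
    rw [h]; push_cast; rw [div_eq_inv_mul]; ring

theorem ca_vz (g : SL2) (v : Fin 2 → ℝ) : ca g (vz v) = vz ((g : Matrix (Fin 2) (Fin 2) ℝ).mulVec v) := by
  apply Complex.ext <;> simp [ca, vz, Matrix.mulVec, dotProduct, Fin.sum_univ_two]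

theorem sig_act (g : SL2) (x : PX) : ∃ c : ℝ, c ≠ 0 ∧ sig (act g x) = c * ca g (sig x) := by
  induction x using Projectivization.ind with
  | h v hv =>
    obtain ⟨c, hc, h⟩ := sig_mk v hv
    have e : act g (Projectivization.mk ℝ v hv) = Projectivization.mk ℝ ((Matrix.SpecialLinearGroup.toLin' g) v)
      (by simpa using hv) := rfl
    obtain ⟨c2, hc2, h2⟩ := sig_mk ((Matrix.SpecialLinearGroup.toLin' g) v) (by simpa using hv)
    refine ⟨c2 / c, div_ne_zero hc2 hc, ?_⟩
    rw [e, h2, h, ca_smul, ca_vz]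
    have hc' : (c : ℂ) ≠ 0 := by exact_mod_cast hc
    push_cast
    rw [Matrix.SpecialLinearGroup.toLin'_apply, Matrix.toLin'_apply]
    field_simp

theorem act_meas (g : SL2) : Measurable (act g) := by
  refine Continuous.measurable ?_
  refine continuous_coinduced_dom.2 ?_
  have h1 : Continuous (fun v : {v : Fin 2 → ℝ // v ≠ 0} => (⟨(Matrix.SpecialLinearGroup.toLin' g) v.1, by simpa using v.2⟩ : {v : Fin 2 → ℝ // v ≠ 0})) := by
    refine Continuous.subtype_mk ?_ _
    exact (LinearMap.continuous_of_finiteDimensional (Matrix.SpecialLinearGroup.toLin' g).toLinearMap).comp continuous_subtype_val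
  have h2 : Continuous (fun v : {v : Fin 2 → ℝ // v ≠ 0} => (Projectivization.mk' ℝ v : PX)) := continuous_coinduced_rng
  exact h2.comp h1

theorem NN_le_opNorm (g : SL2) : NN g ≤ 2 * opNorm g := by
  have hent : ∀ i j, |g.1 i j| ≤ opNorm g := by
    intro i j
    have h1 := (Matrix.toEuclideanCLM (𝕜 := ℝ) (n := Fin 2) (g : Matrix (Fin 2) (Fin 2) ℝ)).le_opNorm (EuclideanSpace.single j 1)
    have h2 := PiLp.norm_apply_le (Matrix.toEuclideanCLM (𝕜 := ℝ) (n := Fin 2) (g : Matrix (Fin 2) (Fin 2) ℝ) (EuclideanSpace.single j 1)) i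
    have h3 : (Matrix.toEuclideanCLM (𝕜 := ℝ) (n := Fin 2) (g : Matrix (Fin 2) (Fin 2) ℝ) (EuclideanSpace.single j 1)) i = g.1 i j := by
      simp
    rw [h3] at h2
    simp at h1
    exact h2.trans h1
  have h0 : 0 ≤ opNorm g := norm_nonneg _
  refine abs_le_of_sq_le_sq' ?_ (by positivity) |>.2
  have hq : ∀ i j, g.1 i j ^ 2 ≤ opNorm g ^ 2 := fun i j => sq_le_sq' (abs_le.1 (hent i j)).1 (abs_le.1 (hent i j)).2
  have := hq 0 0
  have := hq 0 1
  have := hq 1 0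
  have := hq 1 1
  rw [NN_sq]
  nlinarith

theorem setup_of {μ : Measure SL2} [IsProbabilityMeasure μ] (hmom : HasExpMoment μ) (hzd : ZariskiDense μ)
    {ν : Measure PX} [IsProbabilityMeasure ν] (hstat : IsMuStationary μ ν) :
    Setup ((2⁻¹ : ℝ≥0∞) • Measure.dirac 1 + (2⁻¹ : ℝ≥0∞) • μ) (ν.map sig) := by
  have hst : ∀ φ : ℂ → ℝ≥0∞, Measurable φ → (∀ (c : ℝ) (x : ℂ), c ≠ 0 → φ (c * x) = φ x) →
    ∫⁻ x, φ x ∂(ν.map sig) = ∫⁻ g, ∫⁻ x, φ (ca g x) ∂(ν.map sig) ∂μ := by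
    intro φ hφ hh
    have hae : AEMeasurable (fun g => ν.map (act g)) μ := by
      by_contra hcon
      have h0 : ν = 0 := by
        rw [← hstat, Measure.bind, Measure.map_of_not_aemeasurable hcon]; simp
      exact IsProbabilityMeasure.ne_zero ν h0
    rw [lintegral_map hφ sig_meas]
    conv_lhs => rw [← hstat]
    rw [Measure.lintegral_bind hae (f := fun x => φ (sig x)) (by exact (hφ.comp sig_meas).aemeasurable)]
    congr 1; ext g
    have hcm : Measurable (fun x => φ (ca g x)) := by fun_prop
    rw [lintegral_map (f := fun x => φ (sig x)) (by exact hφ.comp sig_meas) (act_meas g), lintegral_map hcm sig_meas]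
    congr 1; ext x
    obtain ⟨c, hc, h⟩ := sig_act g x
    rw [h, hh c _ hc]
  refine ⟨?_, ?_, ?_, ?_, ?_⟩
  · simp
  · obtain ⟨e, he, hm⟩ := hmom
    refine ⟨e, he, ?_⟩
    rw [lintegral_add_measure, lintegral_smul_measure, lintegral_smul_measure, lintegral_dirac]
    refine ENNReal.add_lt_top.2 ⟨ENNReal.mul_lt_top (by simp) ENNReal.ofReal_lt_top, ENNReal.mul_lt_top (by simp) ?_⟩
    calc ∫⁻ g, ENNReal.ofReal (NN g ^ e) ∂μ ≤ ∫⁻ g, ENNReal.ofReal (2 ^ e) * ENNReal.ofReal (opNorm g ^ e) ∂μ := by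
          refine lintegral_mono fun g => ?_
          rw [← ENNReal.ofReal_mul (by positivity), ← Real.mul_rpow (by norm_num) (by exact norm_nonneg _ : 0 ≤ opNorm g)]
          apply ENNReal.ofReal_le_ofReal
          exact Real.rpow_le_rpow (NN_nonneg g) (NN_le_opNorm g) he.le
      _ = ENNReal.ofReal (2 ^ e) * ∫⁻ g, ENNReal.ofReal (opNorm g ^ e) ∂μ := lintegral_const_mul' _ _ ENNReal.ofReal_ne_top
      _ < ⊤ := ENNReal.mul_lt_top ENNReal.ofReal_lt_top hm
  · intro hsol
    apply hzd
    have hsub : Subgroup.closure (measSupp μ) ≤ Subgroup.closure (measSupp ((2⁻¹ : ℝ≥0∞) • Measure.dirac 1 + (2⁻¹ : ℝ≥0∞) • μ)) := by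
      apply Subgroup.closure_mono
      intro g hg U hU hgU
      have := hg U hU hgU
      rw [Measure.add_apply, Measure.smul_apply, Measure.smul_apply]
      refine lt_of_lt_of_le ?_ le_add_self
      exact ENNReal.mul_pos (by simp) this.ne'
    haveI : Group.IsSolvable (Subgroup.closure (measSupp ((2⁻¹ : ℝ≥0∞) • Measure.dirac 1 + (2⁻¹ : ℝ≥0∞) • μ))) := hsol
    exact solvable_of_solvable_injective (Subgroup.inclusion_injective hsub)
  · exact (ae_map_iff sig_meas.aemeasurable (measurableSet_eq_fun (by fun_prop) measurable_const)).2 (Eventually.of_forall sig_norm)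
  · intro φ hφ hh
    rw [lintegral_add_measure, lintegral_smul_measure, lintegral_smul_measure, lintegral_dirac, ← hst φ hφ hh]
    simp only [ca_one, smul_eq_mul]
    rw [← add_mul, ENNReal.inv_two_add_inv_two, one_mul]

instance lazy_prob {μ : Measure SL2} [IsProbabilityMeasure μ] : IsProbabilityMeasure ((2⁻¹ : ℝ≥0∞) • Measure.dirac 1 + (2⁻¹ : ℝ≥0∞) • μ) := by
  constructor
  simp [ENNReal.inv_two_add_inv_two]

end

section

open scoped ENNReal NNReal Topology

theorem arg_cases {a b : ℝ} (ha : a ≠ 0) :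
    Complex.arg ((a : ℂ) + (b : ℂ) * Complex.I) = Real.arctan (b / a) + 0 ∨
    Complex.arg ((a : ℂ) + (b : ℂ) * Complex.I) = Real.arctan (b / a) + (if b / a ≤ 0 then Real.pi else -Real.pi) := by
  set z : ℂ := (a : ℂ) + (b : ℂ) * Complex.I with hz
  have hre : z.re = a := by simp [hz]
  have him : z.im = b := by simp [hz]
  have htan : Real.tan (Complex.arg z) = b / a := by rw [Complex.tan_arg, hre, him]
  have hpi := Real.pi_pos
  rcases lt_or_gt_of_ne ha with h | h
  · right
    have h1 : ¬ |Complex.arg z| ≤ Real.pi / 2 := by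
      rw [Complex.abs_arg_le_pi_div_two_iff, hre]; linarith
    rcases le_or_gt 0 b with hb | hb
    · have h2 : 0 ≤ Complex.arg z := Complex.arg_nonneg_iff.2 (by rw [him]; exact hb)
      rw [abs_of_nonneg h2] at h1
      have h3 := Complex.arg_le_pi z
      rw [if_pos (div_nonpos_of_nonneg_of_nonpos hb h.le), ← htan, ← Real.tan_sub_pi, Real.arctan_tan (by linarith) (by linarith)]
      ring
    · have h2 : Complex.arg z < 0 := Complex.arg_neg_iff.2 (by rw [him]; exact hb)
      rw [abs_of_neg h2] at h1
      have h3 := Complex.neg_pi_lt_arg z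
      rw [if_neg (not_le.2 (div_pos_of_neg_of_neg hb h)), ← htan, ← Real.tan_add_pi, Real.arctan_tan (by linarith) (by linarith)]
      ring
  · left
    have h1 : |Complex.arg z| < Real.pi / 2 := by
      rw [Complex.abs_arg_lt_pi_div_two_iff, hre]; exact Or.inl h
    rw [← htan, Real.arctan_tan (abs_lt.1 h1).1 (abs_lt.1 h1).2, add_zero]

theorem selector {X : Type*} [MeasurableSpace X] {ν : Measure X} (h F0 F1 : ℤ → X → ℂ)
    (h0 : ∀ k, Measurable (F0 k)) (h1 : ∀ k, Measurable (F1 k)) (E : Set X)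
    (hE : ∀ᵐ x ∂ν, ∀ k, (x ∈ E → h k x = F0 k x) ∧ (x ∉ E → h k x = F1 k x)) :
    ∃ A : Set X, MeasurableSet A ∧ ∀ k, AEStronglyMeasurable (h k) ν →
      ∀ᵐ x ∂ν, (x ∈ A → h k x = F0 k x) ∧ (x ∉ A → h k x = F1 k x) := by
  classical
  have hS : ∀ k : ℤ, AEStronglyMeasurable (h k) ν → NullMeasurableSet ({x | h k x = F0 k x} ∩ {x | F0 k x = F1 k x}ᶜ) ν := by
    intro k hk
    refine NullMeasurableSet.inter (nullMeasurableSet_eq_fun hk.aemeasurable (h0 k).aemeasurable) ?_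
    exact (nullMeasurableSet_eq_fun (h0 k).aemeasurable (h1 k).aemeasurable).compl
  set A0 : Set X := ⋃ k : ℤ, ⋃ _ : AEStronglyMeasurable (h k) ν, ({x | h k x = F0 k x} ∩ {x | F0 k x = F1 k x}ᶜ) with hA0
  have hA : NullMeasurableSet A0 ν := NullMeasurableSet.iUnion fun k => NullMeasurableSet.iUnion fun hk => hS k hk
  obtain ⟨A, hAm, hAe⟩ := hA
  refine ⟨A, hAm, fun k hk => ?_⟩
  filter_upwards [hE, hAe.mem_iff] with x hx hxA
  rw [← hxA]
  constructor
  · intro hm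
    rw [hA0] at hm
    simp only [Set.mem_iUnion] at hm
    obtain ⟨l, hl, hl1, hl2⟩ := hm
    have hl1' : h l x = F0 l x := hl1
    have hl2' : ¬ F0 l x = F1 l x := hl2
    by_cases hxE : x ∈ E
    · exact (hx k).1 hxE
    · exact absurd (hl1'.symm.trans ((hx l).2 hxE)) hl2'
  · intro hm
    by_cases hxE : x ∈ E
    · have e := (hx k).1 hxE
      by_cases e2 : F0 k x = F1 k x
      · exact e.trans e2
      · exfalso; apply hm
        rw [hA0]; simp only [Set.mem_iUnion]
        exact ⟨k, hk, e, e2⟩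
    · exact (hx k).2 hxE

/-- affine chart -/
def jch (t : ℝ) : PX := Projectivization.mk ℝ ![1, t] (by intro h; simpa using congrFun h 0)

theorem jch_meas : Measurable jch := by
  refine Continuous.measurable ?_
  have h2 : Continuous (fun v : {v : Fin 2 → ℝ // v ≠ 0} => (Projectivization.mk' ℝ v : PX)) := continuous_coinduced_rng
  have h1 : Continuous (fun t : ℝ => (⟨![1, t], by intro h; simpa using congrFun h 0⟩ : {v : Fin 2 → ℝ // v ≠ 0})) := by
    refine Continuous.subtype_mk ?_ _
    refine continuous_pi fun i => ?_
    fin_cases i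
    · exact continuous_const
    · exact continuous_id
  exact h2.comp h1

theorem Ph1 (x : ℂ) : Ph 1 x = x.im / x.re := by
  simp [Ph, dt, pr]

theorem chart_facts (x : PX) (hx : (sig x).re ≠ 0) : x.rep 0 ≠ 0 ∧ Ph 1 (sig x) = x.rep 1 / x.rep 0 ∧ jch (Ph 1 (sig x)) = x := by
  obtain ⟨c, hc, h⟩ := sig_mk x.rep x.rep_nonzero
  rw [Projectivization.mk_rep] at h
  have hre : (sig x).re = c * x.rep 0 := by rw [h]; simp [vz]
  have him : (sig x).im = c * x.rep 1 := by rw [h]; simp [vz]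
  have h0 : x.rep 0 ≠ 0 := by
    intro h0; apply hx; rw [hre, h0, mul_zero]
  have hP : Ph 1 (sig x) = x.rep 1 / x.rep 0 := by
    rw [Ph1, hre, him, mul_div_mul_left _ _ hc]
  refine ⟨h0, hP, ?_⟩
  rw [hP]
  conv_rhs => rw [← x.mk_rep]
  rw [jch, Projectivization.mk_eq_mk_iff']
  refine ⟨(x.rep 0)⁻¹, ?_⟩
  ext i; fin_cases i
  · simp [h0]
  · simp [div_eq_inv_mul]

theorem psi_c {Φ : ℝ → ℝ} (hΦ : ContDiff ℝ 2 Φ) (hΦ' : ∀ θ, deriv Φ θ ≠ 0) (c : ℝ) :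
    ContDiff ℝ 2 (fun t => 2 * Φ (Real.arctan t + c)) ∧ ∀ t, deriv (fun t => 2 * Φ (Real.arctan t + c)) t ≠ 0 := by
  constructor
  · exact contDiff_const.mul (hΦ.comp (Real.contDiff_arctan.add contDiff_const))
  · intro t
    have h1 : HasDerivAt (fun t => Real.arctan t + c) (1 / (1 + t ^ 2)) t := (Real.hasDerivAt_arctan t).add_const c
    have h2 : HasDerivAt Φ (deriv Φ (Real.arctan t + c)) (Real.arctan t + c) := (hΦ.differentiable (by norm_num) _).hasDerivAt
    have h3 := (h2.comp t h1).const_mul 2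
    have e : deriv (fun t => 2 * Φ (Real.arctan t + c)) t = 2 * (deriv Φ (Real.arctan t + c) * (1 / (1 + t ^ 2))) := h3.deriv
    rw [e]
    have := hΦ' (Real.arctan t + c)
    positivity

/-- the oscillating factor -/
def Eo (Φ : ℝ → ℝ) (c : ℝ) (k : ℤ) (t : ℝ) : ℂ :=
  Complex.exp ((((k : ℝ) * (2 * Φ (Real.arctan t + c)) : ℝ) : ℂ) * Complex.I)

theorem Eo_meas {Φ : ℝ → ℝ} (hΦ : ContDiff ℝ 2 Φ) (c : ℝ) (k : ℤ) : Measurable (Eo Φ c k) := by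
  have := hΦ.continuous.measurable
  unfold Eo
  fun_prop

theorem Eo_norm (Φ : ℝ → ℝ) (c : ℝ) (k : ℤ) (t : ℝ) : ‖Eo Φ c k t‖ = 1 := Complex.norm_exp_ofReal_mul_I _

theorem final_aux (μ : Measure SL2) [IsProbabilityMeasure μ]
    (hmom : HasExpMoment μ) (hzd : ZariskiDense μ)
    (ν : Measure PX) [IsProbabilityMeasure ν] (hstat : IsMuStationary μ ν)
    (Φ : ℝ → ℝ) (hΦ : ContDiff ℝ 2 Φ) (hΦ' : ∀ θ, deriv Φ θ ≠ 0) :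
    Filter.Tendsto
      (fun k : ℤ => ∫ x : PX, Complex.exp (2 * k * Complex.I * (Φ (pangle x) : ℂ)) ∂ν)
      Filter.cofinite (nhds (0 : ℂ)) := by
  classical
  have hS := setup_of hmom hzd hstat
  haveI : IsProbabilityMeasure (ν.map sig) := Measure.isProbabilityMeasure_map sig_meas.aemeasurable
  have hPm : Measurable (fun x => Ph 1 x) := by unfold Ph; fun_prop
  set T : PX → ℝ := fun x => Ph 1 (sig x) with hT
  have hTm : Measurable T := hPm.comp sig_meas
  have hmap : (ν.map sig).map (Ph 1) = ν.map T := Measure.map_map hPm sig_meas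
  haveI : IsProbabilityMeasure (ν.map T) := Measure.isProbabilityMeasure_map hTm.aemeasurable
  have hre : ∀ᵐ x ∂ν, (sig x).re ≠ 0 := by
    have := ae_of_ae_map sig_meas.aemeasurable (hS.pr_ne one_ne_zero)
    filter_upwards [this] with x hx
    simpa [pr] using hx
  set h : ℤ → PX → ℂ := fun k x => Complex.exp (2 * k * Complex.I * (Φ (pangle x) : ℂ)) with hh
  set F0 : ℤ → PX → ℂ := fun k x => Eo Φ 0 k (T x) with hF0
  set F1 : ℤ → PX → ℂ := fun k x => if T x ≤ 0 then Eo Φ Real.pi k (T x) else Eo Φ (-Real.pi) k (T x) with hF1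
  have hF0m : ∀ k, Measurable (F0 k) := fun k => (Eo_meas hΦ 0 k).comp hTm
  have hF1m : ∀ k, Measurable (F1 k) := fun k =>
    Measurable.ite (measurableSet_le hTm measurable_const) ((Eo_meas hΦ _ k).comp hTm) ((Eo_meas hΦ _ k).comp hTm)
  have heq : ∀ k x c, pangle x = Real.arctan (T x) + c → h k x = Eo Φ c k (T x) := by
    intro k x c e
    simp only [hh, Eo, e]
    congr 1; push_cast; ring
  obtain ⟨A, hAm, hA⟩ := selector (ν := ν) h F0 F1 hF0m hF1m {x | pangle x = Real.arctan (T x) + 0} (by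
    filter_upwards [hre] with x hx k
    obtain ⟨ha, hTx, _⟩ := chart_facts x hx
    constructor
    · intro hxE
      exact heq k x 0 hxE
    · intro hxE
      have hxE' : ¬ (pangle x = Real.arctan (T x) + 0) := hxE
      have hTx' : T x = x.rep 1 / x.rep 0 := hTx
      have hc := arg_cases (b := x.rep 1) ha
      rw [← hTx'] at hc
      rcases hc with hc | hc
      · exact absurd hc hxE'
      · have hc' : pangle x = _ := hc
        have := heq k x _ hc'
        rw [this]
        simp only [hF1]
        split_ifs <;> rfl)
  set B : Set ℝ := jch ⁻¹' A with hB
  have hBm : MeasurableSet B := jch_meas hAm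
  set l := ν.map T with hl
  set f0 : ℝ → ℂ := B.indicator (fun _ => 1) with hf0
  set f1 : ℝ → ℂ := (Bᶜ ∩ Set.Iic 0).indicator (fun _ => 1) with hf1
  set f2 : ℝ → ℂ := (Bᶜ ∩ (Set.Iic 0)ᶜ).indicator (fun _ => 1) with hf2
  have hi0 : Integrable f0 l := (integrable_const _).indicator hBm
  have hi1 : Integrable f1 l := (integrable_const _).indicator (hBm.compl.inter measurableSet_Iic)
  have hi2 : Integrable f2 l := (integrable_const _).indicator (hBm.compl.inter measurableSet_Iic.compl)
  have hmulE : ∀ (f : ℝ → ℂ) (c : ℝ) (k : ℤ), Integrable f l → Integrable (fun t => f t * Eo Φ c k t) l := by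
    intro f c k hf
    refine hf.mul_bdd (c := 1) (Eo_meas hΦ c k).aestronglyMeasurable (Eventually.of_forall fun t => (Eo_norm Φ c k t).le)
  have hintg : ∀ k, AEStronglyMeasurable (h k) ν → ∫ x, h k x ∂ν =
      ∫ t, f0 t * Eo Φ 0 k t ∂l + ∫ t, f1 t * Eo Φ Real.pi k t ∂l + ∫ t, f2 t * Eo Φ (-Real.pi) k t ∂l := by
    intro k hk
    rw [← integral_add (hmulE _ _ _ hi0) (hmulE _ _ _ hi1), ← integral_add (f := fun t => f0 t * Eo Φ 0 k t + f1 t * Eo Φ Real.pi k t) (by exact (hmulE _ _ _ hi0).add (hmulE _ _ _ hi1)) (hmulE _ _ _ hi2)]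
    rw [hl, integral_map hTm.aemeasurable (by
      rw [← hl]
      exact (((hmulE _ _ _ hi0).add (hmulE _ _ _ hi1)).add (hmulE _ _ _ hi2)).aestronglyMeasurable)]
    refine integral_congr_ae ?_
    filter_upwards [hre, hA k hk] with x hx hxA
    have hj : jch (T x) = x := (chart_facts x hx).2.2
    have hBA : T x ∈ B ↔ x ∈ A := by rw [hB, Set.mem_preimage, hj]
    by_cases hxa : x ∈ A
    · have hb : T x ∈ B := hBA.2 hxa
      rw [hxA.1 hxa]
      simp [hf0, hf1, hf2, hb, hF0]
    · have hb : T x ∉ B := fun hb => hxa (hBA.1 hb)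
      rw [hxA.2 hxa]
      by_cases h0 : T x ≤ 0
      · simp [hf0, hf1, hf2, hb, hF1, h0]
      · simp [hf0, hf1, hf2, hb, hF1, h0, not_le.1 h0]
  rw [Metric.tendsto_nhds]
  intro η hη
  have h4 : 0 < η / 4 := by linarith
  obtain ⟨K0, hK0⟩ := raj_L1 hS (f := f0) (by rw [hmap]; exact hi0) (psi_c hΦ hΦ' 0).1 (psi_c hΦ hΦ' 0).2 h4
  obtain ⟨K1, hK1⟩ := raj_L1 hS (f := f1) (by rw [hmap]; exact hi1) (psi_c hΦ hΦ' Real.pi).1 (psi_c hΦ hΦ' Real.pi).2 h4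
  obtain ⟨K2, hK2⟩ := raj_L1 hS (f := f2) (by rw [hmap]; exact hi2) (psi_c hΦ hΦ' (-Real.pi)).1 (psi_c hΦ hΦ' (-Real.pi)).2 h4
  rw [hmap] at hK0 hK1 hK2
  rw [Filter.eventually_cofinite]
  set K := max K0 (max K1 K2) with hK
  refine (Set.finite_Icc (-⌈K⌉) ⌈K⌉).subset ?_
  intro k hk
  have hk' : ¬ dist (∫ x, h k x ∂ν) 0 < η := hk
  by_contra hcon
  apply hk'
  have hKk : K ≤ |(k : ℝ)| := by
    by_contra hlt
    rw [not_le] at hlt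
    apply hcon
    have h1 := Int.le_ceil K
    have h2 := abs_lt.1 hlt
    constructor
    · have : ((-⌈K⌉ : ℤ) : ℝ) ≤ (k : ℝ) := by push_cast; linarith
      exact_mod_cast this
    · have : (k : ℝ) ≤ ((⌈K⌉ : ℤ) : ℝ) := by linarith
      exact_mod_cast this
  have a0 : K0 ≤ |(k : ℝ)| := (le_max_left _ _).trans hKk
  have a1 : K1 ≤ |(k : ℝ)| := ((le_max_left _ _).trans (le_max_right _ _)).trans hKk
  have a2 : K2 ≤ |(k : ℝ)| := ((le_max_right _ _).trans (le_max_right _ _)).trans hKk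
  have b0 : ‖∫ t, f0 t * Eo Φ 0 k t ∂l‖ ≤ η / 4 := hK0 k a0
  have b1 : ‖∫ t, f1 t * Eo Φ Real.pi k t ∂l‖ ≤ η / 4 := hK1 k a1
  have b2 : ‖∫ t, f2 t * Eo Φ (-Real.pi) k t ∂l‖ ≤ η / 4 := hK2 k a2
  rw [dist_zero_right]
  by_cases hm : AEStronglyMeasurable (h k) ν
  · rw [hintg k hm]
    refine lt_of_le_of_lt (norm_add₃_le) ?_
    linarith
  · rw [integral_non_aestronglyMeasurable hm, norm_zero]
    exact hη

end


theorem pushforward_by_diffeo_rajchman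
    {π : ℝ} (μ : Measure SL2) [IsProbabilityMeasure μ]
    (hmom : HasExpMoment μ) (hzd : ZariskiDense μ)
    (ν : Measure PX) [IsProbabilityMeasure ν] (hstat : IsMuStationary μ ν)
    (Φ : ℝ → ℝ) (hΦ : ContDiff ℝ 2 Φ) (hΦ' : ∀ θ, deriv Φ θ ≠ 0)
    (hdeg : ∃ e : ℤ, (e = 1 ∨ e = -1) ∧ ∀ θ : ℝ, Φ (θ + π) = Φ θ + e * π) :
    Filter.Tendsto
      (fun k : ℤ => ∫ x : PX, Complex.exp (2 * k * Complex.I * (Φ (pangle x) : ℂ)) ∂ν)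
      Filter.cofinite (nhds (0 : ℂ)) := by
  exact final_aux μ hmom hzd ν hstat Φ hΦ hΦ'

end
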